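/- arXiv:1310.1198 — 5 statements merged into one kernel-verified Lean document; each statement's English description precedes it below -/
import Mathlib

section
/- Let {F_n : n ∈ ℕ} be a Følner sequence of a countably infinite discrete group G, and let T_1, T_2 ∈ 𝒯_G tile G self-similarly, with tiling subgroups G_{T_1}, G_{T_2} and isomorphisms π_{T_1} : G → G_{T_1}, π_{T_2} : G → G_{T_2}. If there exists a finite set T ⊆ G_{T_1} that tiles the group G_{T_1} and such that {Tg : g ∈ G_{T_2}} forms a partition of G_{T_1}, then {T π_{T_2}(F_n) : n ∈ ℕ} is a Følner sequence of G_{T_1}; moreover, if every F_n tiles G, then every T π_{T_2}(F_n) tiles G_{T_1}. -/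
open Filter Topology
open scoped symmDiff Pointwise

/-- `F` is a Følner sequence of `G`. -/
def IsFolner {G : Type*} [Group G] [DecidableEq G] (F : ℕ → Finset G) : Prop :=
  (∀ n, (F n).Nonempty) ∧
    ∀ g : G, Tendsto (fun n => ((((F n).image (g * ·)) ∆ (F n)).card : ℝ) / ((F n).card : ℝ))
      atTop (𝓝 0)

/-- `T` tiles `G` with set of tiling centers `C`: the right translates `{T c : c ∈ C}` form a
partition of `G`. -/
def TilesWith {G : Type*} [Group G] (T : Finset G) (C : Set G) : Prop :=
  ∀ x : G, ∃! c : G, c ∈ C ∧ ∃ t ∈ T, x = t * c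

/-- A non-empty finite subset `T` tiles `G` if some family of right translates forms a
partition of `G`. -/
def Tiles {G : Type*} [Group G] (T : Finset G) : Prop :=
  T.Nonempty ∧ ∃ C : Set G, TilesWith T C

/-- If left multiplication by `h` sends each `t ∈ T` into `T * φ (g t)`, then the translate of
`T * φ(F)` by `h` differs from `T * φ(F)` by at most twice the sum of the differences between
`g t * F` and `F`. -/
theorem card_image_mul_symmDiff_le {G K : Type*} [Group G] [Group K] [DecidableEq G]
    [DecidableEq K] (φ : G →* K) (T : Finset K) (F : Finset G) (h : K) (g : K → G)
    (hg : ∀ t ∈ T, ∃ t' ∈ T, h * t = t' * φ (g t)) :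
    (((T * F.image φ).image (h * ·)) ∆ (T * F.image φ)).card
      ≤ 2 * ∑ t ∈ T, ((F.image (g t * ·)) ∆ F).card := by
  choose! s hs hst using hg
  set A := T * F.image φ with hA
  have hcard : (A.image (h * ·)).card = A.card :=
    Finset.card_image_of_injective _ (mul_right_injective h)
  have hsub : A.image (h * ·) \ A ⊆
      T.biUnion fun t => ((F.image (g t * ·)) ∆ F).image fun x => s t * φ x := by
    intro x hx
    obtain ⟨hx, hxA⟩ := Finset.mem_sdiff.1 hx
    obtain ⟨a, ha, rfl⟩ := Finset.mem_image.1 hx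
    obtain ⟨t, ht, b, hb, rfl⟩ := Finset.mem_mul.1 ha
    obtain ⟨f, hf, rfl⟩ := Finset.mem_image.1 hb
    have key : h * (t * φ f) = s t * φ (g t * f) := by
      rw [map_mul, ← mul_assoc, hst t ht, mul_assoc]
    refine Finset.mem_biUnion.2 ⟨t, ht, Finset.mem_image.2 ⟨g t * f, ?_, key.symm⟩⟩
    refine Finset.mem_symmDiff.2 (Or.inl ⟨Finset.mem_image_of_mem _ hf, fun hgf => hxA ?_⟩)
    rw [key]
    exact Finset.mul_mem_mul (hs t ht) (Finset.mem_image_of_mem _ hgf)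
  have hle : (A.image (h * ·) \ A).card ≤ ∑ t ∈ T, ((F.image (g t * ·)) ∆ F).card :=
    (Finset.card_le_card hsub).trans <| Finset.card_biUnion_le.trans <|
      Finset.sum_le_sum fun _ _ => Finset.card_image_le
  calc _ ≤ (A.image (h * ·) \ A).card + (A \ A.image (h * ·)).card := Finset.card_union_le _ _
    _ = 2 * (A.image (h * ·) \ A).card := by rw [Finset.card_sdiff_comm hcard]; ring
    _ ≤ _ := Nat.mul_le_mul_left 2 hle

/-- Proposition 5.1 of the paper: let `{F_n}` be a (tiling) Følner sequence of `G`, and let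
`T₁, T₂` tile `G` self-similarly, with tiling subgroups `H₁ = G_{T₁}`, `H₂ = G_{T₂}` and
isomorphisms `π₁ : G ≃ H₁`, `π₂ : G ≃ H₂`. If a finite `T ⊆ H₁` is such that
`{T g : g ∈ H₂}` forms a partition of `H₁`, then `{T π₂(F_n)}` is a (tiling) Følner sequence
of the group `H₁`. -/
theorem folner_of_selfsimilar_tiles
    {G : Type*} [Group G] [Countable G] [Infinite G] [DecidableEq G]
    (F : ℕ → Finset G) (hF : IsFolner F)
    (T₁ T₂ : Finset G) (hT₁ : T₁.Nonempty) (hT₂ : T₂.Nonempty)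
    (H₁ H₂ : Subgroup G) (π₁ : G ≃* H₁) (π₂ : G ≃* H₂)
    (htile₁ : TilesWith T₁ (H₁ : Set G)) (htile₂ : TilesWith T₂ (H₂ : Set G))
    (T : Finset G) (hTne : T.Nonempty) (hTsub : (T : Set G) ⊆ (H₁ : Set G))
    (hTH₂ : ∀ t ∈ T, ∀ c ∈ (H₂ : Set G), t * c ∈ (H₁ : Set G))
    (hTpart : ∀ x ∈ (H₁ : Set G), ∃! c : G, c ∈ (H₂ : Set G) ∧ ∃ t ∈ T, x = t * c) :
    (∀ n, (T * ((F n).image fun x => ((π₂ x : G)))).Nonempty) ∧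
    (∀ h ∈ (H₁ : Set G),
      Tendsto (fun n =>
          ((((T * ((F n).image fun x => ((π₂ x : G)))).image (h * ·))
              ∆ (T * ((F n).image fun x => ((π₂ x : G))))).card : ℝ)
            / ((T * ((F n).image fun x => ((π₂ x : G)))).card : ℝ))
        atTop (𝓝 0)) ∧
    ((∀ n, Tiles (F n)) → ∀ n, ∃ C ⊆ (H₁ : Set G),
      ∀ x ∈ (H₁ : Set G), ∃! c : G, c ∈ C ∧
        ∃ s ∈ T * ((F n).image fun x => ((π₂ x : G))), x = s * c) := by
  have hle : ∀ c ∈ (H₂ : Set G), c ∈ (H₁ : Set G) := by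
    obtain ⟨t, ht⟩ := hTne
    exact fun c hc => (H₁.mul_mem_cancel_left (hTsub ht)).1 (hTH₂ t ht c hc)
  have hinj : Function.Injective fun x => (π₂ x : G) :=
    Subtype.val_injective.comp π₂.injective
  refine ⟨fun n => hTne.mul ((hF.1 n).image _), fun h hh => ?_, fun hFt n => ?_⟩
  · have hg : ∀ t ∈ T, ∃ g : G, ∃ t' ∈ T, h * t = t' * (H₂.subtype.comp π₂.toMonoidHom) g := by
      intro t ht
      obtain ⟨c, ⟨hc, t', ht', hct⟩, -⟩ := hTpart (h * t) (H₁.mul_mem hh (hTsub ht))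
      exact ⟨π₂.symm ⟨c, hc⟩, t', ht', by simpa using hct⟩
    choose! g hg using hg
    have hlim : Tendsto (fun n => 2 * ∑ t ∈ T,
        ((((F n).image (g t * ·)) ∆ (F n)).card : ℝ) / ((F n).card : ℝ)) atTop (𝓝 0) := by
      simpa using (tendsto_finsetSum T fun t _ => hF.2 (g t)).const_mul 2
    refine squeeze_zero (fun n => by positivity) (fun n => ?_) hlim
    rw [← Finset.sum_div, ← mul_div_assoc]
    have hnum := card_image_mul_symmDiff_le (H₂.subtype.comp π₂.toMonoidHom) T (F n) h g hg
    have hden : (F n).card ≤ (T * ((F n).image fun x => (π₂ x : G))).card :=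
      (Finset.card_image_of_injective (F n) hinj).symm.le.trans
        (Finset.card_le_card_mul_left hTne)
    have hpos : 0 < (F n).card := (hF.1 n).card_pos
    gcongr
    exact_mod_cast hnum
  · obtain ⟨-, C, hC⟩ := hFt n
    refine ⟨(fun x => (π₂ x : G)) '' C, ?_, fun x hx => ?_⟩
    · rintro _ ⟨c, -, rfl⟩
      exact hle _ (π₂ c).2
    · obtain ⟨c, ⟨hc, t, ht, rfl⟩, hcu⟩ := hTpart x hx
      obtain ⟨y, hy⟩ := π₂.surjective ⟨c, hc⟩
      obtain rfl : (π₂ y : G) = c := congrArg Subtype.val hy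
      obtain ⟨d, ⟨hd, f, hf, rfl⟩, hdu⟩ := hC y
      refine ⟨π₂ d, ⟨⟨d, hd, rfl⟩, t * π₂ f,
        Finset.mul_mem_mul ht (Finset.mem_image_of_mem _ hf), by simp [mul_assoc]⟩, ?_⟩
      rintro _ ⟨⟨d', hd', rfl⟩, s, hs, hsd⟩
      obtain ⟨t', ht', b, hb, rfl⟩ := Finset.mem_mul.1 hs
      obtain ⟨f', hf', rfl⟩ := Finset.mem_image.1 hb
      have heq : f' * d' = f * d := hinj <|
        hcu (π₂ (f' * d') : G) ⟨(π₂ (f' * d')).2, t', ht', by rw [hsd]; simp [mul_assoc]⟩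
      exact congrArg (fun x => (π₂ x : G)) (hdu d' ⟨hd', f', hf', heq.symm⟩)
end

section
/- Let {F_n : n ∈ ℕ} be a Følner sequence of a countably infinite discrete group G and let T ∈ 𝒯_G tile G self-similarly, with tiling subgroup G_T and isomorphism π_T : G → G_T. Then {T π_T(F_n) : n ∈ ℕ} is a Følner sequence of G; moreover, if every F_n tiles G, then every T π_T(F_n) tiles G. -/
open Filter Topology
open scoped symmDiff Pointwise

/-- If every element of `G` is a product `t * π h` with `t ∈ T`, then `T π(F_n)` is Følner
whenever `F_n` is. -/
theorem IsFolner.mul_image {G : Type*} [Group G] [DecidableEq G] {F : ℕ → Finset G}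
    (hF : IsFolner F) {T : Finset G} (hT : T.Nonempty) {π : G →* G} (hπ : Function.Injective π)
    (hcover : ∀ x : G, ∃ t ∈ T, ∃ h : G, x = t * π h) :
    IsFolner (fun n => T * (F n).image π) := by
  refine ⟨fun n => hT.mul ((hF.1 n).image _), fun g => ?_⟩
  choose a ha b hab using hcover
  have hsub : ∀ n, ((T * (F n).image π).image (g * ·)) ∆ (T * (F n).image π) ⊆
      T.biUnion (fun t => (((F n).image (b (g * t) * ·)) ∆ F n).image (a (g * t) * π ·)) ∪
      T.biUnion (fun s => (((F n).image ((b (g⁻¹ * s))⁻¹ * ·)) ∆ F n).image (s * π ·)) := by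
    intro n x hx
    simp only [Finset.mem_union, Finset.mem_biUnion, Finset.mem_image]
    rcases Finset.mem_symmDiff.1 hx with ⟨hx, hx'⟩ | ⟨hx, hx'⟩
    · obtain ⟨y, hy, rfl⟩ := Finset.mem_image.1 hx
      obtain ⟨t, ht, z, hz, rfl⟩ := Finset.mem_mul.1 hy
      obtain ⟨f, hf, rfl⟩ := Finset.mem_image.1 hz
      have key : g * (t * π f) = a (g * t) * π (b (g * t) * f) := by
        rw [map_mul, ← mul_assoc, ← mul_assoc, ← hab]
      refine Or.inl ⟨t, ht, b (g * t) * f, Finset.mem_symmDiff.2 (Or.inl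
        ⟨Finset.mem_image_of_mem _ hf, fun h => hx' ?_⟩), key.symm⟩
      rw [key]
      exact Finset.mul_mem_mul (ha _) (Finset.mem_image_of_mem _ h)
    · obtain ⟨s, hs, z, hz, rfl⟩ := Finset.mem_mul.1 hx
      obtain ⟨f, hf, rfl⟩ := Finset.mem_image.1 hz
      refine Or.inr ⟨s, hs, f, Finset.mem_symmDiff.2 (Or.inr ⟨hf, fun h => hx' ?_⟩), rfl⟩
      obtain ⟨f', hf', rfl⟩ := Finset.mem_image.1 h
      refine Finset.mem_image.2 ⟨a (g⁻¹ * s) * π f',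
        Finset.mul_mem_mul (ha _) (Finset.mem_image_of_mem _ hf'), ?_⟩
      have hs' : g * a (g⁻¹ * s) = s * π (b (g⁻¹ * s))⁻¹ := by
        rw [map_inv, eq_mul_inv_iff_mul_eq, mul_assoc, ← hab, mul_inv_cancel_left]
      rw [map_mul, ← mul_assoc, ← mul_assoc, hs']
  have hcard : ∀ n, (F n).card ≤ (T * (F n).image π).card := fun n => by
    rw [← Finset.card_image_of_injective (F n) hπ]
    exact Finset.card_le_card_mul_left hT
  have hlim := (tendsto_finsetSum T fun t _ => hF.2 (b (g * t))).add
    (tendsto_finsetSum T fun s _ => hF.2 (b (g⁻¹ * s))⁻¹)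
  simp only [Finset.sum_const_zero, add_zero] at hlim
  refine squeeze_zero (fun n => div_nonneg (Nat.cast_nonneg _) (Nat.cast_nonneg _)) (fun n => ?_) hlim
  have hpos : (0 : ℝ) < (F n).card := by exact_mod_cast (hF.1 n).card_pos
  rw [← Finset.sum_div, ← Finset.sum_div, ← add_div]
  refine div_le_div₀ (add_nonneg (Finset.sum_nonneg fun _ _ => Nat.cast_nonneg _)
    (Finset.sum_nonneg fun _ _ => Nat.cast_nonneg _)) ?_ hpos (by exact_mod_cast hcard n)
  have hle := (Finset.card_le_card (hsub n)).trans ((Finset.card_union_le _ _).trans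
    (add_le_add
      (Finset.card_biUnion_le.trans (Finset.sum_le_sum fun t _ => Finset.card_image_le))
      (Finset.card_biUnion_le.trans (Finset.sum_le_sum fun t _ => Finset.card_image_le))))
  exact_mod_cast hle

/-- If `T` tiles `G` with centers the range of an injective endomorphism `π` and `S` tiles `G`
with centers `C`, then `T π(S)` tiles `G` with centers `π(C)`. -/
theorem TilesWith.mul_image {G : Type*} [Group G] [DecidableEq G] {S T : Finset G} {C : Set G}
    {π : G →* G} (hπ : Function.Injective π) (hT : TilesWith T (Set.range π))
    (hS : TilesWith S C) : TilesWith (T * S.image π) (π '' C) := by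
  intro x
  obtain ⟨_, ⟨⟨h, rfl⟩, t, ht, rfl⟩, huniq⟩ := hT x
  obtain ⟨c, ⟨hc, s, hs, rfl⟩, hcuniq⟩ := hS h
  refine ⟨π c, ⟨Set.mem_image_of_mem _ hc, t * π s,
    Finset.mul_mem_mul ht (Finset.mem_image_of_mem _ hs), by rw [map_mul, mul_assoc]⟩, ?_⟩
  rintro _ ⟨⟨c', hc', rfl⟩, y, hy, hxy⟩
  obtain ⟨t', ht', z, hz, rfl⟩ := Finset.mem_mul.1 hy
  obtain ⟨s', hs', rfl⟩ := Finset.mem_image.1 hz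
  have heq := huniq (π (s' * c')) ⟨⟨_, rfl⟩, t', ht', by rw [hxy, map_mul, mul_assoc]⟩
  rw [hcuniq c' ⟨hc', s', hs', (hπ heq).symm⟩]

/-- Corollary 5.2 of the paper: let `{F_n}` be a (tiling) Følner sequence of `G` and let
`T` tile `G` self-similarly, with tiling subgroup `H = G_T` and isomorphism `π_T : G ≃ H`.
Then `{T π_T(F_n)}` is a (tiling) Følner sequence of `G`. -/
theorem folner_of_selfsimilar_tile
    {G : Type*} [Group G] [Countable G] [Infinite G] [DecidableEq G]
    (F : ℕ → Finset G) (hF : IsFolner F)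
    (T : Finset G) (hT : T.Nonempty)
    (H : Subgroup G) (π : G ≃* H)
    (htile : TilesWith T (H : Set G)) :
    IsFolner (fun n => T * ((F n).image fun x => ((π x : G)))) ∧
      ((∀ n, Tiles (F n)) → ∀ n, Tiles (T * ((F n).image fun x => ((π x : G))))) := by
  have hφ : Function.Injective (H.subtype.comp π.toMonoidHom) :=
    Subtype.val_injective.comp π.injective
  have hcoe : (fun x => (π x : G)) = H.subtype.comp π.toMonoidHom := rfl
  have hrange : (H : Set G) = Set.range (H.subtype.comp π.toMonoidHom) := by
    ext x
    refine ⟨fun hx => ⟨π.symm ⟨x, hx⟩, by simp⟩, ?_⟩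
    rintro ⟨y, rfl⟩
    exact (π y).2
  rw [hrange] at htile
  rw [hcoe]
  refine ⟨hF.mul_image hT hφ fun x => ?_, fun hFt n => ?_⟩
  · obtain ⟨_, ⟨⟨h, rfl⟩, t, ht, hx⟩, -⟩ := htile x
    exact ⟨t, ht, h, hx⟩
  · obtain ⟨hne, C, hC⟩ := hFt n
    exact ⟨hT.mul (hne.image _), _, htile.mul_image hφ hC⟩
end

section
/- Let (Y, 𝒟, ν, G) be an MDS, let 𝐃 = {d_F : F ∈ 𝓕_G} ⊆ L¹(Y, 𝒟, ν) be a sub-additive G-invariant family with ν(𝐃) > −∞, and let {F_n : n ∈ ℕ} be a Følner sequence of G each of whose terms tiles G self-similarly (with tiling subgroups G_{F_n} and isomorphisms π_{F_n} : G → G_{F_n}). Assume: (a) {F_n} satisfies the Tempelman condition with some constant M > 0; (b) there exists an infinite subset 𝒩 ⊆ ℕ such that for each m ∈ 𝒩 and each δ > 0, for all sufficiently large p ∈ ℕ there exist n_1, n_2 ∈ ℕ with F_m π_{F_m}(F_{n_1}) ⊇ F_p ⊇ F_m π_{F_m}(F_{n_2}) and (|F_{n_1}| − |F_{n_2}|)/|F_p|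 < δ. Then there exists d ∈ L¹(Y, 𝒟, ν) such that lim_{n→∞} d_{F_n}(y)/|F_n| = d(y) for ν-a.e. y ∈ Y, and ∫_Y d dν = ν(𝐃). -/
open MeasureTheory Filter Topology
open scoped symmDiff Pointwise ENNReal

/-- `F` satisfies the Tempelman condition with constant `M`. -/
def TempelmanWith {G : Type*} [Group G] [DecidableEq G] (F : ℕ → Finset G) (M : ℝ) : Prop :=
  ∀ n : ℕ, ((((Finset.range (n + 1)).biUnion fun k => (F k)⁻¹ * F n).card : ℝ))
      ≤ M * ((F n).card : ℝ)

section Combinatorics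

variable {G : Type*} [Group G] [DecidableEq G]

/-- The points of `A` all of whose left translates by elements of `Q` stay in `A`. -/
def translateCore (A Q : Finset G) : Finset G :=
  A.filter fun x => ∀ q ∈ Q, q * x ∈ A

lemma translateCore_subset (A Q : Finset G) : translateCore A Q ⊆ A :=
  Finset.filter_subset _ _

lemma card_sub_card_translateCore_le (A Q : Finset G) :
    (A.card : ℝ) - (translateCore A Q).card ≤
      ∑ q ∈ Q, ((((A.image (q * ·)) ∆ A).card : ℝ)) := by
  have h1 : A \ translateCore A Q ⊆ Q.biUnion fun q => A.filter fun x => q * x ∉ A := by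
    intro x hx
    simp only [translateCore, Finset.mem_sdiff, Finset.mem_filter, not_and, not_forall] at hx
    obtain ⟨hxA, h⟩ := hx
    obtain ⟨q, hq, hqx⟩ := h hxA
    simp only [Finset.mem_biUnion, Finset.mem_filter]
    exact ⟨q, hq, hxA, hqx⟩
  have h2 : ∀ q : G, (A.filter fun x => q * x ∉ A).card ≤ ((A.image (q * ·)) ∆ A).card := by
    intro q
    refine Finset.card_le_card_of_injOn (q * ·) ?_ ((mul_right_injective q).injOn)
    intro x hx
    simp only [Finset.coe_filter, Set.mem_ofPred_eq] at hx
    simp only [Finset.mem_coe, Finset.mem_symmDiff, Finset.mem_image]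
    exact Or.inl ⟨⟨x, hx.1, rfl⟩, hx.2⟩
  have h3 : A.card - (translateCore A Q).card ≤ ∑ q ∈ Q, ((A.image (q * ·)) ∆ A).card := by
    rw [← Finset.card_sdiff_of_subset (translateCore_subset A Q)]
    exact (Finset.card_le_card h1).trans
      (Finset.card_biUnion_le.trans (Finset.sum_le_sum fun q _ => h2 q))
  have h4 : A.card ≤ (translateCore A Q).card + ∑ q ∈ Q, ((A.image (q * ·)) ∆ A).card := by
    omega
  have h5 : (A.card : ℝ) ≤ (translateCore A Q).card +
      ∑ q ∈ Q, ((((A.image (q * ·)) ∆ A).card : ℝ)) := by exact_mod_cast h4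
  linarith

lemma IsFolner.card_pos {F : ℕ → Finset G} (hF : IsFolner F) (n : ℕ) :
    (0 : ℝ) < ((F n).card : ℝ) := by
  exact_mod_cast (hF.1 n).card_pos

lemma IsFolner.tendsto_translateCore {F : ℕ → Finset G} (hF : IsFolner F) (Q : Finset G) :
    Tendsto (fun n => ((translateCore (F n) Q).card : ℝ) / (F n).card) atTop (𝓝 1) := by
  have h1 : Tendsto (fun n => 1 - ∑ q ∈ Q,
      ((((F n).image (q * ·)) ∆ (F n)).card : ℝ) / ((F n).card : ℝ)) atTop (𝓝 1) := by
    have := (tendsto_finsetSum Q fun q _ => hF.2 q).const_sub 1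
    simpa using this
  refine tendsto_of_tendsto_of_tendsto_of_le_of_le h1 tendsto_const_nhds ?_ ?_
  · intro n
    have hp := hF.card_pos n
    have := card_sub_card_translateCore_le (F n) Q
    simp only
    rw [← Finset.sum_div, le_div_iff₀ hp, sub_mul, div_mul_cancel₀ _ hp.ne']
    linarith
  · intro n
    have hp := hF.card_pos n
    simp only
    rw [div_le_one hp]
    exact_mod_cast Finset.card_le_card (translateCore_subset _ _)

lemma IsFolner.tendsto_card [Infinite G] {F : ℕ → Finset G} (hF : IsFolner F) :
    Tendsto (fun n => ((F n).card : ℝ)) atTop atTop := by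
  refine (tendsto_natCast_atTop_atTop (R := ℝ)).comp ?_
  refine tendsto_atTop.2 fun K => ?_
  obtain ⟨Q, hQ⟩ := Infinite.exists_subset_card_eq G K
  have h := (hF.tendsto_translateCore Q).eventually (lt_mem_nhds (zero_lt_one' ℝ))
  filter_upwards [h] with n hn
  have hp := hF.card_pos n
  have h0 : 0 < ((translateCore (F n) Q).card : ℝ) := by
    by_contra hcon
    have : ((translateCore (F n) Q).card : ℝ) / (F n).card ≤ 0 :=
      div_nonpos_of_nonpos_of_nonneg (not_lt.1 hcon) hp.le
    linarith
  obtain ⟨x, hx⟩ := Finset.card_pos.1 (by exact_mod_cast h0)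
  rw [← hQ]
  refine Finset.card_le_card_of_injOn (· * x) ?_ ((mul_left_injective x).injOn)
  intro q hq
  simp only [translateCore, Finset.mem_filter] at hx
  exact hx.2 q hq

lemma TempelmanWith.exists_disjoint_subfamily {F : ℕ → Finset G} {M : ℝ}
    (hne : ∀ n, (F n).Nonempty) (hT : TempelmanWith F M) (k : G → ℕ) (B : Finset G) :
    ∃ D ⊆ B, (∀ g ∈ D, ∀ h ∈ D, g ≠ h →
        Disjoint ((F (k g)).image (· * g)) ((F (k h)).image (· * h))) ∧
      (B.card : ℝ) ≤ M * ∑ h ∈ D, ((F (k h)).card : ℝ) := by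
  induction B using Finset.strongInduction with
  | H B ih =>
    rcases B.eq_empty_or_nonempty with rfl | hB
    · exact ⟨∅, by simp, by simp, by simp⟩
    obtain ⟨h, hhB, hmax⟩ := Finset.exists_max_image B k hB
    set B' := B.filter fun g => Disjoint ((F (k g)).image (· * g)) ((F (k h)).image (· * h))
      with hB'
    have hhB' : h ∉ B' := by
      simp only [hB', Finset.mem_filter, not_and, disjoint_self, Finset.bot_eq_empty,
        Finset.image_eq_empty]
      exact fun _ => (hne _).ne_empty
    have hB'B : B' ⊆ B := Finset.filter_subset _ _
    obtain ⟨D, hDB, hdisj, hcard⟩ :=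
      ih B' (Finset.ssubset_iff_subset_ne.2 ⟨hB'B, fun e => hhB' (e ▸ hhB)⟩)
    have hhD : h ∉ D := fun hh => hhB' (hDB hh)
    refine ⟨insert h D, ?_, ?_, ?_⟩
    · exact Finset.insert_subset hhB (hDB.trans hB'B)
    · intro a ha b hb hab
      rcases Finset.mem_insert.1 ha with rfl | ha' <;> rcases Finset.mem_insert.1 hb with rfl | hb'
      · exact absurd rfl hab
      · exact (Finset.mem_filter.1 (hDB hb')).2.symm
      · exact (Finset.mem_filter.1 (hDB ha')).2
      · exact hdisj a ha' b hb' hab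
    · rw [Finset.sum_insert hhD, mul_add]
      have hsub : B \ B' ⊆
          (((Finset.range (k h + 1)).biUnion fun j => (F j)⁻¹ * F (k h))).image (· * h) := by
        intro g hg
        simp only [hB', Finset.mem_sdiff, Finset.mem_filter, not_and] at hg
        obtain ⟨hgB, hg2⟩ := hg
        obtain ⟨z, hz1, hz2⟩ := Finset.not_disjoint_iff.1 (hg2 hgB)
        obtain ⟨a, ha, rfl⟩ := Finset.mem_image.1 hz1
        obtain ⟨b, hb, hba⟩ := Finset.mem_image.1 hz2
        refine Finset.mem_image.2 ⟨a⁻¹ * b, Finset.mem_biUnion.2 ⟨k g, ?_, ?_⟩, ?_⟩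
        · exact Finset.mem_range.2 (Nat.lt_succ_of_le (hmax g hgB))
        · exact Finset.mul_mem_mul (Finset.inv_mem_inv ha) hb
        · rw [mul_assoc, hba, inv_mul_cancel_left]
      have hle : ((B \ B').card : ℝ) ≤ M * ((F (k h)).card : ℝ) := by
        refine le_trans ?_ (hT (k h))
        exact_mod_cast (Finset.card_le_card hsub).trans Finset.card_image_le
      have hsum : ((B \ B').card : ℝ) + B'.card = B.card := by
        exact_mod_cast Finset.card_sdiff_add_card_eq_card hB'B
      linarith

lemma sum_le_biUnion_of_superadditive {α ι : Type*} [DecidableEq α] {s : Finset α → ℝ}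
    (h0 : ∀ A, 0 ≤ s A) (hs : ∀ A B, Disjoint A B → s A + s B ≤ s (A ∪ B))
    (D : Finset ι) (A : ι → Finset α)
    (hd : ∀ i ∈ D, ∀ j ∈ D, i ≠ j → Disjoint (A i) (A j)) :
    ∑ i ∈ D, s (A i) ≤ s (D.biUnion A) := by
  classical
  induction D using Finset.induction_on with
  | empty => simpa using h0 ∅
  | insert a D ha ih =>
    rw [Finset.sum_insert ha, Finset.biUnion_insert]
    refine le_trans (add_le_add le_rfl (ih fun i hi j hj => hd i (by simp [hi]) j (by simp [hj])))
      (hs _ _ ?_)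
    rw [Finset.disjoint_biUnion_right]
    intro j hj
    exact hd a (by simp) j (by simp [hj]) (fun e => ha (e ▸ hj))

lemma mono_of_superadditive {α : Type*} [DecidableEq α] {s : Finset α → ℝ}
    (h0 : ∀ A, 0 ≤ s A) (hs : ∀ A B, Disjoint A B → s A + s B ≤ s (A ∪ B))
    {A B : Finset α} (h : A ⊆ B) : s A ≤ s B := by
  have := hs A (B \ A) Finset.disjoint_sdiff
  rw [Finset.union_sdiff_of_subset h] at this
  linarith [h0 (B \ A)]

end Combinatorics

section Superadditive

variable {G : Type*} [Group G] {Y : Type*} [MeasurableSpace Y]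

/-- `T` is a measure-preserving action of `G`. -/
structure IsMPAction (ν : Measure Y) (T : G → Y → Y) : Prop where
  measurePreserving : ∀ g, MeasurePreserving (T g) ν ν
  mul : ∀ g h y, T (g * h) y = T g (T h y)

/-- `S` is a non-negative superadditive process over the action `T`. -/
structure IsSuperFamily [DecidableEq G] (ν : Measure Y) (T : G → Y → Y) (S : Finset G → Y → ℝ) :
    Prop where
  action : IsMPAction ν T
  integrable : ∀ A, Integrable (S A) ν
  nonneg : ∀ᵐ y ∂ν, ∀ A, 0 ≤ S A y
  invariant : ∀ᵐ y ∂ν, ∀ (A : Finset G) (g : G), S (A.image (· * g)) y = S A (T g y)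
  superadditive : ∀ᵐ y ∂ν, ∀ A B, Disjoint A B → S A y + S B y ≤ S (A ∪ B) y

lemma IsMPAction.integral_comp {ν : Measure Y} {T : G → Y → Y} (hT : IsMPAction ν T) {f : Y → ℝ}
    (hf : AEStronglyMeasurable f ν) (g : G) : ∫ y, f (T g y) ∂ν = ∫ y, f y ∂ν := by
  have hm := hT.measurePreserving g
  have hf' : AEStronglyMeasurable f (ν.map (T g)) := by rwa [hm.map_eq]
  rw [← integral_map hm.measurable.aemeasurable hf', hm.map_eq]

lemma IsMPAction.integrable_comp {ν : Measure Y} {T : G → Y → Y} (hT : IsMPAction ν T)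
    {f : Y → ℝ} (hf : Integrable f ν) (g : G) : Integrable (fun y => f (T g y)) ν :=
  (hT.measurePreserving g).integrable_comp_of_integrable hf

variable {ν : Measure Y} {T : G → Y → Y} {S : Finset G → Y → ℝ}

lemma IsMPAction.integral_sum (hT : IsMPAction ν T) {f : Y → ℝ} (hf : Integrable f ν)
    (A : Finset G) : ∫ y, ∑ g ∈ A, f (T g y) ∂ν = A.card * ∫ y, f y ∂ν := by
  rw [integral_finsetSum _ fun g _ => hT.integrable_comp hf g]
  simp [hT.integral_comp hf.aestronglyMeasurable]

lemma ae_cauchySeq_of_small_exceptional_set {u : ℕ → Y → ℝ}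
    (h : ∀ α : ℝ, 0 < α → ∀ ε : ℝ, 0 < ε → ∃ E : Set Y, ν E ≤ ENNReal.ofReal ε ∧
      ∀ᵐ y ∂ν, y ∉ E → ∃ N, ∀ p ≥ N, ∀ q ≥ N, |u p y - u q y| ≤ α) :
    ∀ᵐ y ∂ν, CauchySeq fun n => u n y := by
  have h1 : ∀ α : ℝ, 0 < α → ∀ᵐ y ∂ν, ∃ N, ∀ p ≥ N, ∀ q ≥ N, |u p y - u q y| ≤ α := by
    intro α hα
    rw [ae_iff]
    refine le_antisymm (le_of_forall_pos_le_add fun ε hε => ?_) zero_le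
    rw [zero_add]
    rcases eq_or_ne ε ⊤ with rfl | hεt
    · exact le_top
    obtain ⟨E, hE, hy⟩ := h α hα ε.toReal (ENNReal.toReal_pos hε.ne' hεt)
    rw [ENNReal.ofReal_toReal hεt] at hE
    refine le_trans (measure_mono_ae ?_) hE
    filter_upwards [hy] with y hy hbad
    by_contra hyE
    exact hbad (hy hyE)
  have h2 : ∀ᵐ y ∂ν, ∀ k : ℕ, ∃ N, ∀ p ≥ N, ∀ q ≥ N, |u p y - u q y| ≤ 1 / ((k : ℝ) + 1) :=
    ae_all_iff.2 fun k => h1 _ Nat.one_div_pos_of_nat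
  filter_upwards [h2] with y hy
  rw [Metric.cauchySeq_iff]
  intro ε hε
  obtain ⟨k, hk⟩ := exists_nat_one_div_lt hε
  obtain ⟨N, hN⟩ := hy k
  exact ⟨N, fun p hp q hq => (hN p hp q hq).trans_lt hk⟩

variable [DecidableEq G]

lemma IsMPAction.isSuperFamily_sum (hT : IsMPAction ν T) {f : Y → ℝ} (hf : Integrable f ν)
    (h0 : ∀ y, 0 ≤ f y) : IsSuperFamily ν T fun A y => ∑ g ∈ A, f (T g y) where
  action := hT
  integrable A := integrable_finsetSum _ fun g _ => hT.integrable_comp hf g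
  nonneg := ae_of_all _ fun y A => Finset.sum_nonneg fun g _ => h0 _
  invariant := ae_of_all _ fun y A g => by
    rw [Finset.sum_image (mul_left_injective g).injOn]
    simp only [hT.mul]
  superadditive := ae_of_all _ fun y A B h => (Finset.sum_union h).ge

lemma IsSuperFamily.card_mul_indicator_le {F : ℕ → Finset G} {M : ℝ}
    (hS : IsSuperFamily ν T S) (hne : ∀ n, (F n).Nonempty) (hM : 0 < M)
    (hTemp : TempelmanWith F M) {α : ℝ} (hα : 0 < α) (N : ℕ) (A : Finset G) :
    ∀ᵐ y ∂ν, α * ∑ g ∈ translateCore A ((Finset.range (N + 1)).biUnion F),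
      ((T g) ⁻¹' {y | ∃ n ≤ N, α * (F n).card < S (F n) y}).indicator (fun _ => (1 : ℝ)) y
        ≤ M * S A y := by
  classical
  filter_upwards [hS.nonneg, hS.invariant, hS.superadditive] with y h0 hinv hsup
  set E := {y | ∃ n ≤ N, α * (F n).card < S (F n) y} with hE
  set K := translateCore A ((Finset.range (N + 1)).biUnion F) with hK
  have hsum : ∑ g ∈ K, ((T g) ⁻¹' E).indicator (fun _ => (1 : ℝ)) y
      = ((K.filter fun g => T g y ∈ E).card : ℝ) := by
    rw [Finset.card_filter]
    push_cast
    refine Finset.sum_congr rfl fun g _ => ?_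
    simp [Set.indicator_apply]
  rw [hsum]
  set B := K.filter fun g => T g y ∈ E with hB
  have hex : ∀ g, ∃ n, g ∈ B → n ≤ N ∧ α * (F n).card < S (F n) (T g y) := by
    intro g
    by_cases hg : g ∈ B
    · obtain ⟨n, hn, h⟩ := (Finset.mem_filter.1 hg).2
      exact ⟨n, fun _ => ⟨hn, h⟩⟩
    · exact ⟨0, fun h => absurd h hg⟩
  choose k hk using hex
  obtain ⟨D, hDB, hdisj, hcard⟩ := hTemp.exists_disjoint_subfamily hne k B
  have h1 : ∑ h ∈ D, α * ((F (k h)).card : ℝ) ≤ ∑ h ∈ D, S ((F (k h)).image (· * h)) y := by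
    refine Finset.sum_le_sum fun h hh => ?_
    rw [hinv]
    exact (hk h (hDB hh)).2.le
  have h2 := sum_le_biUnion_of_superadditive (s := fun A => S A y) h0 hsup D
    (fun h => (F (k h)).image (· * h)) hdisj
  have h3 : (D.biUnion fun h => (F (k h)).image (· * h)) ⊆ A := by
    intro x hx
    obtain ⟨h, hh, hx⟩ := Finset.mem_biUnion.1 hx
    obtain ⟨a, ha, rfl⟩ := Finset.mem_image.1 hx
    have hhK := (Finset.mem_filter.1 (hDB hh)).1
    refine (Finset.mem_filter.1 hhK).2 a (Finset.mem_biUnion.2 ⟨k h, ?_, ha⟩)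
    exact Finset.mem_range.2 (Nat.lt_succ_of_le (hk h (hDB hh)).1)
  have h4 := mono_of_superadditive (s := fun A => S A y) h0 hsup h3
  rw [← Finset.mul_sum] at h1
  calc α * (B.card : ℝ) ≤ α * (M * ∑ h ∈ D, ((F (k h)).card : ℝ)) := by gcongr
    _ = M * (α * ∑ h ∈ D, ((F (k h)).card : ℝ)) := by ring
    _ ≤ M * S A y := by
      gcongr
      exact h1.trans (h2.trans h4)

lemma IsSuperFamily.nullMeasurableSet (hS : IsSuperFamily ν T S) (F : ℕ → Finset G)
    (α : ℝ) (N : ℕ) : NullMeasurableSet {y | ∃ n ≤ N, α * (F n).card < S (F n) y} ν := by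
  have : {y | ∃ n ≤ N, α * (F n).card < S (F n) y}
      = ⋃ n, ⋃ _ : n ≤ N, {y | α * (F n).card < S (F n) y} := by
    ext y; simp
  rw [this]
  exact .iUnion fun n => .iUnion fun _ =>
    nullMeasurableSet_lt aemeasurable_const (hS.integrable _).aemeasurable

lemma IsSuperFamily.measure_finite_maximal_le [IsProbabilityMeasure ν] {F : ℕ → Finset G} {M : ℝ}
    (hS : IsSuperFamily ν T S) (hF : IsFolner F) (hM : 0 < M)
    (hTemp : TempelmanWith F M) {γ : ℝ} (hγ : ∀ n, ∫ y, S (F n) y ∂ν ≤ γ * (F n).card)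
    {α : ℝ} (hα : 0 < α) (N : ℕ) :
    α * ν.real {y | ∃ n ≤ N, α * (F n).card < S (F n) y} ≤ M * γ := by
  set E := {y | ∃ n ≤ N, α * (F n).card < S (F n) y} with hE
  have hEm : NullMeasurableSet E ν := hS.nullMeasurableSet F α N
  set Q := (Finset.range (N + 1)).biUnion F with hQ
  have key : ∀ L, α * ((translateCore (F L) Q).card / (F L).card * ν.real E) ≤ M * γ := by
    intro L
    have hpre : ∀ g, NullMeasurableSet ((T g) ⁻¹' E) ν := fun g =>
      hEm.preimage (hS.action.measurePreserving g).quasiMeasurePreserving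
    have hi : ∀ g, Integrable (((T g) ⁻¹' E).indicator (fun _ => (1 : ℝ))) ν := fun g =>
      (integrable_const _).indicator₀ (hpre g)
    have h1 := integral_mono_ae ((integrable_finsetSum _ fun g _ => hi g).const_mul α)
      ((hS.integrable (F L)).const_mul M) (hS.card_mul_indicator_le hF.1 hM hTemp hα N (F L))
    rw [integral_const_mul, integral_const_mul, integral_finsetSum _ fun g _ => hi g] at h1
    have h2 : ∀ g, ∫ y, ((T g) ⁻¹' E).indicator (fun _ => (1 : ℝ)) y ∂ν = ν.real E := by
      intro g
      rw [integral_indicator₀ (hpre g), setIntegral_const, smul_eq_mul, mul_one, measureReal_def,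
        measureReal_def, (hS.action.measurePreserving g).measure_preimage hEm]
    simp only [h2, Finset.sum_const, nsmul_eq_mul] at h1
    have hp := hF.card_pos L
    have h3 : α * ((translateCore (F L) Q).card * ν.real E) ≤ M * (γ * (F L).card) :=
      h1.trans (by gcongr; exact hγ L)
    calc α * ((translateCore (F L) Q).card / (F L).card * ν.real E)
        = α * ((translateCore (F L) Q).card * ν.real E) / (F L).card := by ring
      _ ≤ M * γ := by rw [div_le_iff₀ hp]; linarith
  have hlim := ((hF.tendsto_translateCore Q).mul_const (ν.real E)).const_mul α
  rw [one_mul] at hlim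
  exact le_of_tendsto' hlim key

/-- The maximal inequality for non-negative superadditive processes. -/
lemma IsSuperFamily.measure_maximal_le [IsProbabilityMeasure ν] {F : ℕ → Finset G} {M : ℝ}
    (hS : IsSuperFamily ν T S) (hF : IsFolner F) (hM : 0 < M)
    (hTemp : TempelmanWith F M) {γ : ℝ} (hγ : ∀ n, ∫ y, S (F n) y ∂ν ≤ γ * (F n).card)
    {α : ℝ} (hα : 0 < α) :
    ν {y | ∃ n, α * (F n).card < S (F n) y} ≤ ENNReal.ofReal (M * γ / α) := by
  have : {y | ∃ n, α * (F n).card < S (F n) y}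
      = ⋃ N, {y | ∃ n ≤ N, α * (F n).card < S (F n) y} := by
    ext y
    simp only [Set.mem_ofPred_eq, Set.mem_iUnion]
    exact ⟨fun ⟨n, h⟩ => ⟨n, n, le_rfl, h⟩, fun ⟨_, n, _, h⟩ => ⟨n, h⟩⟩
  have hmono : Monotone fun N => {y | ∃ n ≤ N, α * (F n).card < S (F n) y} := by
    rintro a b hab y ⟨n, hn, h⟩
    exact ⟨n, hn.trans hab, h⟩
  rw [this, hmono.measure_iUnion]
  refine iSup_le fun N => ?_
  rw [← ofReal_measureReal]
  refine ENNReal.ofReal_le_ofReal ?_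
  rw [le_div_iff₀ hα, mul_comm]
  exact hS.measure_finite_maximal_le hF hM hTemp hγ hα N

end Superadditive

section AdditiveTheorem

lemma abs_sum_sub_sum_le {α : Type*} [DecidableEq α] (A B : Finset α) (u : α → ℝ) {C : ℝ}
    (hC : ∀ a, |u a| ≤ C) : |∑ a ∈ A, u a - ∑ a ∈ B, u a| ≤ C * (B ∆ A).card := by
  have h1 : ∀ D : Finset α, |∑ a ∈ D, u a| ≤ C * D.card := fun D =>
    (Finset.abs_sum_le_sum_abs _ _).trans
      ((Finset.sum_le_sum fun a _ => hC a).trans (by simp [mul_comm]))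
  rw [← Finset.sum_sdiff_sub_sum_sdiff]
  have hcard : ((B ∆ A).card : ℝ) = (A \ B).card + (B \ A).card := by
    rw [symmDiff_def, Finset.sup_eq_union, Finset.card_union_of_disjoint disjoint_sdiff_sdiff]
    push_cast
    ring
  rw [hcard, mul_add]
  refine (abs_sub _ _).trans (add_le_add ?_ ?_)
  · exact h1 _
  · exact h1 _

variable {G : Type*} {Y : Type*}

/-- The average of `f` over the translates `T g y`, `g ∈ A`. -/
noncomputable def orbitAverage (T : G → Y → Y) (A : Finset G) (f : Y → ℝ) (y : Y) : ℝ :=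
  (∑ g ∈ A, f (T g y)) / A.card

lemma abs_orbitAverage_sub_le (T : G → Y → Y) (A : Finset G) (f g : Y → ℝ) (y : Y) :
    |orbitAverage T A f y - orbitAverage T A g y| ≤ orbitAverage T A (fun z => |f z - g z|) y := by
  unfold orbitAverage
  rw [← sub_div, ← Finset.sum_sub_distrib, abs_div, Nat.abs_cast]
  gcongr
  exact Finset.abs_sum_le_sum_abs _ _

variable [MeasurableSpace Y]

/-- The averages of `f` along `F` converge almost everywhere to an integrable function with the
same integral as `f`. -/
def ErgodicConverges (ν : Measure Y) (T : G → Y → Y) (F : ℕ → Finset G) (f : Y → ℝ) : Prop :=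
  ∃ f' : Y → ℝ, Integrable f' ν ∧
    (∀ᵐ y ∂ν, Tendsto (fun n => orbitAverage T (F n) f y) atTop (𝓝 (f' y))) ∧
    ∫ y, f' y ∂ν = ∫ y, f y ∂ν

lemma integrable_and_integral_abs_le_of_tendsto {ν : Measure Y} {u : ℕ → Y → ℝ} {v : Y → ℝ}
    {C : ℝ} (hu : ∀ n, Integrable (u n) ν)
    (hv : ∀ᵐ y ∂ν, Tendsto (fun n => u n y) atTop (𝓝 (v y)))
    (hC : ∀ n, ∫ y, |u n y| ∂ν ≤ C) : Integrable v ν ∧ ∫ y, |v y| ∂ν ≤ C := by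
  have hC0 : 0 ≤ C := (integral_nonneg fun y => abs_nonneg (u 0 y)).trans (hC 0)
  have hvm : AEStronglyMeasurable v ν :=
    aestronglyMeasurable_of_tendsto_ae atTop (fun n => (hu n).aestronglyMeasurable) hv
  have h1 : eLpNorm v 1 ν ≤ ENNReal.ofReal C := by
    refine (Lp.eLpNorm_lim_le_liminf_eLpNorm (fun n => (hu n).aestronglyMeasurable) v hv).trans ?_
    refine (liminf_le_liminf (v := fun _ => ENNReal.ofReal C) (.of_forall fun n => ?_)).trans ?_
    · rw [eLpNorm_one_eq_lintegral_enorm, ← ofReal_integral_norm_eq_lintegral_enorm (hu n)]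
      exact ENNReal.ofReal_le_ofReal (hC n)
    · simp
  have hvi : Integrable v ν := memLp_one_iff_integrable.1 ⟨hvm, h1.trans_lt ENNReal.ofReal_lt_top⟩
  refine ⟨hvi, ?_⟩
  rw [eLpNorm_one_eq_lintegral_enorm, ← ofReal_integral_norm_eq_lintegral_enorm hvi] at h1
  exact (ENNReal.ofReal_le_ofReal_iff hC0).1 h1

variable {ν : Measure Y} {T : G → Y → Y} {F : ℕ → Finset G}

lemma exists_simpleFunc_integral_abs_sub_le {f : Y → ℝ} (hf : Integrable f ν) {ε : ℝ}
    (hε : 0 < ε) : ∃ g : SimpleFunc Y ℝ, Integrable g ν ∧ ∫ y, |f y - g y| ∂ν ≤ ε := by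
  obtain ⟨g, hg, hgm⟩ := (memLp_one_iff_integrable.2 hf).exists_simpleFunc_eLpNorm_sub_lt
    ENNReal.one_ne_top (ENNReal.ofReal_pos.2 hε).ne'
  have hgi := memLp_one_iff_integrable.1 hgm
  refine ⟨g, hgi, ?_⟩
  rw [eLpNorm_one_eq_lintegral_enorm, ← ofReal_integral_norm_eq_lintegral_enorm (hf.sub hgi)] at hg
  exact ((ENNReal.ofReal_lt_ofReal_iff hε).1 hg).le

lemma Lp_two_eq_of_inner_eq {φ ψ : Lp ℝ 2 ν} (h : inner ℝ φ ψ = ‖φ‖ ^ 2) (hn : ‖ψ‖ = ‖φ‖) :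
    ψ = φ := by
  have := norm_sub_sq_real φ ψ
  rw [h, hn] at this
  have h0 : ‖φ - ψ‖ ^ 2 = 0 := by linarith
  exact (sub_eq_zero.1 (norm_eq_zero.1 (pow_eq_zero_iff two_ne_zero |>.1 h0))).symm

lemma ErgodicConverges.zero : ErgodicConverges ν T F 0 :=
  ⟨0, integrable_zero _ _ _, by simp [orbitAverage], rfl⟩

lemma ErgodicConverges.add {f g : Y → ℝ} (hf : ErgodicConverges ν T F f)
    (hg : ErgodicConverges ν T F g) (hfi : Integrable f ν) (hgi : Integrable g ν) :
    ErgodicConverges ν T F (f + g) := by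
  obtain ⟨f', hf'i, hf', hfe⟩ := hf
  obtain ⟨g', hg'i, hg', hge⟩ := hg
  refine ⟨f' + g', hf'i.add hg'i, ?_, ?_⟩
  · filter_upwards [hf', hg'] with y h1 h2
    refine (h1.add h2).congr fun n => ?_
    simp [orbitAverage, Finset.sum_add_distrib, add_div]
  · rw [integral_add' hfi hgi, integral_add' hf'i hg'i, hfe, hge]

lemma ErgodicConverges.const_smul {f : Y → ℝ} (hf : ErgodicConverges ν T F f) (c : ℝ) :
    ErgodicConverges ν T F (c • f) := by
  obtain ⟨f', hf'i, hf', hfe⟩ := hf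
  refine ⟨c • f', hf'i.smul c, ?_, ?_⟩
  · filter_upwards [hf'] with y h1
    refine (h1.const_mul c).congr fun n => ?_
    simp only [orbitAverage, Pi.smul_apply, smul_eq_mul, ← Finset.mul_sum, mul_div_assoc]
  · simp [integral_const_mul, hfe]

lemma ErgodicConverges.of_invariant [Countable G] (hne : ∀ n, (F n).Nonempty) {f : Y → ℝ}
    (hf : Integrable f ν) (h : ∀ g : G, (fun y => f (T g y)) =ᵐ[ν] f) :
    ErgodicConverges ν T F f := by
  refine ⟨f, hf, ?_, rfl⟩
  filter_upwards [ae_all_iff.2 h] with y hy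
  refine tendsto_const_nhds.congr fun n => ?_
  have : ((F n).card : ℝ) ≠ 0 := by exact_mod_cast (hne n).card_ne_zero
  simp [orbitAverage, hy, this]

variable [Group G]

lemma IsMPAction.integrable_orbitAverage (hT : IsMPAction ν T) {f : Y → ℝ} (hf : Integrable f ν)
    (A : Finset G) : Integrable (orbitAverage T A f) ν :=
  (integrable_finsetSum _ fun g _ => hT.integrable_comp hf g).div_const _

lemma IsMPAction.integral_orbitAverage (hT : IsMPAction ν T) {f : Y → ℝ} (hf : Integrable f ν)
    {A : Finset G} (hA : A.Nonempty) : ∫ y, orbitAverage T A f y ∂ν = ∫ y, f y ∂ν := by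
  have : (A.card : ℝ) ≠ 0 := by exact_mod_cast hA.card_ne_zero
  unfold orbitAverage
  rw [integral_div, hT.integral_sum hf]
  field_simp

lemma IsMPAction.ae_forall_comp [Countable G] (hT : IsMPAction ν T) {p : Y → Prop}
    (hp : ∀ᵐ y ∂ν, p y) : ∀ᵐ y ∂ν, ∀ g : G, p (T g y) :=
  ae_all_iff.2 fun g => (hT.measurePreserving g).quasiMeasurePreserving.ae hp

lemma ErgodicConverges.congr [Countable G] (hT : IsMPAction ν T) {f g : Y → ℝ}
    (hf : ErgodicConverges ν T F f) (h : f =ᵐ[ν] g) : ErgodicConverges ν T F g := by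
  obtain ⟨f', hf'i, hf', hfe⟩ := hf
  refine ⟨f', hf'i, ?_, hfe.trans (integral_congr_ae h)⟩
  filter_upwards [hf', hT.ae_forall_comp h] with y h1 h2
  refine h1.congr fun n => ?_
  simp [orbitAverage, h2]

variable [DecidableEq G]

lemma ErgodicConverges.of_bounded_coboundary (hT : IsMPAction ν T) (hF : IsFolner F)
    {f : Y → ℝ} (hf : Integrable f ν) {C : ℝ} (hC : ∀ y, |f y| ≤ C) (g : G) :
    ErgodicConverges ν T F (fun y => f y - f (T g y)) := by
  refine ⟨0, integrable_zero _ _ _, ae_of_all _ fun y => ?_, ?_⟩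
  · have hlim := (hF.2 g).const_mul C
    rw [mul_zero] at hlim
    refine squeeze_zero_norm (fun n => ?_) hlim
    have h1 := abs_sum_sub_sum_le (F n) ((F n).image (g * ·)) (fun h => f (T h y)) fun h => hC _
    rw [Finset.sum_image (mul_right_injective g).injOn] at h1
    simp only [hT.mul] at h1
    rw [orbitAverage, Finset.sum_sub_distrib, Real.norm_eq_abs, abs_div, Nat.abs_cast,
      ← mul_div_assoc]
    gcongr
  · rw [integral_sub hf (hT.integrable_comp hf g), hT.integral_comp hf.aestronglyMeasurable]
    simp

variable [IsProbabilityMeasure ν] {M : ℝ}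

lemma ErgodicConverges.of_approx (hT : IsMPAction ν T) (hF : IsFolner F) (hM : 0 < M)
    (hTemp : TempelmanWith F M) {f : Y → ℝ} (hf : Integrable f ν)
    (h : ∀ ε : ℝ, 0 < ε → ∃ g : Y → ℝ, Integrable g ν ∧ ErgodicConverges ν T F g ∧
      ∫ y, |f y - g y| ∂ν ≤ ε) : ErgodicConverges ν T F f := by
  have hcauchy : ∀ᵐ y ∂ν, CauchySeq fun n => orbitAverage T (F n) f y := by
    refine ae_cauchySeq_of_small_exceptional_set fun α hα ε hε => ?_
    obtain ⟨g, hgi, ⟨g', hg'i, hg', -⟩, hfg⟩ := h (ε * (α / 3) / M) (by positivity)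
    have hS := hT.isSuperFamily_sum (hf.sub hgi).abs fun y => abs_nonneg _
    have hmax := hS.measure_maximal_le hF hM hTemp (γ := ∫ y, |f y - g y| ∂ν)
      (fun n => by
        rw [hT.integral_sum (hf.sub hgi).abs, mul_comm]
        rfl) (show 0 < α / 3 by positivity)
    refine ⟨_, hmax.trans (ENNReal.ofReal_le_ofReal ?_), ?_⟩
    · rw [div_le_iff₀ (by positivity)]
      calc M * ∫ y, |f y - g y| ∂ν ≤ M * (ε * (α / 3) / M) := by gcongr
        _ = ε * (α / 3) := by field_simp
    · filter_upwards [hg'] with y hy hyE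
      simp only [not_exists, not_lt] at hyE
      have h1 : ∀ n, |orbitAverage T (F n) f y - orbitAverage T (F n) g y| ≤ α / 3 := fun n => by
        refine (abs_orbitAverage_sub_le _ _ _ _ _).trans ?_
        rw [orbitAverage, div_le_iff₀ (hF.card_pos n)]
        exact hyE n
      obtain ⟨N, hN⟩ := Metric.cauchySeq_iff.1 hy.cauchySeq (α / 3) (by positivity)
      refine ⟨N, fun p hp q hq => ?_⟩
      have h2 := hN p hp q hq
      rw [Real.dist_eq] at h2
      have hp' := abs_le.1 (h1 p)
      have hq' := abs_le.1 (h1 q)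
      have h2' := abs_lt.1 h2
      rw [abs_le]
      constructor <;> linarith [hp'.1, hp'.2, hq'.1, hq'.2, h2'.1, h2'.2]
  set f' : Y → ℝ := fun y => limUnder atTop fun n => orbitAverage T (F n) f y
  have hf' : ∀ᵐ y ∂ν, Tendsto (fun n => orbitAverage T (F n) f y) atTop (𝓝 (f' y)) := by
    filter_upwards [hcauchy] with y hy
    exact hy.tendsto_limUnder
  have key : ∀ ε : ℝ, 0 < ε → Integrable f' ν ∧ |∫ y, f' y ∂ν - ∫ y, f y ∂ν| ≤ 2 * ε := by
    intro ε hε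
    obtain ⟨g, hgi, ⟨g', hg'i, hg', hge⟩, hfg⟩ := h ε hε
    have hb := integrable_and_integral_abs_le_of_tendsto (ν := ν) (C := ε)
      (u := fun n y => orbitAverage T (F n) f y - orbitAverage T (F n) g y)
      (v := fun y => f' y - g' y)
      (fun n => (hT.integrable_orbitAverage hf _).sub (hT.integrable_orbitAverage hgi _))
      (by filter_upwards [hf', hg'] with y h1 h2 using h1.sub h2)
      (fun n => by
        refine le_trans ?_ hfg
        refine le_trans ?_ (hT.integral_orbitAverage (hf.sub hgi).abs (hF.1 n)).le
        exact integral_mono ((hT.integrable_orbitAverage hf _).sub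
          (hT.integrable_orbitAverage hgi _)).abs (hT.integrable_orbitAverage (hf.sub hgi).abs _)
          (abs_orbitAverage_sub_le _ _ _ _))
    have hf'i : Integrable f' ν := by
      have := hb.1.add hg'i
      refine this.congr (ae_of_all _ fun y => ?_)
      simp
    refine ⟨hf'i, ?_⟩
    have h1 : |∫ y, f' y ∂ν - ∫ y, g' y ∂ν| ≤ ε := by
      rw [← integral_sub hf'i hg'i]
      exact abs_integral_le_integral_abs.trans hb.2
    have h2 : |∫ y, f y ∂ν - ∫ y, g y ∂ν| ≤ ε := by
      rw [← integral_sub hf hgi]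
      exact abs_integral_le_integral_abs.trans hfg
    rw [hge] at h1
    rw [abs_le] at *
    constructor <;> linarith [h1.1, h1.2, h2.1, h2.2]
  refine ⟨f', (key 1 one_pos).1, hf', ?_⟩
  refine sub_eq_zero.1 (abs_nonpos_iff.1 (le_of_forall_pos_le_add fun ε hε => ?_))
  have := (key (ε / 2) (by positivity)).2
  linarith

lemma ErgodicConverges.of_coboundary (hT : IsMPAction ν T) (hF : IsFolner F) (hM : 0 < M)
    (hTemp : TempelmanWith F M) {f : Y → ℝ} (hf : Integrable f ν) (g : G) :
    ErgodicConverges ν T F (fun y => f y - f (T g y)) := by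
  refine .of_approx hT hF hM hTemp (hf.sub (hT.integrable_comp hf g)) fun ε hε => ?_
  obtain ⟨s, hsi, hs⟩ := exists_simpleFunc_integral_abs_sub_le hf (half_pos hε)
  obtain ⟨C, hC⟩ := s.exists_forall_norm_le
  refine ⟨_, hsi.sub (hT.integrable_comp hsi g), .of_bounded_coboundary hT hF hsi hC g, ?_⟩
  have hi : Integrable (fun y => |f y - s y|) ν := (hf.sub hsi).abs
  have h1 := hT.integral_comp hi.aestronglyMeasurable g
  calc ∫ y, |f y - f (T g y) - (s y - s (T g y))| ∂ν
      ≤ ∫ y, |f y - s y| + |f (T g y) - s (T g y)| ∂ν := by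
        refine integral_mono ?_ (hi.add (hT.integrable_comp hi g)) fun y => ?_
        · exact ((hf.sub (hT.integrable_comp hf g)).sub (hsi.sub (hT.integrable_comp hsi g))).abs
        · simp only
          rw [show f y - f (T g y) - (s y - s (T g y)) =
            (f y - s y) - (f (T g y) - s (T g y)) by ring]
          exact abs_sub _ _
    _ ≤ ε := by
        rw [integral_add hi (hT.integrable_comp hi g), h1]
        linarith

lemma integral_abs_sub_le_norm_Lp_two (φ ψ : Lp ℝ 2 ν) : ∫ y, |φ y - ψ y| ∂ν ≤ ‖φ - ψ‖ := by
  have hi : MemLp (φ - ψ : Lp ℝ 2 ν) 2 ν := Lp.memLp _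
  have hi1 : Integrable (φ - ψ : Lp ℝ 2 ν) ν := hi.integrable one_le_two
  have h1 : ∫ y, |φ y - ψ y| ∂ν = ∫ y, ‖(φ - ψ : Lp ℝ 2 ν) y‖ ∂ν := by
    refine integral_congr_ae ?_
    filter_upwards [Lp.coeFn_sub φ ψ] with y hy
    rw [hy, Pi.sub_apply, Real.norm_eq_abs]
  rw [h1, Lp.norm_def, ← ENNReal.ofReal_le_iff_le_toReal hi.2.ne,
    ofReal_integral_norm_eq_lintegral_enorm hi1, ← eLpNorm_one_eq_lintegral_enorm]
  exact eLpNorm_le_eLpNorm_of_exponent_le one_le_two hi.1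

/-- The square-integrable functions whose averages converge. -/
def convergentSubmodule [Countable G] (F : ℕ → Finset G) (hT : IsMPAction ν T) :
    Submodule ℝ (Lp ℝ 2 ν) where
  carrier := {φ | ErgodicConverges ν T F φ}
  zero_mem' := ErgodicConverges.zero.congr hT (Lp.coeFn_zero _ _ _).symm
  add_mem' {φ ψ} hφ hψ := (hφ.add hψ ((Lp.memLp φ).integrable one_le_two)
    ((Lp.memLp ψ).integrable one_le_two)).congr hT (Lp.coeFn_add φ ψ).symm
  smul_mem' c φ hφ := (hφ.const_smul c).congr hT (Lp.coeFn_smul c φ).symm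

lemma isClosed_convergentSubmodule [Countable G] (hT : IsMPAction ν T) (hF : IsFolner F)
    (hM : 0 < M) (hTemp : TempelmanWith F M) :
    IsClosed (convergentSubmodule F hT : Set (Lp ℝ 2 ν)) := by
  refine isClosed_of_closure_subset fun φ hφ => ?_
  refine ErgodicConverges.of_approx hT hF hM hTemp ((Lp.memLp φ).integrable one_le_two)
    fun ε hε => ?_
  obtain ⟨ψ, hψ, hd⟩ := Metric.mem_closure_iff.1 hφ ε hε
  refine ⟨ψ, (Lp.memLp ψ).integrable one_le_two, hψ, ?_⟩
  rw [dist_eq_norm] at hd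
  exact (integral_abs_sub_le_norm_Lp_two φ ψ).trans hd.le

lemma orthogonal_convergentSubmodule [Countable G] (hT : IsMPAction ν T) (hF : IsFolner F)
    (hM : 0 < M) (hTemp : TempelmanWith F M) : (convergentSubmodule F hT)ᗮ = ⊥ := by
  refine (Submodule.eq_bot_iff _).2 fun φ hφ => ?_
  rw [Submodule.mem_orthogonal] at hφ
  have hinv : ∀ g, Lp.compMeasurePreserving (T g) (hT.measurePreserving g) φ = φ := by
    intro g
    have hc := Lp.coeFn_compMeasurePreserving φ (hT.measurePreserving g)
    have hmem : φ - Lp.compMeasurePreserving (T g) (hT.measurePreserving g) φ ∈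
        convergentSubmodule F hT := by
      refine (ErgodicConverges.of_coboundary hT hF hM hTemp
        ((Lp.memLp φ).integrable one_le_two) g).congr hT ?_
      filter_upwards [hc, Lp.coeFn_sub φ
        (Lp.compMeasurePreserving (T g) (hT.measurePreserving g) φ)] with y h1 h2
      rw [h2, Pi.sub_apply, h1, Function.comp_apply]
    have h0 := hφ _ hmem
    rw [inner_sub_left, real_inner_self_eq_norm_sq, sub_eq_zero] at h0
    refine Lp_two_eq_of_inner_eq ?_ (Lp.norm_compMeasurePreserving _ _)
    rw [real_inner_comm, h0]
  have hmem : φ ∈ convergentSubmodule F hT := by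
    refine ErgodicConverges.of_invariant hF.1 ((Lp.memLp φ).integrable one_le_two) fun g => ?_
    have hc := Lp.coeFn_compMeasurePreserving φ (hT.measurePreserving g)
    rw [hinv g] at hc
    exact hc.symm
  exact inner_self_eq_zero.1 (hφ φ hmem)

/-- The pointwise ergodic theorem along Følner sequences with the Tempelman condition. -/
theorem ErgodicConverges.of_integrable [Countable G] (hT : IsMPAction ν T) (hF : IsFolner F)
    (hM : 0 < M) (hTemp : TempelmanWith F M) {f : Y → ℝ} (hf : Integrable f ν) :
    ErgodicConverges ν T F f := by
  have htop : convergentSubmodule F hT = ⊤ := by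
    rw [← (isClosed_convergentSubmodule hT hF hM hTemp).submodule_topologicalClosure_eq,
      Submodule.topologicalClosure_eq_top_iff]
    exact orthogonal_convergentSubmodule hT hF hM hTemp
  refine .of_approx hT hF hM hTemp hf fun ε hε => ?_
  obtain ⟨s, hsi, hs⟩ := exists_simpleFunc_integral_abs_sub_le hf hε
  have hs2 : MemLp s 2 ν := s.memLp_of_isFiniteMeasure 2 ν
  have hmem : hs2.toLp s ∈ convergentSubmodule F hT := htop ▸ Submodule.mem_top
  exact ⟨s, hsi, ErgodicConverges.congr hT hmem hs2.coeFn_toLp, hs⟩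

end AdditiveTheorem

section Inflation

variable {G : Type*} [Group G] {A : Finset G} {φ : G →* G}

lemma TilesWith.eq_of_mul_eq {C : Set G} (h : TilesWith A C) {a b c c' : G} (ha : a ∈ A)
    (hb : b ∈ A) (hc : c ∈ C) (hc' : c' ∈ C) (he : a * c = b * c') : c = c' :=
  (h (a * c)).unique ⟨hc, a, ha, rfl⟩ ⟨hc', b, hb, he⟩

lemma IsMPAction.comp_hom {Y : Type*} [MeasurableSpace Y] {ν : Measure Y} {T : G → Y → Y}
    (hT : IsMPAction ν T) (φ : G →* G) : IsMPAction ν fun g => T (φ g) where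
  measurePreserving g := hT.measurePreserving (φ g)
  mul g h y := by rw [map_mul, hT.mul]

variable [DecidableEq G]

lemma mul_image_eq_biUnion (A B : Finset G) (φ : G → G) :
    A * B.image φ = B.biUnion fun g => A.image (· * φ g) := by
  ext x
  simp only [Finset.mem_mul, Finset.mem_image, Finset.mem_biUnion]
  constructor
  · rintro ⟨a, ha, _, ⟨b, hb, rfl⟩, rfl⟩
    exact ⟨b, hb, a, ha, rfl⟩
  · rintro ⟨b, hb, a, ha, rfl⟩
    exact ⟨a, ha, _, ⟨b, hb, rfl⟩, rfl⟩

lemma TilesWith.disjoint_image {C : Set G} (h : TilesWith A C) {c c' : G} (hc : c ∈ C)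
    (hc' : c' ∈ C) (hne : c ≠ c') : Disjoint (A.image (· * c)) (A.image (· * c')) := by
  refine Finset.disjoint_left.2 fun x hx hx' => hne ?_
  obtain ⟨a, ha, rfl⟩ := Finset.mem_image.1 hx
  obtain ⟨b, hb, hab⟩ := Finset.mem_image.1 hx'
  exact h.eq_of_mul_eq ha hb hc hc' hab.symm

lemma TilesWith.disjoint_image_map (h : TilesWith A (Set.range φ)) (hφ : Function.Injective φ)
    {g g' : G} (hne : g ≠ g') : Disjoint (A.image (· * φ g)) (A.image (· * φ g')) :=
  h.disjoint_image ⟨g, rfl⟩ ⟨g', rfl⟩ (hφ.ne hne)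

lemma TilesWith.disjoint_mul_image (h : TilesWith A (Set.range φ)) (hφ : Function.Injective φ)
    {B B' : Finset G} (hB : Disjoint B B') : Disjoint (A * B.image φ) (A * B'.image φ) := by
  rw [mul_image_eq_biUnion, mul_image_eq_biUnion, Finset.disjoint_biUnion_left]
  intro g hg
  rw [Finset.disjoint_biUnion_right]
  intro g' hg'
  exact h.disjoint_image_map hφ fun e => Finset.disjoint_left.1 hB hg (e ▸ hg')

lemma TilesWith.card_mul_image (h : TilesWith A (Set.range φ)) (hφ : Function.Injective φ)
    (B : Finset G) : (A * B.image φ).card = A.card * B.card := by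
  rw [mul_image_eq_biUnion, Finset.card_biUnion fun g _ g' _ hne => h.disjoint_image_map hφ hne]
  simp only [Finset.card_image_of_injective _ (mul_left_injective _), Finset.sum_const,
    smul_eq_mul, mul_comm]

lemma mul_image_image_mul (A B : Finset G) (φ : G →* G) (g : G) :
    A * (B.image (· * g)).image φ = (A * B.image φ).image (· * φ g) := by
  rw [mul_image_eq_biUnion, mul_image_eq_biUnion, Finset.biUnion_image, Finset.image_biUnion]
  simp only [Finset.image_image, Function.comp_def, mul_assoc, map_mul]

lemma TilesWith.tiles_mul_image (h : TilesWith A (Set.range φ)) (hφ : Function.Injective φ)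
    (hA : A.Nonempty) {B : Finset G} (hB : Tiles B) : Tiles (A * B.image φ) := by
  obtain ⟨hBne, C, hC⟩ := hB
  refine ⟨hA.mul (hBne.image _), φ '' C, fun x => ?_⟩
  obtain ⟨_, ⟨⟨x', rfl⟩, a, ha, rfl⟩, -⟩ := h x
  obtain ⟨c, ⟨hc, b, hb, rfl⟩, -⟩ := hC x'
  refine ⟨φ c, ⟨⟨c, hc, rfl⟩, a * φ b,
    Finset.mul_mem_mul ha (Finset.mem_image_of_mem _ hb), by rw [map_mul, mul_assoc]⟩, ?_⟩
  rintro _ ⟨⟨c', hc', rfl⟩, t, ht, he⟩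
  obtain ⟨a', ha', _, hφb', rfl⟩ := Finset.mem_mul.1 ht
  obtain ⟨b', hb', rfl⟩ := Finset.mem_image.1 hφb'
  rw [mul_assoc, ← map_mul] at he
  have h1 := hφ (h.eq_of_mul_eq ha ha' ⟨_, rfl⟩ ⟨_, rfl⟩ he)
  exact congrArg φ (hC.eq_of_mul_eq hb hb' hc hc' h1).symm

variable {Y : Type*} [MeasurableSpace Y] {ν : Measure Y} {T : G → Y → Y} {S : Finset G → Y → ℝ}

/-- A superadditive process viewed along the blocks of a self-similar tile, minus its additive
part. -/
lemma IsSuperFamily.inflate (hS : IsSuperFamily ν T S) (h : TilesWith A (Set.range φ))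
    (hφ : Function.Injective φ) : IsSuperFamily ν (fun g => T (φ g))
      fun B y => S (A * B.image φ) y - ∑ g ∈ B, S A (T (φ g) y) where
  action := hS.action.comp_hom φ
  integrable B := (hS.integrable _).sub
    (integrable_finsetSum _ fun g _ => hS.action.integrable_comp (hS.integrable A) (φ g))
  nonneg := by
    filter_upwards [hS.nonneg, hS.invariant, hS.superadditive] with y h0 hinv hsup B
    have := sum_le_biUnion_of_superadditive (s := fun A => S A y) h0 hsup B
      (fun g => A.image (· * φ g)) fun g _ g' _ hne => h.disjoint_image_map hφ hne
    simp only [← mul_image_eq_biUnion, hinv] at this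
    linarith
  invariant := by
    filter_upwards [hS.invariant] with y hinv B g
    rw [mul_image_image_mul, hinv, Finset.sum_image (mul_left_injective g).injOn]
    simp [hS.action.mul]
  superadditive := by
    filter_upwards [hS.superadditive] with y hsup B B' hB
    have := hsup _ _ (h.disjoint_mul_image hφ hB)
    rw [Finset.image_union, Finset.mul_union, Finset.sum_union hB]
    linarith

lemma IsSuperFamily.integral_image_mul (hS : IsSuperFamily ν T S) (A : Finset G) (g : G) :
    ∫ y, S (A.image (· * g)) y ∂ν = ∫ y, S A y ∂ν := by
  rw [← hS.action.integral_comp (hS.integrable A).aestronglyMeasurable g]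
  refine integral_congr_ae ?_
  filter_upwards [hS.invariant] with y hy using hy A g

lemma IsSuperFamily.integral_nonneg (hS : IsSuperFamily ν T S) (A : Finset G) :
    0 ≤ ∫ y, S A y ∂ν := by
  refine integral_nonneg_of_ae ?_
  filter_upwards [hS.nonneg] with y hy using hy A

lemma IsSuperFamily.card_translateCore_mul_integral_le (hS : IsSuperFamily ν T S)
    {C : Set G} (hA : TilesWith A C) (K : Finset G) :
    ((translateCore K (A * A⁻¹)).card : ℝ) * ∫ y, S A y ∂ν ≤ A.card * ∫ y, S K y ∂ν := by
  classical
  set I := (A⁻¹ * K).filter fun c => c ∈ C ∧ A.image (· * c) ⊆ K with hI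
  have hcover : translateCore K (A * A⁻¹) ⊆ I.biUnion fun c => A.image (· * c) := by
    intro x hx
    obtain ⟨hxK, hx⟩ := Finset.mem_filter.1 hx
    obtain ⟨c, ⟨hc, t, ht, rfl⟩, -⟩ := hA x
    refine Finset.mem_biUnion.2 ⟨c, Finset.mem_filter.2 ⟨?_, hc, ?_⟩,
      Finset.mem_image.2 ⟨t, ht, rfl⟩⟩
    · have := Finset.mul_mem_mul (Finset.inv_mem_inv ht) hxK
      rwa [inv_mul_cancel_left] at this
    · intro z hz
      obtain ⟨s, hs, rfl⟩ := Finset.mem_image.1 hz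
      have := hx (s * t⁻¹) (Finset.mul_mem_mul hs (Finset.inv_mem_inv ht))
      rwa [mul_assoc, inv_mul_cancel_left] at this
  have hcard : (translateCore K (A * A⁻¹)).card ≤ I.card * A.card :=
    (Finset.card_le_card hcover).trans
      (Finset.card_biUnion_le_card_mul _ _ _ fun c _ => Finset.card_image_le)
  have hint : (I.card : ℝ) * ∫ y, S A y ∂ν ≤ ∫ y, S K y ∂ν := by
    have h1 : ∫ y, ∑ c ∈ I, S (A.image (· * c)) y ∂ν ≤ ∫ y, S K y ∂ν := by
      refine integral_mono_ae (integrable_finsetSum _ fun c _ => hS.integrable _)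
        (hS.integrable K) ?_
      filter_upwards [hS.nonneg, hS.superadditive] with y h0 hsup
      refine (sum_le_biUnion_of_superadditive (s := fun A => S A y) h0 hsup I _
        fun c hc c' hc' hne => hA.disjoint_image (Finset.mem_filter.1 hc).2.1
          (Finset.mem_filter.1 hc').2.1 hne).trans
        (mono_of_superadditive (s := fun A => S A y) h0 hsup ?_)
      exact Finset.biUnion_subset.2 fun c hc => (Finset.mem_filter.1 hc).2.2
    rw [integral_finsetSum _ fun c _ => hS.integrable _] at h1
    simpa only [hS.integral_image_mul, Finset.sum_const, nsmul_eq_mul] using h1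
  calc ((translateCore K (A * A⁻¹)).card : ℝ) * ∫ y, S A y ∂ν
      ≤ ((I.card * A.card : ℕ) : ℝ) * ∫ y, S A y ∂ν := by
        have := hS.integral_nonneg A
        gcongr
    _ = A.card * (I.card * ∫ y, S A y ∂ν) := by push_cast; ring
    _ ≤ A.card * ∫ y, S K y ∂ν := by gcongr

lemma IsSuperFamily.eventually_lt_integral_div (hS : IsSuperFamily ν T S)
    {F : ℕ → Finset G} (hF : IsFolner F) (hA : Tiles A) {r : ℝ}
    (hr : r < (∫ y, S A y ∂ν) / A.card) :
    ∀ᶠ n in atTop, r < (∫ y, S (F n) y ∂ν) / (F n).card := by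
  obtain ⟨hne, C, hC⟩ := hA
  have hA0 : (0 : ℝ) < A.card := by exact_mod_cast hne.card_pos
  have hlim := (hF.tendsto_translateCore (A * A⁻¹)).mul_const ((∫ y, S A y ∂ν) / A.card)
  rw [one_mul] at hlim
  filter_upwards [hlim.eventually (lt_mem_nhds hr)] with n hn
  refine hn.trans_le ?_
  have h1 := hS.card_translateCore_mul_integral_le hC (F n)
  rw [div_mul_div_comm, div_le_div_iff₀ (mul_pos (hF.card_pos n) hA0) (hF.card_pos n)]
  calc _ ≤ (A.card * ∫ y, S (F n) y ∂ν) * (F n).card :=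
        mul_le_mul_of_nonneg_right h1 (hF.card_pos n).le
    _ = _ := by ring

end Inflation

section SuperadditiveTheorem

variable {G : Type*} [Group G] [DecidableEq G]

/-- The sets `F p` are approximated from outside and inside by unions of blocks
`A * φ (F n)`, along a homomorphism `φ`. -/
def ApproximatedBy (F : ℕ → Finset G) (A : Finset G) (φ : G →* G) : Prop :=
  ∀ δ : ℝ, 0 < δ → ∀ᶠ p in atTop, ∃ n₁ n₂ : ℕ,
    F p ⊆ A * (F n₁).image φ ∧ A * (F n₂).image φ ⊆ F p ∧
      (((F n₁).card : ℝ) - ((F n₂).card : ℝ)) / ((F p).card : ℝ) < δ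

variable {F : ℕ → Finset G} {A : Finset G} {φ : G →* G}

lemma ApproximatedBy.eventually_exists [Infinite G] (happ : ApproximatedBy F A φ)
    (hF : IsFolner F) (h : TilesWith A (Set.range φ)) (hφ : Function.Injective φ)
    (hA : A.Nonempty) {δ : ℝ} (hδ : 0 < δ) (N : ℕ) :
    ∀ᶠ p in atTop, ∃ n₁ ≥ N, ∃ n₂ ≥ N, F p ⊆ A * (F n₁).image φ ∧ A * (F n₂).image φ ⊆ F p ∧
      ((F n₁).card : ℝ) / (F p).card ≤ 1 / A.card + δ ∧
      1 / A.card - δ ≤ ((F n₂).card : ℝ) / (F p).card ∧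
      ((F n₂).card : ℝ) / (F p).card ≤ 1 / A.card := by
  have hA0 : (0 : ℝ) < A.card := by exact_mod_cast hA.card_pos
  set K : ℝ := ∑ n ∈ Finset.range N, ((F n).card : ℝ) with hK
  have hlarge : ∀ n, K < (F n).card → N ≤ n := by
    intro n hn
    by_contra hlt
    refine absurd hn (not_lt.2 ?_)
    exact Finset.single_le_sum (f := fun n => ((F n).card : ℝ)) (fun i _ => Nat.cast_nonneg _)
      (Finset.mem_range.2 (not_le.1 hlt))
  have hδ' : 0 < min δ (1 / (2 * A.card)) := lt_min hδ (by positivity)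
  filter_upwards [happ _ hδ', hF.tendsto_card.eventually (eventually_gt_atTop (2 * A.card * K))]
    with p ⟨n₁, n₂, h1, h2, h3⟩ hp
  have hp0 := hF.card_pos p
  have hc1 : ((F p).card : ℝ) ≤ A.card * (F n₁).card := by
    exact_mod_cast (Finset.card_le_card h1).trans_eq (h.card_mul_image hφ _)
  have hc2 : (A.card : ℝ) * (F n₂).card ≤ (F p).card := by
    exact_mod_cast (h.card_mul_image hφ _).symm.trans_le (Finset.card_le_card h2)
  have hr1 : 1 / (A.card : ℝ) ≤ (F n₁).card / (F p).card := by
    rw [div_le_div_iff₀ hA0 hp0]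
    linarith
  have hr2 : ((F n₂).card : ℝ) / (F p).card ≤ 1 / A.card := by
    rw [div_le_div_iff₀ hp0 hA0]
    linarith
  rw [sub_div] at h3
  have h4 := h3.trans_le (min_le_left _ _)
  have h5 := h3.trans_le (min_le_right _ _)
  have hhalf : (1 : ℝ) / (2 * A.card) = 1 / A.card - 1 / (2 * A.card) := by
    field_simp
    norm_num
  have hr3 : 1 / (2 * (A.card : ℝ)) ≤ (F n₂).card / (F p).card := by linarith
  have hn2 : K < (F n₂).card := by
    rw [div_le_div_iff₀ (mul_pos two_pos hA0) hp0] at hr3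
    have : 2 * (A.card : ℝ) * K < (F n₂).card * (2 * A.card) := by linarith
    rw [mul_comm] at this
    exact lt_of_mul_lt_mul_right this (mul_pos two_pos hA0).le
  have hn1 : K < (F n₁).card := by
    have : ((F n₂).card : ℝ) ≤ (F n₁).card := by
      exact (div_le_div_iff_of_pos_right hp0).1 (hr2.trans hr1)
    linarith
  exact ⟨n₁, hlarge _ hn1, n₂, hlarge _ hn2, h1, h2, by linarith, by linarith, hr2⟩

lemma ApproximatedBy.eventually_lower [Infinite G] (happ : ApproximatedBy F A φ)
    (hF : IsFolner F) (h : TilesWith A (Set.range φ)) (hφ : Function.Injective φ)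
    (hA : A.Nonempty) {s : Finset G → ℝ} (hs : ∀ B B', B ⊆ B' → s B ≤ s B') {a : ℕ → ℝ} {L : ℝ}
    (ha : Tendsto a atTop (𝓝 L)) (hL : 0 ≤ L)
    (hsa : ∀ n, a n * (F n).card ≤ s (A * (F n).image φ)) {η : ℝ} (hη : 0 < η) :
    ∀ᶠ p in atTop, L / A.card - η ≤ s (F p) / (F p).card := by
  have hA0 : (0 : ℝ) < A.card := by exact_mod_cast hA.card_pos
  set ε := η * A.card / 2 with hε
  have hε0 : 0 < ε := by positivity
  set δ := η / (2 * (L + 1)) with hδ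
  have hδ0 : 0 < δ := by positivity
  obtain ⟨N, hN⟩ := eventually_atTop.1 (ha.eventually (lt_mem_nhds (sub_lt_self L hε0)))
  filter_upwards [happ.eventually_exists hF h hφ hA hδ0 N] with p ⟨_, _, n, hn, _, hsub, _, h1, h2⟩
  have hp := hF.card_pos p
  set r : ℝ := (F n).card / (F p).card with hr
  have hr0 : 0 ≤ r := by positivity
  have h3 : (L - ε) * r ≤ s (F p) / (F p).card := by
    rw [hr, ← mul_div_assoc]
    gcongr
    refine le_trans ?_ ((hsa n).trans (hs _ _ hsub))
    gcongr
    exact (hN n hn).le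
  have h4 : ε * r ≤ η / 2 := by
    calc ε * r ≤ ε * (1 / A.card) := by gcongr
      _ = η / 2 := by rw [hε]; field_simp
  have h5 : L / A.card - L * δ ≤ L * r := by
    have := mul_le_mul_of_nonneg_left h1 hL
    calc L / A.card - L * δ = L * (1 / A.card - δ) := by ring
      _ ≤ L * r := this
  have h6 : L * δ ≤ η / 2 := by
    rw [hδ, ← mul_div_assoc, div_le_div_iff₀ (by positivity) two_pos]
    nlinarith
  nlinarith

lemma ApproximatedBy.eventually_upper [Infinite G] (happ : ApproximatedBy F A φ)
    (hF : IsFolner F) (h : TilesWith A (Set.range φ)) (hφ : Function.Injective φ)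
    (hA : A.Nonempty) {s : Finset G → ℝ} (hs : ∀ B B', B ⊆ B' → s B ≤ s B') {a : ℕ → ℝ} {L : ℝ}
    (ha : Tendsto a atTop (𝓝 L)) (hL : 0 ≤ L) {α : ℝ} (hα : 0 < α)
    (hsa : ∀ n, s (A * (F n).image φ) ≤ (a n + α * A.card) * (F n).card) :
    ∀ᶠ p in atTop, s (F p) / (F p).card ≤ L / A.card + 2 * α := by
  have hA0 : (0 : ℝ) < A.card := by exact_mod_cast hA.card_pos
  obtain ⟨ε, hε⟩ : ∃ ε : ℝ, ε = α * A.card / 2 := ⟨_, rfl⟩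
  have hε0 : 0 < ε := by rw [hε]; positivity
  obtain ⟨D, hD⟩ : ∃ D : ℝ, D = L + ε + α * A.card := ⟨_, rfl⟩
  have hD0 : 0 < D := by rw [hD]; positivity
  obtain ⟨δ, hδ⟩ : ∃ δ : ℝ, δ = α / (2 * D) := ⟨_, rfl⟩
  have hδ0 : 0 < δ := by rw [hδ]; positivity
  obtain ⟨N, hN⟩ := eventually_atTop.1 (ha.eventually (gt_mem_nhds (lt_add_of_pos_right L hε0)))
  filter_upwards [happ.eventually_exists hF h hφ hA hδ0 N] with p ⟨n, hn, _, _, hsub, _, h1, _, _⟩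
  have hp := hF.card_pos p
  calc s (F p) / (F p).card ≤ D * (F n).card / (F p).card := by
        gcongr
        refine ((hs _ _ hsub).trans (hsa n)).trans ?_
        have := hN n hn
        gcongr
        linarith
    _ = D * ((F n).card / (F p).card) := mul_div_assoc _ _ _
    _ ≤ D * (1 / A.card + δ) := by gcongr
    _ = L / A.card + 2 * α := by
        have h1 : D * δ = α / 2 := by
          rw [hδ]
          field_simp
        rw [mul_add, h1, hD, hε]
        field_simp
        ring

variable [Countable G] [Infinite G] {Y : Type*} [MeasurableSpace Y] {ν : Measure Y}
  [IsProbabilityMeasure ν] {T : G → Y → Y} {S : Finset G → Y → ℝ} {M : ℝ}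

lemma IsSuperFamily.exists_block_limit (hS : IsSuperFamily ν T S) (hF : IsFolner F)
    (hM : 0 < M) (hTemp : TempelmanWith F M) {γ : ℝ}
    (hγ : ∀ B, Tiles B → ∫ y, S B y ∂ν ≤ γ * B.card) (hFt : ∀ n, Tiles (F n))
    (h : TilesWith A (Set.range φ)) (hφ : Function.Injective φ) (hA : A.Nonempty)
    (happ : ApproximatedBy F A φ) : ∃ b : Y → ℝ, Integrable b ν ∧
      ∫ y, b y ∂ν = (∫ y, S A y ∂ν) / A.card ∧
      (∀ᵐ y ∂ν, ∀ η : ℝ, 0 < η → ∀ᶠ p in atTop, b y - η ≤ S (F p) y / (F p).card) ∧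
      ∀ α : ℝ, 0 < α → ∃ E : Set Y,
        ν E ≤ ENNReal.ofReal (M * (γ - (∫ y, S A y ∂ν) / A.card) / α) ∧
        ∀ᵐ y ∂ν, y ∉ E → ∀ᶠ p in atTop, S (F p) y / (F p).card ≤ b y + 2 * α := by
  have hA0 : (0 : ℝ) < A.card := by exact_mod_cast hA.card_pos
  obtain ⟨b, hbi, hb, hbe⟩ :=
    ErgodicConverges.of_integrable (hS.action.comp_hom φ) hF hM hTemp (hS.integrable A)
  have hI := hS.inflate h hφ
  have hnn : ∀ᵐ y ∂ν, ∀ g : G, 0 ≤ S A (T (φ g) y) := by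
    filter_upwards [hS.action.ae_forall_comp hS.nonneg] with y hy g using hy _ _
  have hb0 : ∀ᵐ y ∂ν, 0 ≤ b y := by
    filter_upwards [hb, hnn] with y h1 h2
    exact ge_of_tendsto' h1 fun n => div_nonneg (Finset.sum_nonneg fun g _ => h2 g)
      (Nat.cast_nonneg _)
  have hsum : ∀ n y, orbitAverage (fun g => T (φ g)) (F n) (S A) y * (F n).card
      = ∑ g ∈ F n, S A (T (φ g) y) := fun n y => div_mul_cancel₀ _ (hF.card_pos n).ne'
  refine ⟨fun y => b y / A.card, hbi.div_const _, by rw [integral_div, hbe], ?_, ?_⟩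
  · filter_upwards [hb, hb0, hS.nonneg, hS.superadditive, hI.nonneg] with y h1 h2 h3 h4 h5 η hη
    refine happ.eventually_lower hF h hφ hA (s := fun B => S B y)
      (fun B B' hB => mono_of_superadditive (s := fun B => S B y) h3 h4 hB) h1 h2 (fun n => ?_) hη
    rw [hsum]
    linarith [h5 (F n)]
  · intro α hα
    have hmax := hI.measure_maximal_le hF hM hTemp
      (γ := γ * A.card - ∫ y, S A y ∂ν) (fun n => by
        rw [integral_sub (hS.integrable _) (integrable_finsetSum _ fun g _ =>
          hS.action.integrable_comp (hS.integrable A) (φ g)),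
          (hS.action.comp_hom φ).integral_sum (hS.integrable A)]
        have := hγ _ (h.tiles_mul_image hφ hA (hFt n))
        rw [h.card_mul_image hφ] at this
        push_cast at this
        linarith) (show 0 < α * A.card by positivity)
    refine ⟨_, hmax.trans (ENNReal.ofReal_le_ofReal (le_of_eq ?_)), ?_⟩
    · field_simp
    · filter_upwards [hb, hb0, hS.nonneg, hS.superadditive] with y h1 h2 h3 h4 hyE
      simp only [not_exists, not_lt] at hyE
      refine happ.eventually_upper hF h hφ hA (s := fun B => S B y)
        (fun B B' hB => mono_of_superadditive (s := fun B => S B y) h3 h4 hB) h1 h2 hα fun n => ?_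
      rw [add_mul, hsum]
      linarith [hyE n]

/-- The pointwise ergodic theorem for non-negative superadditive processes. -/
theorem IsSuperFamily.exists_limit (hS : IsSuperFamily ν T S) (hF : IsFolner F)
    (hM : 0 < M) (hTemp : TempelmanWith F M) {γ : ℝ}
    (hγ : ∀ B, Tiles B → ∫ y, S B y ∂ν ≤ γ * B.card)
    (hγ' : ∀ ε : ℝ, 0 < ε → ∃ B, Tiles B ∧ γ - ε < (∫ y, S B y ∂ν) / B.card)
    (φ : ℕ → G →* G) (hφ : ∀ n, Function.Injective (φ n))
    (htile : ∀ n, TilesWith (F n) (Set.range (φ n)))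
    {𝒩 : Set ℕ} (h𝒩 : 𝒩.Infinite) (happ : ∀ m ∈ 𝒩, ApproximatedBy F (F m) (φ m)) :
    ∃ s : Y → ℝ, Integrable s ν ∧
      (∀ᵐ y ∂ν, Tendsto (fun n => S (F n) y / (F n).card) atTop (𝓝 (s y))) ∧
      ∫ y, s y ∂ν = γ := by
  have hFt : ∀ n, Tiles (F n) := fun n => ⟨hF.1 n, _, htile n⟩
  have hexists : ∀ ε : ℝ, 0 < ε → ∃ m ∈ 𝒩, γ - ε < (∫ y, S (F m) y ∂ν) / (F m).card := by
    intro ε hε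
    obtain ⟨B, hB, hlt⟩ := hγ' ε hε
    obtain ⟨N, hN⟩ := eventually_atTop.1 (hS.eventually_lt_integral_div hF hB hlt)
    obtain ⟨m, hm, hmN⟩ := h𝒩.exists_gt N
    exact ⟨m, hm, hN m hmN.le⟩
  have hblock := fun m (hm : m ∈ 𝒩) => hS.exists_block_limit hF hM hTemp hγ hFt (htile m) (hφ m)
    (hF.1 m) (happ m hm)
  have hcauchy : ∀ᵐ y ∂ν, CauchySeq fun n => S (F n) y / (F n).card := by
    refine ae_cauchySeq_of_small_exceptional_set fun α hα ε hε => ?_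
    obtain ⟨m, hm, hlt⟩ := hexists (ε * (α / 4) / M) (by positivity)
    obtain ⟨b, -, -, hlow, hup⟩ := hblock m hm
    obtain ⟨E, hE, hEup⟩ := hup (α / 4) (by positivity)
    refine ⟨E, hE.trans (ENNReal.ofReal_le_ofReal ?_), ?_⟩
    · rw [div_le_iff₀ (by positivity)]
      calc M * (γ - (∫ y, S (F m) y ∂ν) / (F m).card) ≤ M * (ε * (α / 4) / M) := by
            gcongr
            linarith
        _ = ε * (α / 4) := by field_simp
    · filter_upwards [hlow, hEup] with y h1 h2 hy
      obtain ⟨N, hN⟩ := eventually_atTop.1 ((h1 (α / 2) (by positivity)).and (h2 hy))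
      refine ⟨N, fun p hp q hq => ?_⟩
      obtain ⟨hp1, hp2⟩ := hN p hp
      obtain ⟨hq1, hq2⟩ := hN q hq
      rw [abs_le]
      constructor <;> linarith
  set s : Y → ℝ := fun y => limUnder atTop fun n => S (F n) y / (F n).card
  have hs : ∀ᵐ y ∂ν, Tendsto (fun n => S (F n) y / (F n).card) atTop (𝓝 (s y)) := by
    filter_upwards [hcauchy] with y hy using hy.tendsto_limUnder
  obtain ⟨hsi, hsγ⟩ := integrable_and_integral_abs_le_of_tendsto (C := γ)
    (fun n => (hS.integrable (F n)).div_const _) hs (fun n => by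
      have h1 : ∫ y, |S (F n) y / (F n).card| ∂ν = ∫ y, S (F n) y / (F n).card ∂ν := by
        refine integral_congr_ae ?_
        filter_upwards [hS.nonneg] with y hy
        exact abs_of_nonneg (div_nonneg (hy _) (Nat.cast_nonneg _))
      rw [h1, integral_div, div_le_iff₀ (hF.card_pos n)]
      exact hγ _ (hFt n))
  refine ⟨s, hsi, hs, le_antisymm ?_ (le_of_forall_pos_le_add fun ε hε => ?_)⟩
  · exact (integral_mono hsi hsi.abs fun y => le_abs_self _).trans hsγ
  · obtain ⟨m, hm, hlt⟩ := hexists ε hε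
    obtain ⟨b, hbi, hbe, hlow, -⟩ := hblock m hm
    have hle : ∫ y, b y ∂ν ≤ ∫ y, s y ∂ν := by
      refine integral_mono_ae hbi hsi ?_
      filter_upwards [hs, hlow] with y h1 h2
      refine le_of_forall_pos_le_add fun η hη => ?_
      have := ge_of_tendsto h1 (h2 η hη)
      linarith
    linarith

end SuperadditiveTheorem

section Reduction

variable {G : Type*} [Group G] {Y : Type*} [MulAction G Y]

lemma isMPAction_smul [MeasurableSpace Y] {ν : Measure Y}
    (hact : ∀ g : G, MeasurePreserving (fun y : Y => g • y) ν ν) :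
    IsMPAction ν fun (g : G) (y : Y) => g • y :=
  ⟨hact, fun g h y => mul_smul g h y⟩

variable [DecidableEq G] {d : Finset G → Y → ℝ}

/-- The deficiency of a subadditive invariant family with respect to its additive majorant. -/
noncomputable def additiveDeficiency (d : Finset G → Y → ℝ) (A : Finset G) (y : Y) : ℝ :=
  if A = ∅ then 0 else ∑ g ∈ A, d {1} (g • y) - d A y

lemma additiveDeficiency_of_nonempty {A : Finset G} (hA : A.Nonempty) (y : Y) :
    additiveDeficiency d A y = ∑ g ∈ A, d {1} (g • y) - d A y :=
  if_neg hA.ne_empty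

variable [MeasurableSpace Y] {ν : Measure Y}

lemma integral_additiveDeficiency
    (hact : ∀ g : G, MeasurePreserving (fun y : Y => g • y) ν ν)
    (hint : ∀ F : Finset G, F.Nonempty → Integrable (d F) ν) {A : Finset G} (hA : A.Nonempty) :
    ∫ y, additiveDeficiency d A y ∂ν = A.card * ∫ y, d {1} y ∂ν - ∫ y, d A y ∂ν := by
  have h1 := hint {1} (Finset.singleton_nonempty 1)
  simp only [additiveDeficiency_of_nonempty hA]
  rw [integral_sub (integrable_finsetSum _ fun g _ => (isMPAction_smul hact).integrable_comp h1 g)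
    (hint A hA), (isMPAction_smul hact).integral_sum h1]

variable [Countable G]

lemma ae_subadditive_le_sum
    (hinv : ∀ F : Finset G, F.Nonempty → ∀ g : G, ∀ᵐ y ∂ν, d (F.image (· * g)) y = d F (g • y))
    (hsub : ∀ E F : Finset G, E.Nonempty → F.Nonempty → Disjoint E F →
      ∀ᵐ y ∂ν, d (E ∪ F) y ≤ d E y + d F y) :
    ∀ᵐ y ∂ν, ∀ A : Finset G, A.Nonempty → d A y ≤ ∑ g ∈ A, d {1} (g • y) := by
  have h1 : ∀ᵐ y ∂ν, ∀ g : G, d {g} y = d {1} (g • y) := ae_all_iff.2 fun g => by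
    simpa using hinv {1} (Finset.singleton_nonempty 1) g
  have h2 : ∀ᵐ y ∂ν, ∀ E F : Finset G, E.Nonempty → F.Nonempty → Disjoint E F →
      d (E ∪ F) y ≤ d E y + d F y := by
    simp only [ae_all_iff]
    exact hsub
  filter_upwards [h1, h2] with y h1 h2 A hA
  induction hA using Finset.Nonempty.cons_induction with
  | singleton a => simp [h1]
  | cons a A ha hA ih =>
    rw [Finset.cons_eq_insert, Finset.sum_insert ha, Finset.insert_eq]
    refine (h2 _ _ (Finset.singleton_nonempty a) hA (by simpa using ha)).trans ?_
    rw [h1]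
    linarith

lemma isSuperFamily_additiveDeficiency
    (hact : ∀ g : G, MeasurePreserving (fun y : Y => g • y) ν ν)
    (hint : ∀ F : Finset G, F.Nonempty → Integrable (d F) ν)
    (hinv : ∀ F : Finset G, F.Nonempty → ∀ g : G, ∀ᵐ y ∂ν, d (F.image (· * g)) y = d F (g • y))
    (hsub : ∀ E F : Finset G, E.Nonempty → F.Nonempty → Disjoint E F →
      ∀ᵐ y ∂ν, d (E ∪ F) y ≤ d E y + d F y) :
    IsSuperFamily ν (fun (g : G) (y : Y) => g • y) (additiveDeficiency d) where
  action := isMPAction_smul hact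
  integrable A := by
    rcases A.eq_empty_or_nonempty with rfl | hA
    · have he : additiveDeficiency d ∅ = fun _ => 0 := funext fun y => if_pos rfl
      rw [he]
      exact integrable_zero _ _ _
    · have he : additiveDeficiency d A = fun y => ∑ g ∈ A, d {1} (g • y) - d A y :=
        funext fun y => additiveDeficiency_of_nonempty hA y
      rw [he]
      exact (integrable_finsetSum _ fun g _ => (isMPAction_smul hact).integrable_comp
        (hint {1} (Finset.singleton_nonempty 1)) g).sub (hint A hA)
  nonneg := by
    filter_upwards [ae_subadditive_le_sum hinv hsub] with y hy A
    rcases A.eq_empty_or_nonempty with rfl | hA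
    · simp [additiveDeficiency]
    · rw [additiveDeficiency_of_nonempty hA]
      linarith [hy A hA]
  invariant := by
    have h1 : ∀ᵐ y ∂ν, ∀ F : Finset G, F.Nonempty → ∀ g : G,
        d (F.image (· * g)) y = d F (g • y) := by
      simp only [ae_all_iff]
      exact hinv
    filter_upwards [h1] with y hy A g
    rcases A.eq_empty_or_nonempty with rfl | hA
    · simp [additiveDeficiency]
    · rw [additiveDeficiency_of_nonempty hA, additiveDeficiency_of_nonempty (hA.image _),
        hy A hA g, Finset.sum_image (mul_left_injective g).injOn]
      simp only [mul_smul]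
  superadditive := by
    have h2 : ∀ᵐ y ∂ν, ∀ E F : Finset G, E.Nonempty → F.Nonempty → Disjoint E F →
        d (E ∪ F) y ≤ d E y + d F y := by
      simp only [ae_all_iff]
      exact hsub
    filter_upwards [h2] with y hy A B hAB
    rcases A.eq_empty_or_nonempty with rfl | hA
    · simp [additiveDeficiency]
    rcases B.eq_empty_or_nonempty with rfl | hB
    · simp [additiveDeficiency]
    rw [additiveDeficiency_of_nonempty hA, additiveDeficiency_of_nonempty hB,
      additiveDeficiency_of_nonempty (hA.mono Finset.subset_union_left), Finset.sum_union hAB]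
    linarith [hy A B hA hB hAB]

end Reduction

/-- Theorem 5.3(1) of the paper: let `𝐃` be a sub-additive `G`-invariant family in `L¹(ν)` with
`ν(𝐃) > -∞`, and let `{F_n}` be a Følner sequence of `G` consisting of self-similar tiling
subsets (with tiling subgroups `H n = G_{F_n}` and isomorphisms `π n : G ≃ G_{F_n}`)
satisfying (a) the Tempelman condition with constant `M > 0` and (b) the approximation
condition along an infinite set `𝒩 ⊆ ℕ`. Then there is `d ∈ L¹(ν)` with
`lim_n d_{F_n}(y)/|F_n| = d(y)` a.e. and `∫ d dν = ν(𝐃)`. -/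
theorem pointwise_subadditive_ergodic_theorem
    {G : Type*} [Group G] [Countable G] [Infinite G] [DecidableEq G]
    {Y : Type*} [MeasurableSpace Y] [MulAction G Y]
    (ν : Measure Y) [IsProbabilityMeasure ν]
    (hact : ∀ g : G, MeasurePreserving (fun y => g • y) ν ν)
    (d : Finset G → Y → ℝ)
    (hint : ∀ F : Finset G, F.Nonempty → Integrable (d F) ν)
    (hinv : ∀ F : Finset G, F.Nonempty → ∀ g : G,
      ∀ᵐ y ∂ν, d (F.image (· * g)) y = d F (g • y))
    (hsub : ∀ E F : Finset G, E.Nonempty → F.Nonempty → Disjoint E F →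
      ∀ᵐ y ∂ν, d (E ∪ F) y ≤ d E y + d F y)
    (hνD : ⊥ < ⨅ T ∈ {T : Finset G | Tiles T},
      (((T.card : ℝ)⁻¹ * ∫ y, d T y ∂ν : ℝ) : EReal))
    (F : ℕ → Finset G) (hF : IsFolner F)
    (H : ℕ → Subgroup G) (π : ∀ n, G ≃* H n)
    (htile : ∀ n, TilesWith (F n) ((H n : Set G)))
    (M : ℝ) (hM : 0 < M) (hTemp : TempelmanWith F M)
    (𝒩 : Set ℕ) (h𝒩 : 𝒩.Infinite)
    (happrox : ∀ m ∈ 𝒩, ∀ δ : ℝ, 0 < δ → ∀ᶠ p in atTop, ∃ n₁ n₂ : ℕ,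
      F p ⊆ F m * ((F n₁).image fun x => ((π m x : G))) ∧
      F m * ((F n₂).image fun x => ((π m x : G))) ⊆ F p ∧
      (((F n₁).card : ℝ) - ((F n₂).card : ℝ)) / ((F p).card : ℝ) < δ) :
    ∃ dlim : Y → ℝ, Integrable dlim ν ∧
      (∀ᵐ y ∂ν, Tendsto (fun n => d (F n) y / ((F n).card : ℝ)) atTop (𝓝 (dlim y))) ∧
      ((∫ y, dlim y ∂ν : ℝ) : EReal)
        = ⨅ T ∈ {T : Finset G | Tiles T},
            (((T.card : ℝ)⁻¹ * ∫ y, d T y ∂ν : ℝ) : EReal) := by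
  set i := ⨅ T ∈ {T : Finset G | Tiles T},
    (((T.card : ℝ)⁻¹ * ∫ y, d T y ∂ν : ℝ) : EReal) with hi
  have hle : ∀ B : Finset G, Tiles B → i ≤ (((B.card : ℝ)⁻¹ * ∫ y, d B y ∂ν : ℝ) : EReal) :=
    fun B hB => iInf₂_le B hB
  have htop : i < ⊤ := (hle (F 0) ⟨hF.1 0, _, htile 0⟩).trans_lt (EReal.coe_lt_top _)
  obtain ⟨r, hr⟩ : ∃ r : ℝ, i = r := ⟨i.toReal, (EReal.coe_toReal htop.ne hνD.ne').symm⟩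
  have hT := isMPAction_smul hact
  have h1 := hint {1} (Finset.singleton_nonempty 1)
  have hS := isSuperFamily_additiveDeficiency hact hint hinv hsub
  let φ : ℕ → G →* G := fun n => (H n).subtype.comp (π n).toMonoidHom
  have hφ : ∀ n, Function.Injective (φ n) := fun n =>
    Subtype.val_injective.comp (π n).injective
  have hrange : ∀ n, Set.range (φ n) = (H n : Set G) := by
    intro n
    ext x
    exact ⟨fun ⟨y, hy⟩ => hy ▸ (π n y).2, fun hx => ⟨(π n).symm ⟨x, hx⟩, by simp [φ]⟩⟩
  obtain ⟨s, hsi, hs, hse⟩ := hS.exists_limit (γ := ∫ y, d {1} y ∂ν - r) hF hM hTemp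
    (fun B hB => by
      have hB0 : (0 : ℝ) < B.card := by exact_mod_cast hB.1.card_pos
      have := hle B hB
      rw [hr, EReal.coe_le_coe_iff, inv_mul_eq_div, le_div_iff₀ hB0] at this
      rw [integral_additiveDeficiency hact hint hB.1]
      linarith)
    (fun ε hε => by
      have hlt : i < ((r + ε : ℝ) : EReal) := by
        rw [hr]
        exact EReal.coe_lt_coe_iff.2 (lt_add_of_pos_right r hε)
      simp only [hi, iInf_lt_iff] at hlt
      obtain ⟨B, hB, hlt⟩ := hlt
      have hBt : Tiles B := hB
      have hB0 : (0 : ℝ) < B.card := by exact_mod_cast hBt.1.card_pos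
      refine ⟨B, hBt, ?_⟩
      rw [EReal.coe_lt_coe_iff, inv_mul_eq_div, div_lt_iff₀ hB0] at hlt
      rw [integral_additiveDeficiency hact hint hBt.1, lt_div_iff₀ hB0]
      linarith)
    φ hφ (fun n => by rw [hrange]; exact htile n) h𝒩 happrox
  obtain ⟨e, hei, he, hee⟩ := ErgodicConverges.of_integrable hT hF hM hTemp h1
  refine ⟨fun y => e y - s y, hei.sub hsi, ?_, ?_⟩
  · filter_upwards [hs, he] with y hy1 hy2
    refine (hy2.sub hy1).congr fun n => ?_
    rw [additiveDeficiency_of_nonempty (hF.1 n), orbitAverage, ← sub_div, sub_sub_cancel]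
  · rw [integral_sub hei hsi, hee, hse, hr, sub_sub_cancel]
end

section
/- Let (Y, 𝒟, ν, G) be an MDS, let 𝐃 = {d_F : F ∈ 𝓕_G} ⊆ L¹(Y, 𝒟, ν) be a sub-additive G-invariant family with ν(𝐃) > −∞, and let {F_n : n ∈ ℕ} be a Følner sequence of G each of whose terms tiles G self-similarly (with tiling subgroups G_{F_n} and isomorphisms π_{F_n} : G → G_{F_n}), satisfying: (a) the Tempelman condition with some constant M > 0; (b) there is an infinite 𝒩 ⊆ ℕ such that for each m ∈ 𝒩 and each δ > 0, for all sufficiently large p there exist n_1, n_2 with F_m π_{F_m}(F_{n_1}) ⊇ F_p ⊇ F_m π_{F_m}(F_{n_2}) and (|F_{n_1}| − |F_{n_2}|)/|F_p| < δ. If the ν-a.e. limit function d(y) = lim_{n→∞} d_{F_n}(y)/|F_n| is G-invariant, then for ν-a.e. y ∈ Y, d(y) = inf_{T ∈ 𝒯_G} (1/|T|) E(d_T | 𝓘)(y). -/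
open MeasureTheory Filter Topology
open scoped symmDiff Pointwise ENNReal
/-- The σ-algebra `𝓘` of `G`-invariant sets. -/
def invSigma (G : Type*) {Y : Type*} [Group G] [MulAction G Y] [MeasurableSpace Y]
    (ν : Measure Y) : MeasurableSpace Y :=
  MeasurableSpace.generateFrom {D : Set Y | MeasurableSet D ∧ ∀ g : G, ν ((g • D) ∆ D) = 0}


section UniformIntegrability

variable {G Y : Type*} [Group G] [MeasurableSpace Y] [MulAction G Y] [MeasurableConstSMul G Y]
  {ν : Measure Y} [SMulInvariantMeasure G Y ν]

lemma MeasureTheory.Integrable.comp_smul_of_invariant {f : Y → ℝ} (hf : Integrable f ν) (c : G) :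
    Integrable (fun y => f (c • y)) ν :=
  (measurePreserving_smul c ν).integrable_comp_of_integrable hf

/-- Weighted sums of translates of an integrable function, with total weight at most one, have
small integrals over all sets on which all translates have small integrals. -/
lemma eLpNorm_indicator_weighted_sum_smul_le {f : Y → ℝ} (hf : Integrable f ν)
    (S : Finset G) {a : ℝ} (ha : 0 ≤ a) (haS : a * S.card ≤ 1) {s : Set Y}
    (hs : MeasurableSet s) {C : ℝ≥0∞}
    (hC : ∀ c : G, eLpNorm (s.indicator fun y => f (c • y)) 1 ν ≤ C) :
    eLpNorm (s.indicator fun y => a * ∑ c ∈ S, f (c • y)) 1 ν ≤ C := by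
  have h : (s.indicator fun y => a * ∑ c ∈ S, f (c • y))
      = a • ∑ c ∈ S, s.indicator (fun y => f (c • y)) := by
    ext y
    by_cases hy : y ∈ s <;> simp [hy]
  rw [h, eLpNorm_const_smul]
  calc ‖a‖ₑ * eLpNorm (∑ c ∈ S, s.indicator fun y => f (c • y)) 1 ν
      ≤ ‖a‖ₑ * ∑ c ∈ S, eLpNorm (s.indicator fun y => f (c • y)) 1 ν := by
        gcongr
        exact eLpNorm_sum_le
          (fun c _ => (hf.comp_smul_of_invariant c).aestronglyMeasurable.indicator hs) le_rfl
    _ ≤ ‖a‖ₑ * ∑ _c ∈ S, C := by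
        gcongr with c _
        exact hC c
    _ = ENNReal.ofReal (a * S.card) * C := by
        rw [Finset.sum_const, nsmul_eq_mul, ← mul_assoc, ENNReal.ofReal_mul ha,
          Real.enorm_eq_ofReal ha, ENNReal.ofReal_natCast]
    _ ≤ 1 * C := by
        gcongr
        exact ENNReal.ofReal_le_one.2 haS
    _ = C := one_mul C

/-- Weighted sums of translates of an integrable function, with total weight at most one, are
uniformly integrable. -/
lemma uniformIntegrable_weighted_sum_smul {ι : Type*} {f : Y → ℝ} (hf : Integrable f ν)
    (S : ι → Finset G) {a : ι → ℝ} (ha : ∀ i, 0 ≤ a i) (haS : ∀ i, a i * (S i).card ≤ 1) :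
    UniformIntegrable (fun i y => a i * ∑ c ∈ S i, f (c • y)) 1 ν := by
  refine ⟨fun i => ?_, fun ε hε => ?_, (eLpNorm f 1 ν).toNNReal, fun i => ?_⟩
  · exact ((integrable_finsetSum _
      fun c _ => hf.comp_smul_of_invariant c).const_mul _).aestronglyMeasurable
  · obtain ⟨δ, hδ, h⟩ := (memLp_one_iff_integrable.2 hf).eLpNorm_indicator_le le_rfl
      ENNReal.one_ne_top hε
    refine ⟨δ, hδ, fun i s hs hsδ =>
      eLpNorm_indicator_weighted_sum_smul_le hf (S i) (ha i) (haS i) hs fun c => ?_⟩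
    have hc : (s.indicator fun y => f (c • y)) = (c • s).indicator f ∘ (c • ·) := by
      ext y
      by_cases hy : y ∈ s <;> simp [hy]
    rw [hc, eLpNorm_comp_measurePreserving
      (hf.aestronglyMeasurable.indicator (hs.const_smul c)) (measurePreserving_smul c ν)]
    exact h _ (hs.const_smul c) (by rwa [measure_smul])
  · rw [ENNReal.coe_toNNReal (memLp_one_iff_integrable.2 hf).eLpNorm_ne_top]
    have := eLpNorm_indicator_weighted_sum_smul_le hf (S i) (ha i) (haS i) MeasurableSet.univ
      (C := eLpNorm f 1 ν) fun c => ?_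
    · simpa using this
    · rw [Set.indicator_univ]
      exact (eLpNorm_comp_measurePreserving hf.aestronglyMeasurable
        (measurePreserving_smul c ν)).le

/-- Vitali's theorem for positive parts: if `u n` is bounded above by a null sequence and by a
uniformly integrable sequence, then the integrals of the positive parts tend to zero. -/
lemma tendsto_integral_posPart_of_unifIntegrable [IsFiniteMeasure ν] {u B v : ℕ → Y → ℝ}
    (hu : ∀ n, Integrable (u n) ν) (hB : UnifIntegrable B 1 ν) (huB : ∀ n, u n ≤ᵐ[ν] B n)
    (huv : ∀ n, u n ≤ᵐ[ν] v n) (hv : ∀ᵐ y ∂ν, Tendsto (fun n => v n y) atTop (𝓝 0)) :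
    Tendsto (fun n => ∫ y, max (u n y) 0 ∂ν) atTop (𝓝 0) := by
  have hpi : ∀ n, Integrable (fun y => max (u n y) 0) ν := fun n => (hu n).pos_part
  have hpui : UnifIntegrable (fun n y => max (u n y) 0) 1 ν := fun ε hε => by
    obtain ⟨δ, hδ, h⟩ := hB hε
    refine ⟨δ, hδ, fun n s hs hsδ => (eLpNorm_mono_ae ?_).trans (h n s hs hsδ)⟩
    filter_upwards [huB n] with y hyB
    by_cases hy : y ∈ s
    · simp only [hy, Set.indicator_of_mem, Real.norm_eq_abs]
      rw [abs_of_nonneg (le_max_right _ _)]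
      exact max_le (hyB.trans (le_abs_self _)) (abs_nonneg _)
    · simp [hy]
  have hae : ∀ᵐ y ∂ν, Tendsto (fun n => max (u n y) 0) atTop (𝓝 0) := by
    filter_upwards [ae_all_iff.2 huv, hv] with y hy hvy
    refine squeeze_zero (fun n => le_max_right _ _) (fun n => max_le_max_right 0 (hy n)) ?_
    simpa using hvy.max (tendsto_const_nhds (x := (0 : ℝ)))
  have := tendsto_Lp_finite_of_tendsto_ae le_rfl ENNReal.one_ne_top
    (fun n => (hpi n).aestronglyMeasurable) (MemLp.zero' (p := 1) (μ := ν) (ε := ℝ)) hpui hae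
  have h2 := tendsto_integral_of_L1' (fun _ : Y => (0 : ℝ)) aestronglyMeasurable_const
    (Eventually.of_forall hpi) this
  simpa using h2

end UniformIntegrability

section Tiling

variable {G : Type*} [DecidableEq G]

lemma ae_biUnion_le_sum_of_subadditive {Y : Type*} [MeasurableSpace Y] {ν : Measure Y}
    {d : Finset G → Y → ℝ}
    (hsub : ∀ E F : Finset G, E.Nonempty → F.Nonempty → Disjoint E F →
      ∀ᵐ y ∂ν, d (E ∪ F) y ≤ d E y + d F y)
    {ι : Type*} {s : Finset ι} (hs : s.Nonempty) {P : ι → Finset G}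
    (hP : ∀ i ∈ s, (P i).Nonempty) (hdisj : (s : Set ι).PairwiseDisjoint P) :
    ∀ᵐ y ∂ν, d (s.biUnion P) y ≤ ∑ i ∈ s, d (P i) y := by
  classical
  induction hs using Finset.Nonempty.cons_induction with
  | singleton a => simp
  | cons a s ha hs ih =>
    rw [Finset.coe_cons, Set.pairwiseDisjoint_insert_of_notMem (by simpa using ha)] at hdisj
    have hne : (s.biUnion P).Nonempty := by
      obtain ⟨i, hi⟩ := hs
      obtain ⟨x, hx⟩ := hP i (Finset.mem_cons_of_mem hi)
      exact ⟨x, Finset.mem_biUnion.2 ⟨i, hi, hx⟩⟩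
    filter_upwards [ih (fun i hi => hP i (Finset.mem_cons_of_mem hi)) hdisj.1,
      hsub (P a) (s.biUnion P) (hP a (Finset.mem_cons_self a s)) hne
        ((Finset.disjoint_biUnion_right _ _ _).2 hdisj.2)] with y h₁ h₂
    rw [Finset.sum_cons, Finset.cons_eq_insert, Finset.biUnion_insert]
    linarith

variable [Group G]

/-- The cells of a partition of a finite set into translates `T * c` (left summand) and
singletons (right summand). -/
def packingCell (T : Finset G) : G ⊕ G → Finset G :=
  Sum.elim (fun c => T.image (· * c)) fun x => {x}

lemma packingCell_nonempty {T : Finset G} (hT : T.Nonempty) (i : G ⊕ G) :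
    (packingCell T i).Nonempty := by
  cases i
  · exact hT.image _
  · exact Finset.singleton_nonempty _

/-- A finite set splits into whole tiles and a remainder controlled by its boundary. -/
lemma TilesWith.exists_packing {T : Finset G} {C : Set G} (h : TilesWith T C) (hT : T.Nonempty)
    (F : Finset G) :
    ∃ K R : Finset G, F = (K.disjSum R).biUnion (packingCell T) ∧
      ((K.disjSum R : Finset (G ⊕ G)) : Set (G ⊕ G)).PairwiseDisjoint (packingCell T) ∧
      R.card ≤ ∑ g ∈ T * T⁻¹, (F.image (g * ·) ∆ F).card := by
  classical
  obtain ⟨t₀, ht₀⟩ := hT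
  let K : Finset G := {c ∈ F.image (t₀⁻¹ * ·) | c ∈ C ∧ T.image (· * c) ⊆ F}
  have hK : ∀ c, c ∈ K ↔ c ∈ C ∧ ∀ t ∈ T, t * c ∈ F := fun c => by
    simp only [K, Finset.mem_filter, Finset.mem_image, Finset.image_subset_iff]
    exact ⟨fun h => h.2, fun h => ⟨⟨t₀ * c, h.2 t₀ ht₀, by group⟩, h⟩⟩
  let R : Finset G := {x ∈ F | ∀ c ∈ K, ∀ t ∈ T, x ≠ t * c}
  have hR : ∀ x, x ∈ R ↔ x ∈ F ∧ ∀ c ∈ K, ∀ t ∈ T, x ≠ t * c := fun x => by simp [R]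
  have huniq : ∀ c ∈ K, ∀ c' ∈ K, ∀ t ∈ T, ∀ t' ∈ T, t * c = t' * c' → c = c' := by
    intro c hc c' hc' t ht t' ht' hcc
    exact (h (t * c)).unique ⟨((hK c).1 hc).1, t, ht, rfl⟩ ⟨((hK c').1 hc').1, t', ht', hcc⟩
  refine ⟨K, R, ?_, ?_, ?_⟩
  · ext x
    simp only [Finset.mem_biUnion, Finset.mem_disjSum, packingCell]
    constructor
    · intro hx
      by_cases hxR : x ∈ R
      · exact ⟨.inr x, by simp [hxR]⟩
      · have : ∃ c ∈ K, ∃ t ∈ T, x = t * c := by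
          by_contra! hcon
          exact hxR ((hR x).2 ⟨hx, hcon⟩)
        obtain ⟨c, hc, t, ht, rfl⟩ := this
        exact ⟨.inl c, by simp [hc], by simp [ht]⟩
    · rintro ⟨i, ⟨c, hc, rfl⟩ | ⟨c, hc, rfl⟩, hx⟩
      · obtain ⟨t, ht, rfl⟩ := Finset.mem_image.1 hx
        exact ((hK c).1 hc).2 t ht
      · rw [Sum.elim_inr, Finset.mem_singleton] at hx
        exact hx ▸ ((hR c).1 hc).1
  · rintro (c | c) hc (c' | c') hc' hne <;>
      simp only [Finset.mem_coe, Finset.inl_mem_disjSum, Finset.inr_mem_disjSum] at hc hc' <;>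
      simp only [Function.onFun, packingCell, Sum.elim_inl, Sum.elim_inr, Finset.disjoint_left,
        Finset.mem_image, Finset.mem_singleton]
    · rintro x ⟨t, ht, rfl⟩ ⟨t', ht', hx⟩
      exact hne (congrArg _ (huniq c hc c' hc' t ht t' ht' hx.symm))
    · rintro x ⟨t, ht, rfl⟩ rfl
      exact ((hR _).1 hc').2 c hc t ht rfl
    · rintro x rfl ⟨t, ht, hx⟩
      exact ((hR _).1 hc).2 c' hc' t ht hx.symm
    · rintro x rfl rfl
      exact hne rfl
  · have hsub : R ⊆ (T * T⁻¹).biUnion fun g => (F.image (g * ·) ∆ F).image (g⁻¹ * ·) := by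
      intro x hx
      obtain ⟨hxF, hxK⟩ := (hR x).1 hx
      obtain ⟨c, ⟨hcC, t, ht, rfl⟩, -⟩ := h x
      have hcK : c ∉ K := fun hcK => hxK c hcK t ht rfl
      rw [hK] at hcK
      push Not at hcK
      obtain ⟨t', ht', hF'⟩ := hcK hcC
      refine Finset.mem_biUnion.2 ⟨t' * t⁻¹, Finset.mul_mem_mul ht' (Finset.inv_mem_inv ht),
        Finset.mem_image.2 ⟨t' * c, Finset.mem_symmDiff.2 (.inl ⟨Finset.mem_image.2
          ⟨t * c, hxF, by group⟩, hF'⟩), by group⟩⟩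
    exact (Finset.card_le_card hsub).trans (Finset.card_biUnion_le.trans
      (Finset.sum_le_sum fun g _ => Finset.card_image_le))

lemma card_eq_of_packing {T F K R : Finset G}
    (hF : F = (K.disjSum R).biUnion (packingCell T))
    (hdisj : ((K.disjSum R : Finset (G ⊕ G)) : Set (G ⊕ G)).PairwiseDisjoint (packingCell T)) :
    F.card = K.card * T.card + R.card := by
  rw [hF, Finset.card_biUnion hdisj, Finset.sum_disjSum]
  simp only [packingCell, Sum.elim_inl, Sum.elim_inr, Finset.card_singleton,
    Finset.card_image_of_injective _ (mul_left_injective _), Finset.sum_const, smul_eq_mul, mul_one]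

end Tiling

section Invariant

variable {G Y : Type*} [Group G] [MeasurableSpace Y] [MulAction G Y] {ν : Measure Y}

lemma measurableSet_and_smul_ae_eq_of_invSigma [Countable G] {D : Set Y}
    (hD : MeasurableSet[invSigma G ν] D) : MeasurableSet D ∧ ∀ g : G, (g • D : Set Y) =ᵐ[ν] D := by
  induction D, hD using MeasurableSpace.generateFrom_induction with
  | hC t ht _ => exact ⟨ht.1, fun g => measure_symmDiff_eq_zero_iff.1 (ht.2 g)⟩
  | empty => simp
  | compl t _ ih =>
    refine ⟨ih.1.compl, fun g => ?_⟩
    rw [Set.smul_set_compl]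
    exact (ih.2 g).compl
  | iUnion s _ ih =>
    refine ⟨.iUnion fun n => (ih n).1, fun g => ?_⟩
    rw [Set.smul_set_iUnion]
    exact Filter.EventuallyEq.countable_iUnion fun n => (ih n).2 g

lemma invSigma_le : invSigma G ν ≤ ‹MeasurableSpace Y› :=
  MeasurableSpace.generateFrom_le fun _ h => h.1

lemma measurable_invSigma_of_ae_invariant {f : Y → ℝ} (hf : Measurable f)
    (hinv : ∀ g : G, ∀ᵐ y ∂ν, f (g • y) = f y) : Measurable[invSigma G ν] f := by
  intro s hs
  refine MeasurableSpace.measurableSet_generateFrom ⟨hf hs, fun g => ?_⟩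
  rw [measure_symmDiff_eq_zero_iff]
  filter_upwards [hinv g⁻¹] with y hy
  refine propext ?_
  change y ∈ g • (f ⁻¹' s) ↔ y ∈ f ⁻¹' s
  rw [Set.mem_smul_set_iff_inv_smul_mem, Set.mem_preimage, Set.mem_preimage, hy]

variable [MeasurableConstSMul G Y] [SMulInvariantMeasure G Y ν]

lemma setIntegral_comp_smul_of_invariant {D : Set Y} (hD : ∀ g : G, (g • D : Set Y) =ᵐ[ν] D)
    (f : Y → ℝ) (g : G) : ∫ y in D, f (g • y) ∂ν = ∫ y in D, f y ∂ν := by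
  have h := (measurePreserving_smul g ν).setIntegral_preimage_emb
    (measurableEmbedding_const_smul g) f D
  rw [← h]
  refine (setIntegral_congr_set ?_).symm
  rw [Set.preimage_smul]
  exact hD g⁻¹

/-- Along a Følner sequence, the normalised terms of a sub-additive invariant family are dominated
by a uniformly integrable sequence whose integrals over invariant sets converge to those of the
normalised function of a given tile. -/
lemma exists_uniformIntegrable_dominating [DecidableEq G] {d : Finset G → Y → ℝ}
    (hint : ∀ F : Finset G, F.Nonempty → Integrable (d F) ν)
    (hinv : ∀ F : Finset G, F.Nonempty → ∀ g : G,
      ∀ᵐ y ∂ν, d (F.image (· * g)) y = d F (g • y))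
    (hsub : ∀ E F : Finset G, E.Nonempty → F.Nonempty → Disjoint E F →
      ∀ᵐ y ∂ν, d (E ∪ F) y ≤ d E y + d F y)
    {F : ℕ → Finset G} (hF : IsFolner F) {T : Finset G} (hT : Tiles T) :
    ∃ A : ℕ → Y → ℝ, UniformIntegrable A 1 ν ∧
      (∀ n, ∀ᵐ y ∂ν, d (F n) y / (F n).card ≤ A n y) ∧
      ∀ D : Set Y, MeasurableSet D → (∀ g : G, (g • D : Set Y) =ᵐ[ν] D) →
        Tendsto (fun n => ∫ y in D, A n y ∂ν) atTop
          (𝓝 ((T.card : ℝ)⁻¹ * ∫ y in D, d T y ∂ν)) := by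
  obtain ⟨hTne, C, hC⟩ := hT
  choose K R hKR hdisj hR using fun n => hC.exists_packing hTne (F n)
  have hcard := fun n => card_eq_of_packing (hKR n) (hdisj n)
  have hTpos : (0 : ℝ) < T.card := by exact_mod_cast hTne.card_pos
  have hFpos : ∀ n, (0 : ℝ) < (F n).card := fun n => by exact_mod_cast (hF.1 n).card_pos
  have hcard' : ∀ n, ((F n).card : ℝ) = (K n).card * T.card + (R n).card := fun n => by
    exact_mod_cast hcard n
  have hw : ∀ n, (0 : ℝ) ≤ ((F n).card : ℝ)⁻¹ := fun n => inv_nonneg.2 (hFpos n).le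
  have hwK : ∀ n, ((F n).card : ℝ)⁻¹ * (K n).card ≤ 1 := fun n => by
    rw [inv_mul_le_one₀ (hFpos n)]
    exact_mod_cast (hcard n).symm ▸ le_add_right (Nat.le_mul_of_pos_right _ hTne.card_pos)
  have hwR : ∀ n, ((F n).card : ℝ)⁻¹ * (R n).card ≤ 1 := fun n => by
    rw [inv_mul_le_one₀ (hFpos n)]
    exact_mod_cast (hcard n).symm ▸ Nat.le_add_left _ _
  have hone := Finset.singleton_nonempty (1 : G)
  have hUT := uniformIntegrable_weighted_sum_smul (hint T hTne) K hw hwK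
  have hUR := uniformIntegrable_weighted_sum_smul (hint {1} hone) R hw hwR
  have hIT := fun n => memLp_one_iff_integrable.1 (hUT.memLp n)
  have hIR := fun n => memLp_one_iff_integrable.1 (hUR.memLp n)
  have hRlim : Tendsto (fun n => ((F n).card : ℝ)⁻¹ * (R n).card) atTop (𝓝 0) := by
    refine squeeze_zero (fun n => mul_nonneg (hw n) (Nat.cast_nonneg _)) (fun n => ?_)
      (g := fun n => ∑ g ∈ T * T⁻¹, (((F n).image (g * ·) ∆ F n).card : ℝ) / (F n).card) ?_
    · rw [← Finset.sum_div, div_eq_inv_mul]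
      have := hR n
      gcongr
      exact_mod_cast this
    · simpa using tendsto_finsetSum (T * T⁻¹) fun g _ => hF.2 g
  have hKlim : Tendsto (fun n => ((F n).card : ℝ)⁻¹ * (K n).card) atTop (𝓝 (T.card : ℝ)⁻¹) := by
    have h : ∀ n, ((F n).card : ℝ)⁻¹ * (K n).card
        = (T.card : ℝ)⁻¹ * (1 - ((F n).card : ℝ)⁻¹ * (R n).card) := fun n => by
      have := (hFpos n).ne'
      field_simp
      linarith [hcard' n]
    simp_rw [h]
    simpa using (hRlim.const_sub 1).const_mul (T.card : ℝ)⁻¹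
  obtain ⟨C₁, hC₁⟩ := hUT.2.2
  obtain ⟨C₂, hC₂⟩ := hUR.2.2
  refine ⟨_, ⟨fun n => ((hIT n).add (hIR n)).aestronglyMeasurable,
    hUT.unifIntegrable.add hUR.unifIntegrable le_rfl hUT.aestronglyMeasurable
      hUR.aestronglyMeasurable, C₁ + C₂, fun n => ?_⟩, fun n => ?_, fun D hD hDinv => ?_⟩
  · exact (eLpNorm_add_le (hUT.aestronglyMeasurable n) (hUR.aestronglyMeasurable n)
      le_rfl).trans (add_le_add (hC₁ n) (hC₂ n))
  · have hsum := ae_biUnion_le_sum_of_subadditive hsub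
      (s := (K n).disjSum (R n)) (by
        by_contra hs
        rw [Finset.not_nonempty_iff_eq_empty] at hs
        have := hKR n
        rw [hs, Finset.biUnion_empty] at this
        exact (hF.1 n).ne_empty this)
      (fun i _ => packingCell_nonempty hTne i) (hdisj n)
    rw [← hKR n] at hsum
    have h₁ := (Finset.eventually_all (K n)).2 fun c _ => hinv T hTne c
    have h₂ := (Finset.eventually_all (R n)).2 fun x _ => hinv {1} hone x
    filter_upwards [hsum, h₁, h₂] with y hy hy₁ hy₂
    rw [Finset.sum_disjSum] at hy
    simp only [Finset.image_singleton, one_mul] at hy₂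
    simp only [packingCell, Sum.elim_inl, Sum.elim_inr] at hy
    rw [Finset.sum_congr rfl hy₁, Finset.sum_congr rfl hy₂] at hy
    rw [div_eq_inv_mul]
    simp only [Pi.add_apply, ← mul_add]
    exact mul_le_mul_of_nonneg_left hy (hw n)
  · have h : ∀ n, ∫ y in D, (((F n).card : ℝ)⁻¹ * ∑ c ∈ K n, d T (c • y)
        + ((F n).card : ℝ)⁻¹ * ∑ x ∈ R n, d {1} (x • y)) ∂ν
        = ((F n).card : ℝ)⁻¹ * (K n).card * ∫ y in D, d T y ∂ν
        + ((F n).card : ℝ)⁻¹ * (R n).card * ∫ y in D, d {1} y ∂ν := fun n => by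
      rw [integral_add (hIT n).integrableOn (hIR n).integrableOn, integral_const_mul,
        integral_const_mul, integral_finsetSum _ fun c _ =>
          ((hint T hTne).comp_smul_of_invariant c).integrableOn, integral_finsetSum _ fun c _ =>
          ((hint {1} hone).comp_smul_of_invariant c).integrableOn]
      simp_rw [setIntegral_comp_smul_of_invariant hDinv]
      simp [mul_assoc]
    simp only [Pi.add_apply, h]
    simpa using (hKlim.mul_const (∫ y in D, d T y ∂ν)).add (hRlim.mul_const (∫ y in D, d {1} y ∂ν))

end Invariant

section Limit

variable {Y : Type*} [MeasurableSpace Y] {ν : Measure Y}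

lemma integral_norm_le_of_eLpNorm_one_le {f : Y → ℝ} (hf : Integrable f ν) {C : NNReal}
    (hC : eLpNorm f 1 ν ≤ C) : ∫ y, |f y| ∂ν ≤ C := by
  rw [eLpNorm_one_eq_lintegral_enorm, ← ofReal_integral_norm_eq_lintegral_enorm hf,
    ← ENNReal.ofReal_coe_nnreal, ENNReal.ofReal_le_ofReal_iff C.coe_nonneg] at hC
  exact hC

/-- An almost everywhere limit is integrable if the sequence is dominated from above by a uniformly
integrable one and has integrals bounded below. -/
lemma integrable_of_tendsto_of_le_uniformIntegrable {g A : ℕ → Y → ℝ}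
    (hg : ∀ n, Integrable (g n) ν) (hA : UniformIntegrable A 1 ν)
    (hgA : ∀ n, g n ≤ᵐ[ν] A n) {c : ℝ} (hc : ∀ n, c ≤ ∫ y, g n y ∂ν) {l : Y → ℝ}
    (hl : ∀ᵐ y ∂ν, Tendsto (fun n => g n y) atTop (𝓝 (l y))) : Integrable l ν := by
  obtain ⟨C, hC⟩ := hA.2.2
  have hAi := fun n => memLp_one_iff_integrable.1 (hA.memLp n)
  refine memLp_one_iff_integrable.1 ⟨aestronglyMeasurable_of_tendsto_ae _
    (fun n => (hg n).aestronglyMeasurable) hl, ?_⟩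
  refine (Lp.eLpNorm_lim_le_liminf_eLpNorm (fun n => (hg n).aestronglyMeasurable) l hl).trans_lt
    (lt_of_le_of_lt (b := ENNReal.ofReal (2 * C - c)) ?_ ENNReal.ofReal_lt_top)
  refine liminf_le_of_frequently_le' (Frequently.of_forall fun n => ?_)
  rw [eLpNorm_one_eq_lintegral_enorm, ← ofReal_integral_norm_eq_lintegral_enorm (hg n)]
  refine ENNReal.ofReal_le_ofReal ?_
  calc ∫ y, ‖g n y‖ ∂ν ≤ ∫ y, (2 * |A n y| - g n y) ∂ν := by
        refine integral_mono_ae (hg n).norm (((hAi n).abs.const_mul 2).sub (hg n)) ?_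
        filter_upwards [hgA n] with y hy
        rw [Real.norm_eq_abs, abs_le']
        constructor <;> linarith [le_abs_self (A n y), abs_nonneg (A n y)]
    _ = 2 * ∫ y, |A n y| ∂ν - ∫ y, g n y ∂ν := by
        rw [integral_sub ((hAi n).abs.const_mul 2) (hg n), integral_const_mul]
    _ ≤ 2 * C - c := by
        linarith [integral_norm_le_of_eLpNorm_one_le (hAi n) (hC n), hc n]

lemma setIntegral_le_of_tendsto_of_le_uniformIntegrable [IsFiniteMeasure ν] {g A : ℕ → Y → ℝ}
    (hA : UniformIntegrable A 1 ν) (hgA : ∀ n, g n ≤ᵐ[ν] A n) {l : Y → ℝ} (hli : Integrable l ν)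
    (hl : ∀ᵐ y ∂ν, Tendsto (fun n => g n y) atTop (𝓝 (l y))) {D : Set Y} {a : ℝ}
    (ha : Tendsto (fun n => ∫ y in D, A n y ∂ν) atTop (𝓝 a)) : ∫ y in D, l y ∂ν ≤ a := by
  have hAi := fun n => memLp_one_iff_integrable.1 (hA.memLp n)
  have hd : ∀ n, Integrable (fun y => l y - A n y) ν := fun n => hli.sub (hAi n)
  have h := tendsto_integral_posPart_of_unifIntegrable (u := fun n y => l y - A n y)
    (v := fun n y => l y - g n y) hd
    ((unifIntegrable_const le_rfl ENNReal.one_ne_top (memLp_one_iff_integrable.2 hli)).sub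
      hA.unifIntegrable le_rfl (fun _ => hli.aestronglyMeasurable) hA.aestronglyMeasurable)
    (fun n => .rfl) (fun n => (hgA n).mono fun y hy => sub_le_sub_left hy _)
    (hl.mono fun y hy => by simpa using hy.const_sub (l y))
  refine ge_of_tendsto' (by simpa using h.add ha) fun n => ?_
  have h₁ : ∫ y in D, (l y - A n y) ∂ν ≤ ∫ y in D, max (l y - A n y) 0 ∂ν :=
    integral_mono (hd n).integrableOn (hd n).pos_part.integrableOn fun y => le_max_left _ 0
  have h₂ := setIntegral_le_integral (s := D) (hd n).pos_part
    (.of_forall fun y => le_max_right (l y - A n y) 0)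
  rw [integral_sub hli.integrableOn (hAi n).integrableOn] at h₁
  linarith

/-- The reverse Fatou inequality under uniform integrability from above. -/
lemma eventually_integral_lt_of_le_uniformIntegrable [IsFiniteMeasure ν] {g A : ℕ → Y → ℝ}
    (hg : ∀ n, Integrable (g n) ν) (hA : UniformIntegrable A 1 ν) (hgA : ∀ n, g n ≤ᵐ[ν] A n)
    {l : Y → ℝ} (hli : Integrable l ν)
    (hl : ∀ᵐ y ∂ν, Tendsto (fun n => g n y) atTop (𝓝 (l y))) {ε : ℝ} (hε : 0 < ε) :
    ∀ᶠ n in atTop, ∫ y, g n y ∂ν < ∫ y, l y ∂ν + ε := by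
  have hd : ∀ n, Integrable (fun y => g n y - l y) ν := fun n => (hg n).sub hli
  have h := tendsto_integral_posPart_of_unifIntegrable (u := fun n y => g n y - l y)
    (v := fun n y => g n y - l y) hd
    (hA.unifIntegrable.sub (unifIntegrable_const le_rfl ENNReal.one_ne_top
      (memLp_one_iff_integrable.2 hli)) le_rfl hA.aestronglyMeasurable
      (fun _ => hli.aestronglyMeasurable))
    (fun n => (hgA n).mono fun y hy => sub_le_sub_right hy _) (fun n => .rfl)
    (hl.mono fun y hy => by simpa using hy.sub_const (l y))
  filter_upwards [h.eventually_lt_const hε] with n hn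
  have := integral_mono (hd n) (hd n).pos_part fun y => le_max_left (g n y - l y) 0
  rw [integral_sub (hg n) hli] at this
  linarith

/-- Functions lying above `l` whose integrals come arbitrarily close to that of `l` come
arbitrarily close to `l` almost everywhere. -/
lemma ae_exists_lt_add_of_forall_exists_integral_lt {w : ℕ → Y → ℝ} {l : Y → ℝ}
    (hw : ∀ n, Integrable (w n) ν) (hli : Integrable l ν) (hlw : ∀ n, l ≤ᵐ[ν] w n)
    (h : ∀ ε : ℝ, 0 < ε → ∃ n, ∫ y, w n y ∂ν < ∫ y, l y ∂ν + ε) :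
    ∀ᵐ y ∂ν, ∀ ε : ℝ, 0 < ε → ∃ n, w n y < l y + ε := by
  have hd : ∀ n, Integrable (fun y => w n y - l y) ν := fun n => (hw n).sub hli
  have h0 : ∫⁻ y, ⨅ n, ENNReal.ofReal (w n y - l y) ∂ν = 0 := by
    refine nonpos_iff_eq_zero.1 (ENNReal.le_of_forall_pos_le_add fun ε hε _ => ?_)
    obtain ⟨n, hn⟩ := h ε hε
    rw [zero_add]
    calc ∫⁻ y, ⨅ n, ENNReal.ofReal (w n y - l y) ∂ν
        ≤ ∫⁻ y, ENNReal.ofReal (w n y - l y) ∂ν := lintegral_mono fun y => iInf_le _ n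
      _ = ENNReal.ofReal (∫ y, (w n y - l y) ∂ν) :=
          (ofReal_integral_eq_lintegral_ofReal (hd n)
            ((hlw n).mono fun y hy => sub_nonneg.2 hy)).symm
      _ ≤ ε := by
          rw [integral_sub (hw n) hli]
          exact ENNReal.ofReal_le_of_le_toReal (by simp; linarith)
  rw [lintegral_eq_zero_iff' (.iInf fun n => (hd n).aemeasurable.ennreal_ofReal)] at h0
  filter_upwards [h0] with y hy ε hε
  have : ⨅ n, ENNReal.ofReal (w n y - l y) < ENNReal.ofReal ε := by
    rw [hy]
    simpa using hε
  obtain ⟨n, hn⟩ := iInf_lt_iff.1 this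
  exact ⟨n, by linarith [(ENNReal.ofReal_lt_ofReal_iff hε).1 hn]⟩

end Limit

/-- Theorem 5.3(2) of the paper: under the hypotheses of the pointwise sub-additive ergodic
theorem (sub-additive `G`-invariant family with `ν(𝐃) > -∞`, self-similar tiling Følner
sequence with the Tempelman condition (a) and the approximation condition (b)), if the a.e.
limit function `d = lim_n d_{F_n}/|F_n|` is `G`-invariant, then for `ν`-a.e. `y`,
`d(y) = inf_{T ∈ 𝒯_G} (1/|T|) E(d_T | 𝓘)(y)`. -/
theorem limit_eq_inf_condexp_of_invariant
    {G : Type*} [Group G] [Countable G] [Infinite G] [DecidableEq G]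
    {Y : Type*} [MeasurableSpace Y] [MulAction G Y]
    (ν : Measure Y) [IsProbabilityMeasure ν]
    (hact : ∀ g : G, MeasurePreserving (fun y => g • y) ν ν)
    (d : Finset G → Y → ℝ)
    (hint : ∀ F : Finset G, F.Nonempty → Integrable (d F) ν)
    (hinv : ∀ F : Finset G, F.Nonempty → ∀ g : G,
      ∀ᵐ y ∂ν, d (F.image (· * g)) y = d F (g • y))
    (hsub : ∀ E F : Finset G, E.Nonempty → F.Nonempty → Disjoint E F →
      ∀ᵐ y ∂ν, d (E ∪ F) y ≤ d E y + d F y)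
    (hνD : ⊥ < ⨅ T ∈ {T : Finset G | Tiles T},
      (((T.card : ℝ)⁻¹ * ∫ y, d T y ∂ν : ℝ) : EReal))
    (F : ℕ → Finset G) (hF : IsFolner F)
    (H : ℕ → Subgroup G) (π : ∀ n, G ≃* H n)
    (htile : ∀ n, TilesWith (F n) ((H n : Set G)))
    (M : ℝ) (hM : 0 < M) (hTemp : TempelmanWith F M)
    (𝒩 : Set ℕ) (h𝒩 : 𝒩.Infinite)
    (happrox : ∀ m ∈ 𝒩, ∀ δ : ℝ, 0 < δ → ∀ᶠ p in atTop, ∃ n₁ n₂ : ℕ,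
      F p ⊆ F m * ((F n₁).image fun x => ((π m x : G))) ∧
      F m * ((F n₂).image fun x => ((π m x : G))) ⊆ F p ∧
      (((F n₁).card : ℝ) - ((F n₂).card : ℝ)) / ((F p).card : ℝ) < δ)
    (dlim : Y → ℝ)
    (hlim : ∀ᵐ y ∂ν, Tendsto (fun n => d (F n) y / ((F n).card : ℝ)) atTop (𝓝 (dlim y)))
    (hGinv : ∀ g : G, ∀ᵐ y ∂ν, dlim (g • y) = dlim y) :
    ∀ᵐ y ∂ν, ((dlim y : ℝ) : EReal)
      = ⨅ T ∈ {T : Finset G | Tiles T},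
          (((T.card : ℝ)⁻¹ * (ν[d T | invSigma G ν]) y : ℝ) : EReal) := by
  have hle : invSigma G ν ≤ ‹MeasurableSpace Y› := invSigma_le
  have : MeasurableConstSMul G Y := ⟨fun g => (hact g).measurable⟩
  have : SMulInvariantMeasure G Y ν :=
    ⟨fun g _ hs => (hact g).measure_preimage hs.nullMeasurableSet⟩
  have hFt : ∀ n, Tiles (F n) := fun n => ⟨hF.1 n, _, htile n⟩
  have hgi : ∀ n, Integrable (fun y => d (F n) y / (F n).card) ν := fun n =>
    (hint _ (hF.1 n)).div_const _
  obtain ⟨c, -, hc⟩ := EReal.lt_iff_exists_real_btwn.1 hνD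
  have hc' : ∀ n, c ≤ ∫ y, d (F n) y / (F n).card ∂ν := fun n => by
    rw [integral_div, div_eq_inv_mul]
    exact_mod_cast hc.le.trans (iInf₂_le (F n) (hFt n))
  have hli : Integrable dlim ν := by
    obtain ⟨A, hA, hgA, -⟩ := exists_uniformIntegrable_dominating hint hinv hsub hF (hFt 0)
    exact integrable_of_tendsto_of_le_uniformIntegrable hgi hA hgA hc' hlim
  have hlm : AEStronglyMeasurable[invSigma G ν] dlim ν := by
    have hae := hli.aemeasurable.ae_eq_mk
    refine ⟨_, (measurable_invSigma_of_ae_invariant hli.aemeasurable.measurable_mk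
      fun g => ?_).stronglyMeasurable, hae⟩
    filter_upwards [hae, (hact g).quasiMeasurePreserving.ae hae, hGinv g] with y h₁ h₂ h₃
    rw [← h₁, ← h₂, h₃]
  have hupper : ∀ T : Finset G, Tiles T →
      dlim ≤ᵐ[ν] fun y => (T.card : ℝ)⁻¹ * (ν[d T | invSigma G ν]) y := fun T hT => by
    obtain ⟨A, hA, hgA, hAD⟩ := exists_uniformIntegrable_dominating hint hinv hsub hF hT
    have hEi : Integrable (fun y => (T.card : ℝ)⁻¹ * (ν[d T | invSigma G ν]) y) ν :=
      integrable_condExp.const_mul _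
    have hEm : StronglyMeasurable[invSigma G ν]
        fun y => (T.card : ℝ)⁻¹ * (ν[d T | invSigma G ν]) y :=
      stronglyMeasurable_condExp.const_mul _
    obtain ⟨l, hl, hdl⟩ := hlm
    have hli' := hli.congr hdl
    refine hdl.trans_le (ae_le_of_ae_le_trim (hm := hle) ?_)
    refine ae_le_of_forall_setIntegral_le (hli'.trim hle hl)
      (hEi.trim hle hEm) fun D hD _ => ?_
    rw [← setIntegral_trim hle hl hD, ← setIntegral_trim hle hEm hD,
      integral_const_mul, setIntegral_condExp hle (hint T hT.1) hD]
    obtain ⟨hDm, hDinv⟩ := measurableSet_and_smul_ae_eq_of_invSigma hD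
    exact setIntegral_le_of_tendsto_of_le_uniformIntegrable hA hgA hli'
      (by filter_upwards [hlim, hdl] with y h₁ h₂ using h₂ ▸ h₁) (hAD D hDm hDinv)
  have hlower := ae_exists_lt_add_of_forall_exists_integral_lt
    (w := fun n y => ((F n).card : ℝ)⁻¹ * (ν[d (F n) | invSigma G ν]) y)
    (fun n => integrable_condExp.const_mul _) hli (fun n => hupper (F n) (hFt n)) fun ε hε => by
      obtain ⟨A, hA, hgA, -⟩ := exists_uniformIntegrable_dominating hint hinv hsub hF (hFt 0)
      obtain ⟨n, hn⟩ :=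
        (eventually_integral_lt_of_le_uniformIntegrable hgi hA hgA hli hlim hε).exists
      refine ⟨n, ?_⟩
      rwa [integral_const_mul, integral_condExp hle, ← div_eq_inv_mul, ← integral_div]
  have hupper' : ∀ᵐ y ∂ν, ∀ T : Finset G, Tiles T →
      dlim y ≤ (T.card : ℝ)⁻¹ * (ν[d T | invSigma G ν]) y :=
    ae_all_iff.2 fun T => eventually_imp_distrib_left.2 (hupper T)
  filter_upwards [hupper', hlower] with y hy₁ hy₂
  refine le_antisymm (le_iInf₂ fun T hT => EReal.coe_le_coe_iff.2 (hy₁ T hT)) ?_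
  by_contra! hlt
  obtain ⟨z, hz₁, hz₂⟩ := EReal.lt_iff_exists_real_btwn.1 hlt
  obtain ⟨n, hn⟩ := hy₂ (z - dlim y) (sub_pos.2 (EReal.coe_lt_coe_iff.1 hz₁))
  rw [add_sub_cancel] at hn
  exact (hz₂.trans_le (iInf₂_le (F n) (hFt n))).not_gt (EReal.coe_lt_coe_iff.2 hn)
end

section
/- Let (Y, 𝒟, ν, G) be an MDS, let 𝐃 = {d_F : F ∈ 𝓕_G} ⊆ L¹(Y, 𝒟, ν) be a sub-additive G-invariant family with ν(𝐃) > −∞, and let {F_n : n ∈ ℕ} be a Følner sequence of G each of whose terms tiles G self-similarly (with tiling subgroups G_{F_n} and isomorphisms π_{F_n} : G → G_{F_n}), satisfying: (a) the Tempelman condition with some constant M > 0; (b) there is an infinite 𝒩 ⊆ ℕ such that for each m ∈ 𝒩 and each δ > 0, for all sufficiently large p there exist n_1, n_2 with F_m π_{F_m}(F_{n_1}) ⊇ F_p ⊇ F_m π_{F_m}(F_{n_2}) and (|F_{n_1}| − |F_{n_2}|)/|F_p| < δ. If in addition one of the following holds: (i) 𝐃 is G-bi-invariant; (ii) 𝐃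 is strongly sub-additive; (iii) for every N ∈ ℕ there exist p, m ∈ 𝒩 with p, m ≥ N and G_{F_m} G_{F_p} = G; then the ν-a.e. limit function d(y) = lim_{n→∞} d_{F_n}(y)/|F_n| is G-invariant, i.e. d(gy) = d(y) for ν-a.e. y and all g ∈ G. -/
open MeasureTheory Filter Topology
open scoped symmDiff Pointwise ENNReal

theorem norm_sum_sub_sum_le_card_symmDiff {G : Type*} [DecidableEq G]
    {E : Type*} [SeminormedAddCommGroup E] (f : G → E) (A B : Finset G) (C : ℝ)
    (hf : ∀ g, ‖f g‖ ≤ C) : ‖∑ c ∈ A, f c - ∑ c ∈ B, f c‖ ≤ (A ∆ B).card * C := by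
  have h1 : ∑ c ∈ A, f c - ∑ c ∈ B, f c = ∑ c ∈ A \ B, f c - ∑ c ∈ B \ A, f c := by
    rw [← Finset.sum_inter_add_sum_sdiff A B, ← Finset.sum_inter_add_sum_sdiff B A,
      Finset.inter_comm B A]
    abel
  have h2 : (A ∆ B).card = (A \ B).card + (B \ A).card := by
    rw [symmDiff_def, Finset.sup_eq_union, Finset.card_union_of_disjoint]
    exact disjoint_sdiff_sdiff
  have h3 : ∀ S : Finset G, ‖∑ c ∈ S, f c‖ ≤ S.card * C := fun S => by
    refine (norm_sum_le_of_le _ fun c _ => hf c).trans (by simp)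
  rw [h1, h2]
  push_cast
  linarith [norm_sub_le (∑ c ∈ A \ B, f c) (∑ c ∈ B \ A, f c), h3 (A \ B), h3 (B \ A)]

section MeanErgodic

variable {G : Type*} {E : Type*} [NormedAddCommGroup E] [NormedSpace ℝ E]

/-- The average of a family of isometries over a finite set. -/
noncomputable def isomAvg (U : G → E →ₗᵢ[ℝ] E) (Φ : Finset G) : E →ₗ[ℝ] E :=
  (Φ.card : ℝ)⁻¹ • ∑ c ∈ Φ, (U c).toLinearMap

theorem isomAvg_apply (U : G → E →ₗᵢ[ℝ] E) (Φ : Finset G) (x : E) :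
    isomAvg U Φ x = (Φ.card : ℝ)⁻¹ • ∑ c ∈ Φ, U c x := by
  simp [isomAvg]

theorem norm_isomAvg_le (U : G → E →ₗᵢ[ℝ] E) (Φ : Finset G) (x : E) :
    ‖isomAvg U Φ x‖ ≤ ‖x‖ := by
  rw [isomAvg_apply, norm_smul, norm_inv, Real.norm_natCast]
  have h : ‖∑ c ∈ Φ, U c x‖ ≤ Φ.card * ‖x‖ := by
    refine (norm_sum_le _ _).trans ?_
    simp
  rcases Φ.eq_empty_or_nonempty with rfl | hne
  · simp
  · have : (0 : ℝ) < Φ.card := by exact_mod_cast hne.card_pos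
    rw [inv_mul_le_iff₀ this]
    exact h

variable [Group G]

/-- The vectors whose averages converge to an invariant vector. -/
def meanErgodicSubmodule (U : G → E →ₗᵢ[ℝ] E) (H : Subgroup G) (Φ : ℕ → Finset G) :
    Submodule ℝ E where
  carrier := {x | ∃ p, Tendsto (fun n => isomAvg U (Φ n) x) atTop (𝓝 p) ∧ ∀ h ∈ H, U h p = p}
  zero_mem' := ⟨0, by simp, by simp⟩
  add_mem' := by
    rintro x y ⟨p, hp, hp'⟩ ⟨q, hq, hq'⟩
    refine ⟨p + q, by simpa using hp.add hq, fun h hh => by simp [hp' h hh, hq' h hh]⟩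
  smul_mem' := by
    rintro a x ⟨p, hp, hp'⟩
    exact ⟨a • p, by simpa using hp.const_smul a, fun h hh => by simp [hp' h hh]⟩

theorem isClosed_meanErgodicSubmodule [CompleteSpace E] (U : G → E →ₗᵢ[ℝ] E) (H : Subgroup G)
    (Φ : ℕ → Finset G) : IsClosed (meanErgodicSubmodule U H Φ : Set E) := by
  rw [← isSeqClosed_iff_isClosed]
  intro x a hx hxa
  choose p hp hp' using hx
  have hdist : ∀ i j, dist (p i) (p j) ≤ dist (x i) (x j) := by
    intro i j
    rw [dist_eq_norm, dist_eq_norm]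
    refine le_of_tendsto ((hp i).sub (hp j)).norm (Eventually.of_forall fun n => ?_)
    rw [← map_sub]
    exact norm_isomAvg_le _ _ _
  have hcauchy : CauchySeq p := by
    have := hxa.cauchySeq
    rw [Metric.cauchySeq_iff] at this ⊢
    intro ε hε
    obtain ⟨N, hN⟩ := this ε hε
    exact ⟨N, fun m hm n hn => (hdist m n).trans_lt (hN m hm n hn)⟩
  obtain ⟨q, hq⟩ := cauchySeq_tendsto_of_complete hcauchy
  refine ⟨q, ?_, fun h hh => ?_⟩
  · rw [Metric.tendsto_atTop']
    intro ε hε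
    have h1 : ∀ᶠ k in atTop, dist (x k) a < ε / 3 := (Metric.tendsto_nhds.1 hxa) _ (by positivity)
    have h2 : ∀ᶠ k in atTop, dist (p k) q < ε / 3 := (Metric.tendsto_nhds.1 hq) _ (by positivity)
    obtain ⟨k, hk1, hk2⟩ := (h1.and h2).exists
    obtain ⟨N, hN⟩ := (Metric.tendsto_atTop'.1 (hp k)) (ε / 3) (by positivity)
    refine ⟨N, fun n hn => ?_⟩
    have h3 : dist (isomAvg U (Φ n) a) (isomAvg U (Φ n) (x k)) ≤ dist (x k) a := by
      rw [dist_eq_norm, ← map_sub, dist_comm, dist_eq_norm]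
      exact norm_isomAvg_le _ _ _
    have h4 := dist_triangle4 (isomAvg U (Φ n) a) (isomAvg U (Φ n) (x k)) (p k) q
    linarith [hN n hn]
  · refine tendsto_nhds_unique (((U h).continuous.tendsto q).comp hq) ?_
    simpa [Function.comp_def, hp' _ h hh] using hq

theorem mem_meanErgodicSubmodule_of_invariant (U : G → E →ₗᵢ[ℝ] E) (H : Subgroup G)
    (Φ : ℕ → Finset G) (hΦH : ∀ n, ∀ c ∈ Φ n, c ∈ H) (hne : ∀ᶠ n in atTop, (Φ n).Nonempty)
    {x : E} (hx : ∀ h ∈ H, U h x = x) : x ∈ meanErgodicSubmodule U H Φ := by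
  refine ⟨x, tendsto_const_nhds.congr' ?_, hx⟩
  filter_upwards [hne] with n hn
  have : ((Φ n).card : ℝ) ≠ 0 := by exact_mod_cast hn.card_pos.ne'
  rw [isomAvg_apply, Finset.sum_congr rfl fun c hc => hx c (hΦH n c hc), Finset.sum_const,
    ← Nat.cast_smul_eq_nsmul ℝ, smul_smul, inv_mul_cancel₀ this, one_smul]

variable [DecidableEq G]

theorem coboundary_mem_meanErgodicSubmodule (U : G → E →ₗᵢ[ℝ] E)
    (hU : ∀ g h x, U (g * h) x = U h (U g x)) (H : Subgroup G) (Φ : ℕ → Finset G)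
    (hΦ : ∀ h ∈ H, Tendsto (fun n => ((((Φ n).image (h * ·)) ∆ (Φ n)).card : ℝ) / (Φ n).card)
      atTop (𝓝 0)) {h : G} (hh : h ∈ H) (x : E) :
    U h x - x ∈ meanErgodicSubmodule U H Φ := by
  refine ⟨0, ?_, by simp⟩
  rw [tendsto_zero_iff_norm_tendsto_zero]
  have h0 := (hΦ h hh).mul_const ‖x‖
  rw [zero_mul] at h0
  refine squeeze_zero (fun _ => norm_nonneg _) (fun n => ?_) h0
  rw [isomAvg_apply, norm_smul, norm_inv, Real.norm_natCast]
  have h1 : ∑ c ∈ Φ n, U c (U h x - x)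
      = ∑ c ∈ (Φ n).image (h * ·), U c x - ∑ c ∈ Φ n, U c x := by
    rw [Finset.sum_image fun a _ b _ hab => mul_left_cancel hab, ← Finset.sum_sub_distrib]
    exact Finset.sum_congr rfl fun c _ => by rw [map_sub, hU]
  rw [h1, div_mul_eq_mul_div, inv_mul_eq_div]
  gcongr
  exact norm_sum_sub_sum_le_card_symmDiff _ _ _ _ fun g => ((U g).norm_map x).le

end MeanErgodic

theorem meanErgodicSubmodule_eq_top {G : Type*} [Group G] [DecidableEq G]
    {E : Type*} [NormedAddCommGroup E] [InnerProductSpace ℝ E]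
    [CompleteSpace E] (U : G → E →ₗᵢ[ℝ] E)
    (hU : ∀ g h x, U (g * h) x = U h (U g x)) (H : Subgroup G) (Φ : ℕ → Finset G)
    (hΦH : ∀ n, ∀ c ∈ Φ n, c ∈ H) (hne : ∀ᶠ n in atTop, (Φ n).Nonempty)
    (hΦ : ∀ h ∈ H, Tendsto (fun n => ((((Φ n).image (h * ·)) ∆ (Φ n)).card : ℝ) / (Φ n).card)
      atTop (𝓝 0)) : meanErgodicSubmodule U H Φ = ⊤ := by
  have hcob := fun (h : G) (hh : h ∈ H) (x : E) =>
    coboundary_mem_meanErgodicSubmodule U hU H Φ hΦ hh x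
  have hfix := fun (x : E) (hx : ∀ h ∈ H, U h x = x) =>
    mem_meanErgodicSubmodule_of_invariant U H Φ hΦH hne hx
  have hcl := isClosed_meanErgodicSubmodule U H Φ
  generalize meanErgodicSubmodule U H Φ = S at hcob hfix hcl ⊢
  have : CompleteSpace S := hcl.completeSpace_coe
  rw [← Submodule.orthogonal_eq_bot_iff, Submodule.eq_bot_iff]
  intro v hv
  have hinv : ∀ h ∈ H, U h v = v := by
    intro h hh
    have h1 := (Submodule.mem_orthogonal _ _).1 hv _ (hcob h hh v)
    rw [inner_sub_left, real_inner_self_eq_norm_sq] at h1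
    have h2 := norm_sub_sq_real (U h v) v
    rw [(U h).norm_map] at h2
    rw [← sub_eq_zero, ← norm_eq_zero, ← sq_eq_zero_iff]
    linarith
  exact inner_self_eq_zero (𝕜 := ℝ).1 ((Submodule.mem_orthogonal _ _).1 hv v (hfix v hinv))

theorem lp_coeFn_sum {Y ι : Type*} [MeasurableSpace Y] {ν : Measure Y} {p : ℝ≥0∞}
    (s : Finset ι) (f : ι → Lp ℝ p ν) :
    ((∑ i ∈ s, f i : Lp ℝ p ν) : Y → ℝ) =ᵐ[ν] fun y => ∑ i ∈ s, f i y := by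
  classical
  induction s using Finset.induction_on with
  | empty => simpa using! Lp.coeFn_zero ℝ p ν
  | insert a s ha ih =>
    simp only [Finset.sum_insert ha]
    filter_upwards [Lp.coeFn_add (f a) (∑ i ∈ s, f i), ih] with y h1 h2
    rw [h1, Pi.add_apply, h2]

theorem MeasureTheory.MeasurePreserving.integral_comp_eq {Y : Type*} [MeasurableSpace Y]
    {ν : Measure Y} {T : Y → Y} (hT : MeasurePreserving T ν ν) {u : Y → ℝ}
    (hu : AEStronglyMeasurable u ν) : ∫ y, u (T y) ∂ν = ∫ y, u y ∂ν := by
  rw [← integral_map hT.aemeasurable (by rwa [hT.map_eq]), hT.map_eq]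

section Koopman

variable {G : Type*} [Group G] {Y : Type*} [MeasurableSpace Y] [MulAction G Y]
  {ν : Measure Y}

/-- The Koopman isometries of a measure preserving action on `Lp`. -/
noncomputable def koopman (hact : ∀ g : G, MeasurePreserving (fun y => g • y) ν ν)
    (p : ℝ≥0∞) [Fact (1 ≤ p)] (g : G) : Lp ℝ p ν →ₗᵢ[ℝ] Lp ℝ p ν :=
  Lp.compMeasurePreservingₗᵢ ℝ (fun y => g • y) (hact g)

theorem koopman_apply_ae (hact : ∀ g : G, MeasurePreserving (fun y => g • y) ν ν)
    (p : ℝ≥0∞) [Fact (1 ≤ p)] (g : G) (x : Lp ℝ p ν) :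
    koopman hact p g x =ᵐ[ν] fun y => x (g • y) :=
  Lp.coeFn_compMeasurePreserving x (hact g)

theorem koopman_mul (hact : ∀ g : G, MeasurePreserving (fun y => g • y) ν ν)
    (p : ℝ≥0∞) [Fact (1 ≤ p)] (g h : G) (x : Lp ℝ p ν) :
    koopman hact p (g * h) x = koopman hact p h (koopman hact p g x) := by
  apply Lp.ext
  filter_upwards [koopman_apply_ae hact p (g * h) x,
    koopman_apply_ae hact p h (koopman hact p g x),
    (hact h).quasiMeasurePreserving.ae (koopman_apply_ae hact p g x)] with y h1 h2 h3
  rw [h1, h2, h3, mul_smul]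

theorem isomAvg_koopman_ae (hact : ∀ g : G, MeasurePreserving (fun y => g • y) ν ν)
    (p : ℝ≥0∞) [Fact (1 ≤ p)] (Φ : Finset G) (x : Lp ℝ p ν) :
    isomAvg (koopman hact p) Φ x =ᵐ[ν] fun y => (Φ.card : ℝ)⁻¹ * ∑ c ∈ Φ, x (c • y) := by
  rw [isomAvg_apply]
  have hs : ∀ᵐ y ∂ν, ∀ c ∈ Φ, koopman hact p c x y = x (c • y) :=
    (ae_ball_iff (Finset.countable_toSet Φ)).2 fun c _ => koopman_apply_ae hact p c x
  filter_upwards [Lp.coeFn_smul (Φ.card : ℝ)⁻¹ (∑ c ∈ Φ, koopman hact p c x),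
    lp_coeFn_sum Φ fun c => koopman hact p c x, hs] with y h1 h2 h3
  rw [h1, Pi.smul_apply, h2, Finset.sum_congr rfl h3, smul_eq_mul]

/-- The inclusion of `L²` into `L¹` for a probability measure. -/
noncomputable def lpTwoToLpOne (ν : Measure Y) [IsProbabilityMeasure ν] :
    Lp ℝ 2 ν →L[ℝ] Lp ℝ 1 ν :=
  LinearMap.mkContinuous
    { toFun := fun x => ⟨x.1, Lp.antitone one_le_two x.2⟩
      map_add' := fun _ _ => rfl
      map_smul' := fun _ _ => rfl } 1 fun x => by
    rw [one_mul, Lp.norm_def, Lp.norm_def]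
    exact ENNReal.toReal_mono (Lp.eLpNorm_ne_top x)
      (eLpNorm_le_eLpNorm_of_exponent_le one_le_two (Lp.aestronglyMeasurable x))

theorem dense_range_lpTwoToLpOne (ν : Measure Y) [IsProbabilityMeasure ν] :
    Dense (Set.range (lpTwoToLpOne ν)) := by
  refine (Lp.simpleFunc.dense (E := ℝ) (μ := ν) (p := 1) (by simp)).mono fun x hx => ?_
  have h1 := Lp.simpleFunc.toSimpleFunc_eq_toFun ⟨x, hx⟩
  have h2 : MemLp x 2 ν := (memLp_congr_ae h1).1
    ((Lp.simpleFunc.toSimpleFunc ⟨x, hx⟩).memLp_of_isFiniteMeasure 2 ν)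
  exact ⟨⟨x.1, Lp.mem_Lp_iff_memLp.2 h2⟩, rfl⟩

variable [DecidableEq G] [IsProbabilityMeasure ν]

theorem meanErgodicSubmodule_koopman_one_eq_top
    (hact : ∀ g : G, MeasurePreserving (fun y => g • y) ν ν)
    (H : Subgroup G) (Φ : ℕ → Finset G)
    (hΦH : ∀ n, ∀ c ∈ Φ n, c ∈ H) (hne : ∀ᶠ n in atTop, (Φ n).Nonempty)
    (hΦ : ∀ h ∈ H, Tendsto (fun n => ((((Φ n).image (h * ·)) ∆ (Φ n)).card : ℝ) / (Φ n).card)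
      atTop (𝓝 0)) : meanErgodicSubmodule (koopman hact 1) H Φ = ⊤ := by
  have hJ : ∀ g x, koopman hact 1 g (lpTwoToLpOne ν x) = lpTwoToLpOne ν (koopman hact 2 g x) :=
    fun _ _ => rfl
  have hJavg : ∀ n x, isomAvg (koopman hact 1) (Φ n) (lpTwoToLpOne ν x)
      = lpTwoToLpOne ν (isomAvg (koopman hact 2) (Φ n) x) := fun n x => by
    simp only [isomAvg_apply, hJ, map_smul, map_sum]
  have htop := meanErgodicSubmodule_eq_top (koopman hact 2) (koopman_mul hact 2) H Φ hΦH hne hΦ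
  have hcl := isClosed_meanErgodicSubmodule (koopman hact 1) H Φ
  have hd : Dense (meanErgodicSubmodule (koopman hact 1) H Φ : Set (Lp ℝ 1 ν)) := by
    refine (dense_range_lpTwoToLpOne ν).mono ?_
    rintro _ ⟨x, rfl⟩
    obtain ⟨p, hp, hp'⟩ : x ∈ meanErgodicSubmodule (koopman hact 2) H Φ := by
      rw [htop]; trivial
    refine ⟨lpTwoToLpOne ν p, ?_, fun h hh => by rw [hJ, hp' h hh]⟩
    simp only [hJavg]
    exact ((lpTwoToLpOne ν).continuous.tendsto p).comp hp
  rw [← SetLike.coe_set_eq, ← hcl.closure_eq, hd.closure_eq, Submodule.top_coe]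

/-- The `L¹` mean ergodic theorem for averages along Følner sets of a subgroup. -/
theorem exists_invariant_limit_average
    (hact : ∀ g : G, MeasurePreserving (fun y => g • y) ν ν)
    (H : Subgroup G) (Φ : ℕ → Finset G)
    (hΦH : ∀ n, ∀ c ∈ Φ n, c ∈ H) (hne : ∀ᶠ n in atTop, (Φ n).Nonempty)
    (hΦ : ∀ h ∈ H, Tendsto (fun n => ((((Φ n).image (h * ·)) ∆ (Φ n)).card : ℝ) / (Φ n).card)
      atTop (𝓝 0)) {u : Y → ℝ} (hu : Integrable u ν) :
    ∃ P : Y → ℝ, Integrable P ν ∧ (∀ h ∈ H, ∀ᵐ y ∂ν, P (h • y) = P y) ∧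
      ∫ y, P y ∂ν = ∫ y, u y ∂ν ∧
      TendstoInMeasure ν (fun n y => ((Φ n).card : ℝ)⁻¹ * ∑ c ∈ Φ n, u (c • y)) atTop P := by
  obtain ⟨p, hp, hp'⟩ : hu.toL1 u ∈ meanErgodicSubmodule (koopman hact 1) H Φ := by
    rw [meanErgodicSubmodule_koopman_one_eq_top hact H Φ hΦH hne hΦ]; trivial
  have hae : ∀ n, isomAvg (koopman hact 1) (Φ n) (hu.toL1 u)
      =ᵐ[ν] fun y => ((Φ n).card : ℝ)⁻¹ * ∑ c ∈ Φ n, u (c • y) := fun n => by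
    have hs : ∀ᵐ y ∂ν, ∀ c ∈ Φ n, hu.toL1 u (c • y) = u (c • y) :=
      (ae_ball_iff (Finset.countable_toSet _)).2 fun c _ =>
        (hact c).quasiMeasurePreserving.ae hu.coeFn_toL1
    filter_upwards [isomAvg_koopman_ae hact 1 (Φ n) (hu.toL1 u), hs] with y h1 h2
    rw [h1, Finset.sum_congr rfl h2]
  refine ⟨p, L1.integrable_coeFn p, fun h hh => ?_, ?_, ?_⟩
  · filter_upwards [koopman_apply_ae hact 1 h p] with y hy
    rw [← hy, hp' h hh]
  · have h1 : Tendsto (fun n => ∫ y, isomAvg (koopman hact 1) (Φ n) (hu.toL1 u) y ∂ν) atTop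
        (𝓝 (∫ y, p y ∂ν)) := (continuous_integral.tendsto p).comp hp
    refine tendsto_nhds_unique h1 (tendsto_const_nhds.congr' ?_)
    filter_upwards [hne] with n hn
    have hint : ∀ c : G, Integrable (fun y => u (c • y)) ν := fun c =>
      (hact c).integrable_comp_of_integrable hu
    have hc : ((Φ n).card : ℝ) ≠ 0 := by exact_mod_cast hn.card_pos.ne'
    rw [integral_congr_ae (hae n), integral_const_mul, integral_finsetSum _ fun c _ => hint c,
      Finset.sum_congr rfl fun c _ => (hact c).integral_comp_eq hu.aestronglyMeasurable,
      Finset.sum_const, nsmul_eq_mul, ← mul_assoc,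
      inv_mul_cancel₀ hc, one_mul]
  · exact (tendstoInMeasure_of_tendsto_Lp hp).congr_left hae

end Koopman

section Folner

variable {G : Type*} [Group G]

open Classical in
/-- The elements of `F` that some element of `K` moves out of `F`. -/
noncomputable def leftBoundary (K F : Finset G) : Finset G :=
  F.filter fun x => ∃ k ∈ K, k * x ∉ F

open Classical in
/-- The elements `c` of `F` that lie in `H` and satisfy `K * c ⊆ F`. -/
noncomputable def innerCenters (H : Subgroup G) (K F : Finset G) : Finset G :=
  F.filter fun c => c ∈ H ∧ ∀ k ∈ K, k * c ∈ F

theorem mem_leftBoundary {K F : Finset G} {x : G} :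
    x ∈ leftBoundary K F ↔ x ∈ F ∧ ∃ k ∈ K, k * x ∉ F := by
  classical simp [leftBoundary]

theorem mem_innerCenters {H : Subgroup G} {K F : Finset G} {c : G} :
    c ∈ innerCenters H K F ↔ c ∈ F ∧ c ∈ H ∧ ∀ k ∈ K, k * c ∈ F := by
  classical simp [innerCenters]

theorem TilesWith.nonempty {T : Finset G} {C : Set G} (h : TilesWith T C) : T.Nonempty := by
  obtain ⟨c, ⟨-, t, ht, -⟩, -⟩ := h 1
  exact ⟨t, ht⟩

variable [DecidableEq G]

theorem card_leftBoundary_le (K F : Finset G) :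
    (leftBoundary K F).card ≤ ∑ k ∈ K, ((F.image (k * ·)) ∆ F).card := by
  classical
  have h1 : leftBoundary K F ⊆ K.biUnion fun k => F.filter fun x => k * x ∉ F := fun x hx => by
    obtain ⟨hx, k, hk, hkx⟩ := mem_leftBoundary.1 hx
    exact Finset.mem_biUnion.2 ⟨k, hk, Finset.mem_filter.2 ⟨hx, hkx⟩⟩
  refine (Finset.card_le_card h1).trans (Finset.card_biUnion_le.trans ?_)
  refine Finset.sum_le_sum fun k _ => ?_
  refine Finset.card_le_card_of_injOn (k * ·) (fun x hx => ?_) fun a _ b _ h => mul_left_cancel h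
  obtain ⟨hx, hkx⟩ := Finset.mem_filter.1 hx
  exact Finset.mem_coe.2 (Finset.mem_symmDiff.2 (Or.inl ⟨Finset.mem_image_of_mem _ hx, hkx⟩))

theorem IsFolner.tendsto_leftBoundary {F : ℕ → Finset G} (hF : IsFolner F) (K : Finset G) :
    Tendsto (fun n => ((leftBoundary K (F n)).card : ℝ) / (F n).card) atTop (𝓝 0) := by
  have h := tendsto_finsetSum K fun k _ => hF.2 k
  rw [Finset.sum_const_zero] at h
  refine squeeze_zero (fun n => by positivity) (fun n => ?_) h
  rw [← Finset.sum_div]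
  gcongr
  exact_mod_cast card_leftBoundary_le K (F n)

theorem card_image_symmDiff_innerCenters_le (H : Subgroup G) (K F : Finset G) {h : G}
    (hh : h ∈ H) :
    (((innerCenters H K F).image (h * ·)) ∆ innerCenters H K F).card
      ≤ 2 * (leftBoundary (insert 1 K * {h, h⁻¹}) F).card := by
  set B := leftBoundary (insert 1 K * {h, h⁻¹}) F with hB
  have key : ∀ c ∈ innerCenters H K F, ∀ g ∈ H, g = h ∨ g = h⁻¹ → g * c ∉ innerCenters H K F →
      c ∈ B := by
    intro c hc g hg hgh hgc
    rw [mem_innerCenters] at hc hgc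
    have hg' : g ∈ ({h, h⁻¹} : Finset G) := by simpa using hgh
    refine mem_leftBoundary.2 ⟨hc.1, ?_⟩
    by_contra! hcon
    refine hgc ⟨?_, H.mul_mem hg hc.2.1, fun k hk => ?_⟩
    · simpa using hcon (1 * g) (Finset.mul_mem_mul (Finset.mem_insert_self _ _) hg')
    · simpa [mul_assoc] using
        hcon (k * g) (Finset.mul_mem_mul (Finset.mem_insert_of_mem hk) hg')
  have hsub : ((innerCenters H K F).image (h * ·)) ∆ innerCenters H K F
      ⊆ B.image (h * ·) ∪ B := by
    intro x hx
    rcases Finset.mem_symmDiff.1 hx with ⟨h1, h2⟩ | ⟨h1, h2⟩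
    · obtain ⟨c, hc, rfl⟩ := Finset.mem_image.1 h1
      exact Finset.mem_union_left _ (Finset.mem_image_of_mem _ (key c hc h hh (Or.inl rfl) h2))
    · refine Finset.mem_union_right _ (key x h1 h⁻¹ (H.inv_mem hh) (Or.inr rfl) fun h3 => h2 ?_)
      exact Finset.mem_image.2 ⟨h⁻¹ * x, h3, by simp⟩
  calc _ ≤ (B.image (h * ·) ∪ B).card := Finset.card_le_card hsub
    _ ≤ (B.image (h * ·)).card + B.card := Finset.card_union_le _ _
    _ ≤ 2 * B.card := by linarith [Finset.card_image_le (s := B) (f := (h * ·))]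

theorem card_le_mul_card_innerCenters (H : Subgroup G) {E : Finset G} (hE : TilesWith E (H : Set G))
    (K F : Finset G) :
    F.card ≤ E.card * (innerCenters H K F).card + (leftBoundary (insert 1 K * E⁻¹) F).card := by
  have hsub : F ⊆ E * innerCenters H K F ∪ leftBoundary (insert 1 K * E⁻¹) F := by
    intro x hx
    obtain ⟨c, ⟨hc, t, ht, rfl⟩, -⟩ := hE x
    by_cases hcC : c ∈ innerCenters H K F
    · exact Finset.mem_union_left _ (Finset.mul_mem_mul ht hcC)
    · refine Finset.mem_union_right _ (mem_leftBoundary.2 ⟨hx, ?_⟩)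
      have ht' : t⁻¹ ∈ E⁻¹ := Finset.inv_mem_inv ht
      by_contra! hcon
      refine hcC (mem_innerCenters.2 ⟨?_, hc, fun k hk => ?_⟩)
      · simpa using hcon (1 * t⁻¹) (Finset.mul_mem_mul (Finset.mem_insert_self _ _) ht')
      · simpa [mul_assoc] using
          hcon (k * t⁻¹) (Finset.mul_mem_mul (Finset.mem_insert_of_mem hk) ht')
  calc F.card ≤ _ := Finset.card_le_card hsub
    _ ≤ _ := Finset.card_union_le _ _
    _ ≤ _ := by gcongr; exact Finset.card_mul_le

/-- The inner centers of a Følner sequence have density at least about `1 / |E|`. -/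
theorem IsFolner.exists_density_innerCenters {F : ℕ → Finset G} (hF : IsFolner F)
    (H : Subgroup G) {E : Finset G} (hE : TilesWith E (H : Set G)) (K : Finset G) :
    ∃ b : ℕ → ℝ, Tendsto b atTop (𝓝 0) ∧ ∀ n, (E.card : ℝ)⁻¹ * (1 - b n)
      ≤ ((innerCenters H K (F n)).card : ℝ) / (F n).card := by
  refine ⟨_, hF.tendsto_leftBoundary (insert 1 K * E⁻¹), fun n => ?_⟩
  have hF0 : (0 : ℝ) < (F n).card := by exact_mod_cast (hF.1 n).card_pos
  have hE0 : (0 : ℝ) < E.card := by exact_mod_cast hE.nonempty.card_pos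
  have h : ((F n).card : ℝ) ≤ E.card * (innerCenters H K (F n)).card
      + (leftBoundary (insert 1 K * E⁻¹) (F n)).card := by
    exact_mod_cast card_le_mul_card_innerCenters H hE K (F n)
  rw [inv_mul_le_iff₀ hE0, one_sub_div hF0.ne', ← mul_div_assoc]
  gcongr
  linarith

theorem IsFolner.eventually_half_le_innerCenters {F : ℕ → Finset G} (hF : IsFolner F)
    (H : Subgroup G) {E : Finset G} (hE : TilesWith E (H : Set G)) (K : Finset G) :
    ∀ᶠ n in atTop, ((F n).card : ℝ) ≤ 2 * E.card * (innerCenters H K (F n)).card := by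
  obtain ⟨b, hb, hb'⟩ := hF.exists_density_innerCenters H hE K
  have hE0 : (0 : ℝ) < E.card := by exact_mod_cast hE.nonempty.card_pos
  filter_upwards [hb.eventually_lt_const (show (0 : ℝ) < 1 / 2 by norm_num)] with n hn
  have hF0 : (0 : ℝ) < (F n).card := by exact_mod_cast (hF.1 n).card_pos
  have h := hb' n
  rw [inv_mul_le_iff₀ hE0, ← mul_div_assoc, le_div_iff₀ hF0] at h
  nlinarith

theorem IsFolner.eventually_innerCenters_nonempty {F : ℕ → Finset G} (hF : IsFolner F)
    (H : Subgroup G) {E : Finset G} (hE : TilesWith E (H : Set G)) (K : Finset G) :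
    ∀ᶠ n in atTop, (innerCenters H K (F n)).Nonempty := by
  filter_upwards [hF.eventually_half_le_innerCenters H hE K] with n hn
  rw [Finset.nonempty_iff_ne_empty]
  intro h
  have hF0 : (0 : ℝ) < (F n).card := by exact_mod_cast (hF.1 n).card_pos
  simp [h] at hn
  exact (hF.1 n).ne_empty hn

theorem IsFolner.tendsto_innerCenters_symmDiff {F : ℕ → Finset G} (hF : IsFolner F)
    (H : Subgroup G) {E : Finset G} (hE : TilesWith E (H : Set G)) (K : Finset G) {h : G}
    (hh : h ∈ H) :
    Tendsto (fun n => ((((innerCenters H K (F n)).image (h * ·)) ∆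
      innerCenters H K (F n)).card : ℝ) / (innerCenters H K (F n)).card) atTop (𝓝 0) := by
  have h0 := (hF.tendsto_leftBoundary (insert 1 K * {h, h⁻¹})).const_mul (4 * (E.card : ℝ))
  rw [mul_zero] at h0
  refine squeeze_zero' (Eventually.of_forall fun n => by positivity) ?_ h0
  filter_upwards [hF.eventually_half_le_innerCenters H hE K,
    hF.eventually_innerCenters_nonempty H hE K] with n hn hne
  have hF0 : (0 : ℝ) < (F n).card := by exact_mod_cast (hF.1 n).card_pos
  have hC0 : (0 : ℝ) < (innerCenters H K (F n)).card := by exact_mod_cast hne.card_pos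
  have hle : ((((innerCenters H K (F n)).image (h * ·)) ∆ innerCenters H K (F n)).card : ℝ)
      ≤ 2 * (leftBoundary (insert 1 K * {h, h⁻¹}) (F n)).card := by
    exact_mod_cast card_image_symmDiff_innerCenters_le H K (F n) hh
  rw [div_le_iff₀ hC0, ← mul_div_assoc, div_mul_eq_mul_div, le_div_iff₀ hF0]
  calc _ ≤ (2 * (leftBoundary (insert 1 K * {h, h⁻¹}) (F n)).card : ℝ)
        * (2 * E.card * (innerCenters H K (F n)).card) := by gcongr
    _ = _ := by ring

end Folner

section UpperBound

variable {G : Type*} [Group G] [DecidableEq G] {Y : Type*} [MeasurableSpace Y] [MulAction G Y]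
  {ν : Measure Y} [IsProbabilityMeasure ν]

theorem exists_invariant_upper_bound
    (hact : ∀ g : G, MeasurePreserving (fun y => g • y) ν ν)
    {F : ℕ → Finset G} (hF : IsFolner F) {r : ℕ → Y → ℝ} {L : Y → ℝ}
    (hr : TendstoInMeasure ν r atTop L) (H : Subgroup G) {E : Finset G}
    (hE : TilesWith E (H : Set G)) (K : Finset G) {u : Y → ℝ} (hu : Integrable u ν)
    (hu0 : ∀ᵐ y ∂ν, u y ≤ 0) :
    ∃ Q : Y → ℝ, Integrable Q ν ∧ (∀ h ∈ H, ∀ᵐ y ∂ν, Q (h • y) = Q y) ∧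
      ∫ y, Q y ∂ν = (E.card : ℝ)⁻¹ * ∫ y, u y ∂ν ∧
      ∀ γ : G, (∀ n, ∀ᵐ y ∂ν,
        (F n).card * r n y ≤ ∑ c ∈ innerCenters H K (F n), u (c • γ • y)) →
        ∀ᵐ y ∂ν, L y ≤ Q (γ • y) := by
  obtain ⟨P, hP, hPinv, hPint, hPlim⟩ := exists_invariant_limit_average hact H
    (fun n => innerCenters H K (F n)) (fun n c hc => (mem_innerCenters.1 hc).2.1)
    (hF.eventually_innerCenters_nonempty H hE K)
    (fun h hh => hF.tendsto_innerCenters_symmDiff H hE K hh) hu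
  refine ⟨fun y => (E.card : ℝ)⁻¹ * P y, hP.const_mul _, fun h hh => ?_, ?_, fun γ hγ => ?_⟩
  · filter_upwards [hPinv h hh] with y hy
    rw [hy]
  · rw [integral_const_mul, hPint]
  obtain ⟨φ, hφ, hφr⟩ := hr.exists_seq_tendsto_ae
  obtain ⟨ψ, hψ, hψP⟩ := (hPlim.comp hφ.tendsto_atTop).exists_seq_tendsto_ae
  obtain ⟨b, hb, hb'⟩ := hF.exists_density_innerCenters H hE K
  have hu0' : ∀ᵐ y ∂ν, ∀ n, ∀ c ∈ innerCenters H K (F n), u (c • γ • y) ≤ 0 :=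
    ae_all_iff.2 fun n => (ae_ball_iff (Finset.countable_toSet _)).2 fun c _ =>
      (hact γ).quasiMeasurePreserving.ae ((hact c).quasiMeasurePreserving.ae hu0)
  filter_upwards [hφr, (hact γ).quasiMeasurePreserving.ae hψP, hu0', ae_all_iff.2 hγ]
    with y h1 h2 h3 h4
  have h5 : Tendsto (fun k => r (φ (ψ k)) y) atTop (𝓝 (L y)) := h1.comp hψ.tendsto_atTop
  have h6 := (((hb.comp (hφ.comp hψ).tendsto_atTop).const_sub 1).const_mul
    (E.card : ℝ)⁻¹).mul h2
  rw [sub_zero, mul_one] at h6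
  refine le_of_tendsto_of_tendsto' h5 h6 fun k => ?_
  simp only [Function.comp_apply]
  set n := φ (ψ k)
  set C := innerCenters H K (F n)
  have hF0 : (0 : ℝ) < (F n).card := by exact_mod_cast (hF.1 n).card_pos
  have hs : ∑ c ∈ C, u (c • γ • y) ≤ 0 := Finset.sum_nonpos (h3 n)
  have hle : r n y ≤ (C.card : ℝ) / (F n).card * ((C.card : ℝ)⁻¹ * ∑ c ∈ C, u (c • γ • y)) := by
    have : (C.card : ℝ) * ((C.card : ℝ)⁻¹ * ∑ c ∈ C, u (c • γ • y)) = ∑ c ∈ C, u (c • γ • y) := by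
      rcases C.eq_empty_or_nonempty with hC | hC
      · simp [hC]
      · rw [mul_inv_cancel_left₀ (by exact_mod_cast hC.card_pos.ne')]
    rw [div_mul_eq_mul_div, this, le_div_iff₀ hF0, mul_comm]
    exact h4 n
  exact hle.trans (mul_le_mul_of_nonpos_right (hb' n)
    (mul_nonpos_of_nonneg_of_nonpos (by positivity) hs))

end UpperBound

theorem MeasureTheory.TendstoInMeasure.integrable_and_integral_le {Y : Type*} [MeasurableSpace Y]
    {ν : Measure Y} {f : ℕ → Y → ℝ} {g : Y → ℝ} (hfg : TendstoInMeasure ν f atTop g)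
    (hf : ∀ n, Integrable (f n) ν) (hf0 : ∀ n, 0 ≤ᵐ[ν] f n) {c : ℝ}
    (hc : ∃ᶠ n in atTop, ∫ y, f n y ∂ν ≤ c) : Integrable g ν ∧ ∫ y, g y ∂ν ≤ c := by
  obtain ⟨φ, hφ, hφc⟩ := Filter.extraction_of_frequently_atTop hc
  obtain ⟨ψ, -, hψg⟩ := (hfg.comp hφ.tendsto_atTop).exists_seq_tendsto_ae
  have hgm : AEStronglyMeasurable g ν :=
    aestronglyMeasurable_of_tendsto_ae atTop (fun k => (hf _).aestronglyMeasurable) hψg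
  have hg0 : 0 ≤ᵐ[ν] g := by
    filter_upwards [hψg, ae_all_iff.2 hf0] with y h1 h2
    exact ge_of_tendsto' h1 fun k => h2 _
  have hc0 : 0 ≤ c := (integral_nonneg_of_ae (hf0 _)).trans (hφc 0)
  have hle : ∫⁻ y, ENNReal.ofReal (g y) ∂ν ≤ ENNReal.ofReal c := by
    calc ∫⁻ y, ENNReal.ofReal (g y) ∂ν
        = ∫⁻ y, liminf (fun k => ENNReal.ofReal (f (φ (ψ k)) y)) atTop ∂ν := by
          refine lintegral_congr_ae ?_
          filter_upwards [hψg] with y hy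
          exact ((ENNReal.continuous_ofReal.tendsto _).comp hy).liminf_eq.symm
      _ ≤ liminf (fun k => ∫⁻ y, ENNReal.ofReal (f (φ (ψ k)) y) ∂ν) atTop :=
          lintegral_liminf_le' fun k => (hf _).aemeasurable.ennreal_ofReal
      _ ≤ ENNReal.ofReal c := by
          refine liminf_le_of_frequently_le' (Frequently.of_forall fun k => ?_)
          rw [← ofReal_integral_eq_lintegral_ofReal (hf _) (hf0 _)]
          exact ENNReal.ofReal_le_ofReal (hφc _)
  refine ⟨⟨hgm, ?_⟩, ?_⟩
  · rw [hasFiniteIntegral_iff_ofReal hg0]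
    exact hle.trans_lt ENNReal.ofReal_lt_top
  · rw [integral_eq_lintegral_of_nonneg_ae hg0 hgm]
    exact ENNReal.toReal_le_of_le_ofReal hc0 hle

section SetFunction

variable {G : Type*} [DecidableEq G] {D : Finset G → ℝ}

theorem le_of_subset_of_subadditive_of_nonpos
    (hsub : ∀ A B : Finset G, A.Nonempty → B.Nonempty → Disjoint A B → D (A ∪ B) ≤ D A + D B)
    (hneg : ∀ A : Finset G, A.Nonempty → D A ≤ 0) {A F : Finset G} (hA : A.Nonempty)
    (hAF : A ⊆ F) : D F ≤ D A := by
  rcases (F \ A).eq_empty_or_nonempty with h | h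
  · rw [Finset.Subset.antisymm (Finset.sdiff_eq_empty_iff_subset.1 h) hAF]
  · have := hsub A (F \ A) hA h Finset.disjoint_sdiff
    rw [Finset.union_sdiff_of_subset hAF] at this
    linarith [hneg _ h]

theorem biUnion_le_sum_of_subadditive {ι : Type*}
    (hsub : ∀ A B : Finset G, A.Nonempty → B.Nonempty → Disjoint A B → D (A ∪ B) ≤ D A + D B)
    {C : Finset ι} (hC : C.Nonempty) (A : ι → Finset G) (hA : ∀ c ∈ C, (A c).Nonempty)
    (hdisj : (C : Set ι).PairwiseDisjoint A) : D (C.biUnion A) ≤ ∑ c ∈ C, D (A c) := by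
  classical
  induction hC using Finset.Nonempty.cons_induction with
  | singleton a => simp
  | cons a s ha hs ih =>
    rw [Finset.sum_cons, Finset.cons_eq_insert, Finset.biUnion_insert]
    rw [Finset.coe_cons] at hdisj
    have hA' : ∀ c ∈ s, (A c).Nonempty := fun c hc => hA c (Finset.mem_cons_of_mem hc)
    have h1 := ih hA' (hdisj.subset (Set.subset_insert _ _))
    have h2 := hsub (A a) (s.biUnion A) (hA a (Finset.mem_cons_self _ _))
      (hs.biUnion hA') ((Finset.disjoint_biUnion_right _ _ _).2 fun c hc =>
        hdisj (Set.mem_insert _ _) (Set.mem_insert_of_mem _ hc) (by rintro rfl; exact ha hc))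
    linarith

theorem le_sum_of_packing {ι : Type*}
    (hsub : ∀ A B : Finset G, A.Nonempty → B.Nonempty → Disjoint A B → D (A ∪ B) ≤ D A + D B)
    (hneg : ∀ A : Finset G, A.Nonempty → D A ≤ 0) {F : Finset G} (hF : F.Nonempty)
    (C : Finset ι) (A : ι → Finset G) (hA : ∀ c ∈ C, (A c).Nonempty) (hAF : ∀ c ∈ C, A c ⊆ F)
    (hdisj : (C : Set ι).PairwiseDisjoint A) : D F ≤ ∑ c ∈ C, D (A c) := by
  rcases C.eq_empty_or_nonempty with rfl | hC
  · simpa using hneg F hF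
  · exact (le_of_subset_of_subadditive_of_nonpos hsub hneg (hC.biUnion hA)
      (Finset.biUnion_subset.2 hAF)).trans (biUnion_le_sum_of_subadditive hsub hC A hA hdisj)

theorem sum_levelSets_le_of_stronglySubadditive {ι : Type*} [DecidableEq ι]
    (h0 : D ∅ = 0) (hst : ∀ A B : Finset G, D (A ∩ B) + D (A ∪ B) ≤ D A + D B) (F : Finset G)
    (A : ι → Finset G) (C : Finset ι) (hAF : ∀ c ∈ C, A c ⊆ F) (N : ℕ) (hN : C.card ≤ N) :
    ∑ j ∈ Finset.range N, D (F.filter fun x => j < (C.filter fun c => x ∈ A c).card)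
      ≤ ∑ c ∈ C, D (A c) := by
  induction C using Finset.induction_on with
  | empty => simp [h0]
  | insert a s ha ih =>
    rw [Finset.card_insert_of_notMem ha] at hN
    have haF := hAF a (Finset.mem_insert_self _ _)
    have ih' := ih (fun c hc => hAF c (Finset.mem_insert_of_mem hc)) (by omega)
    set cnt : G → ℕ := fun x => (s.filter fun c => x ∈ A c).card with hcnt
    have hcnt_le : ∀ x, cnt x ≤ s.card := fun x => Finset.card_filter_le _ _
    have hins : ∀ x, ((insert a s).filter fun c => x ∈ A c).card
        = cnt x + if x ∈ A a then 1 else 0 := fun x => by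
      rw [Finset.filter_insert]
      split_ifs with hx
      · rw [Finset.card_insert_of_notMem (by simp [ha])]
      · rfl
    set S : ℕ → Finset G := fun j => (A a).filter fun x => j ≤ cnt x with hS
    have hstep : ∀ j, D (F.filter fun x => j < ((insert a s).filter fun c => x ∈ A c).card)
        ≤ D (F.filter fun x => j < cnt x) + (D (S j) - D (S (j + 1))) := fun j => by
      have h1 : (F.filter fun x => j < cnt x) ∩ S j = S (j + 1) := by
        ext x
        simp only [hS, Finset.mem_inter, Finset.mem_filter]
        constructor
        · rintro ⟨⟨_, h⟩, h', _⟩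
          exact ⟨h', h⟩
        · rintro ⟨h, h'⟩
          exact ⟨⟨haF h, h'⟩, h, by omega⟩
      have h2 : (F.filter fun x => j < cnt x) ∪ S j
          = F.filter fun x => j < ((insert a s).filter fun c => x ∈ A c).card := by
        ext x
        simp only [hS, hins, Finset.mem_union, Finset.mem_filter]
        by_cases hx : x ∈ A a
        · have := haF hx
          simp only [hx, this, true_and, if_true]
          omega
        · simp [hx]
      have h3 := hst (F.filter fun x => j < cnt x) (S j)
      rw [h1, h2] at h3
      linarith
    have hS0 : S 0 = A a := by simp [hS]
    have hSN : S N = ∅ := by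
      refine Finset.filter_eq_empty_iff.2 fun x _ => ?_
      have := hcnt_le x
      omega
    have hsum := Finset.sum_le_sum fun j (_ : j ∈ Finset.range N) => hstep j
    rw [Finset.sum_add_distrib, Finset.sum_range_sub', hS0, hSN, h0] at hsum
    rw [Finset.sum_insert ha]
    linarith

theorem nsmul_le_sum_of_stronglySubadditive {ι : Type*} [DecidableEq ι]
    (h0 : D ∅ = 0) (hst : ∀ A B : Finset G, D (A ∩ B) + D (A ∪ B) ≤ D A + D B)
    (hneg : ∀ A : Finset G, A.Nonempty → D A ≤ 0) {F : Finset G}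
    (C : Finset ι) (A : ι → Finset G) (hAF : ∀ c ∈ C, A c ⊆ F) {k : ℕ}
    (hk : ∀ x ∈ F, (C.filter fun c => x ∈ A c).card ≤ k) : k * D F ≤ ∑ c ∈ C, D (A c) := by
  have hsub : ∀ A B : Finset G, A.Nonempty → B.Nonempty → Disjoint A B →
      D (A ∪ B) ≤ D A + D B := fun A B _ _ hAB => by
    have := hst A B
    rwa [Finset.disjoint_iff_inter_eq_empty.1 hAB, h0, zero_add] at this
  refine le_trans ?_ (sum_levelSets_le_of_stronglySubadditive h0 hst F A C hAF (k + C.card)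
    (by omega))
  rw [Finset.sum_range_add]
  have h1 : ∀ j, D (F.filter fun x => k + j < (C.filter fun c => x ∈ A c).card) = 0 := fun j => by
    rw [Finset.filter_eq_empty_iff.2 fun x hx => ?_, h0]
    have := hk x hx
    omega
  have hmono : ∀ B, B ⊆ F → D F ≤ D B := fun B hB => by
    rcases B.eq_empty_or_nonempty with rfl | hB'
    · rcases F.eq_empty_or_nonempty with rfl | hF
      · rfl
      · rw [h0]
        exact hneg F hF
    · exact le_of_subset_of_subadditive_of_nonpos hsub hneg hB' hB
  simp only [h1, Finset.sum_const_zero, add_zero]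
  calc (k : ℝ) * D F = ∑ j ∈ Finset.range k, D F := by simp
    _ ≤ _ := Finset.sum_le_sum fun j _ => hmono _ (Finset.filter_subset _ _)

end SetFunction

theorem MeasureTheory.TendstoInMeasure.sub_of_tendsto_ae {Y : Type*} [MeasurableSpace Y]
    {ν : Measure Y} [IsFiniteMeasure ν] {f g : ℕ → Y → ℝ} {a b : Y → ℝ}
    (hf : ∀ n, AEStronglyMeasurable (f n) ν) (hg : ∀ n, AEStronglyMeasurable (g n) ν)
    (hfa : ∀ᵐ y ∂ν, Tendsto (fun n => f n y) atTop (𝓝 (a y))) (hgb : TendstoInMeasure ν g atTop b) :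
    TendstoInMeasure ν (fun n y => f n y - g n y) atTop (fun y => a y - b y) := by
  refine (exists_seq_tendstoInMeasure_atTop_iff fun n => (hf n).sub (hg n)).2 ?_
  intro φ hφ
  obtain ⟨ψ, hψ, h⟩ := (hgb.comp hφ.tendsto_atTop).exists_seq_tendsto_ae
  refine ⟨ψ, hψ, ?_⟩
  filter_upwards [hfa, h] with y h1 h2
  exact (h1.comp (hφ.comp hψ).tendsto_atTop).sub h2

/-- The limit in measure of nonpositive functions is integrable with integral at least the
limit superior of the integrals. -/
theorem integrable_and_eventually_integral_le {Y : Type*} [MeasurableSpace Y]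
    {ν : Measure Y} {r : ℕ → Y → ℝ} {L : Y → ℝ} (hr : TendstoInMeasure ν r atTop L)
    (hint : ∀ n, Integrable (r n) ν) (hneg : ∀ n, ∀ᵐ y ∂ν, r n y ≤ 0) {c : ℝ}
    (hc : ∀ n, c ≤ ∫ y, r n y ∂ν) :
    Integrable L ν ∧ ∀ ε : ℝ, 0 < ε → ∀ᶠ n in atTop, ∫ y, r n y ∂ν ≤ ∫ y, L y ∂ν + ε := by
  have hr' : TendstoInMeasure ν (fun n y => -r n y) atTop fun y => -L y := fun ε hε => by
    simpa only [edist_neg_neg] using hr ε hε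
  have key := fun c' => hr'.integrable_and_integral_le (fun n => (hint n).neg)
    (fun n => (hneg n).mono fun y hy => neg_nonneg.2 hy) (c := c')
  simp only [integral_neg] at key
  have hL := (key (-c) (Frequently.of_forall fun n => neg_le_neg (hc n))).1
  refine ⟨by simpa using! hL.neg, fun ε hε => ?_⟩
  by_contra hcon
  have h2 := (key (-(∫ y, L y ∂ν + ε)) ((not_eventually.1 hcon).mono fun n hn => by
    linarith [not_le.1 hn])).2
  linarith

theorem tilesWith_one_top {G : Type*} [Group G] :
    TilesWith ({1} : Finset G) ((⊤ : Subgroup G) : Set G) :=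
  fun x => ⟨x, ⟨trivial, 1, by simp⟩, by rintro c ⟨-, t, ht, rfl⟩; simp_all⟩

section Core

variable {G : Type*} [Group G] [DecidableEq G] {Y : Type*} [MeasurableSpace Y] [MulAction G Y]
  {ν : Measure Y}

theorem integral_abs_comp_sub_le {T : Y → Y} (hT : MeasurePreserving T ν ν) {L Q : Y → ℝ}
    (hL : Integrable L ν) (hQ : Integrable Q ν) (h1 : ∀ᵐ y ∂ν, L y ≤ Q y)
    (h2 : ∀ᵐ y ∂ν, L (T y) ≤ Q y) :
    ∫ y, |L (T y) - L y| ∂ν ≤ 2 * (∫ y, Q y ∂ν - ∫ y, L y ∂ν) := by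
  have hLT : Integrable (fun y => L (T y)) ν := hT.integrable_comp_of_integrable hL
  have hQL : Integrable (fun y => 2 * Q y - L (T y)) ν := (hQ.const_mul 2).sub hLT
  have h3 : ∫ y, (2 * Q y - L (T y) - L y) ∂ν = 2 * (∫ y, Q y ∂ν - ∫ y, L y ∂ν) := by
    rw [integral_sub hQL hL, integral_sub (hQ.const_mul 2) hLT,
      integral_const_mul, hT.integral_comp_eq hL.aestronglyMeasurable]
    ring
  rw [← h3]
  refine integral_mono_ae (hLT.sub hL).abs (hQL.sub hL) ?_
  filter_upwards [h1, h2] with y hy1 hy2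
  exact abs_le.2 ⟨by linarith, by linarith⟩

theorem ae_comp_eq_of_forall_integral_abs_le {T : Y → Y} (hT : MeasurePreserving T ν ν)
    {L : Y → ℝ} (hL : Integrable L ν)
    (h : ∀ ε : ℝ, 0 < ε → ∫ y, |L (T y) - L y| ∂ν ≤ ε) : ∀ᵐ y ∂ν, L (T y) = L y := by
  have hLT : Integrable (fun y => L (T y)) ν := hT.integrable_comp_of_integrable hL
  have h0 : ∫ y, |L (T y) - L y| ∂ν = 0 :=
    le_antisymm (le_of_forall_pos_le_add fun ε hε => by simpa using h ε hε)
      (integral_nonneg fun _ => abs_nonneg _)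
  have habs : Integrable (fun y => |L (T y) - L y|) ν := (hLT.sub hL).abs
  rw [integral_eq_zero_iff_of_nonneg (fun _ => abs_nonneg _) habs] at h0
  filter_upwards [h0] with y hy
  exact sub_eq_zero.1 (abs_eq_zero.1 hy)

theorem TilesWith.disjoint_image_s15 {T : Finset G} {H : Subgroup G} (hT : TilesWith T (H : Set G))
    (g : G) : (H : Set G).PairwiseDisjoint fun c => (T.image (g * ·)).image (· * c) := by
  intro a ha b hb hab
  rw [Function.onFun, Finset.disjoint_left]
  intro x hxa hxb
  simp only [Finset.mem_image, exists_exists_and_eq_and] at hxa hxb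
  obtain ⟨t, ht, rfl⟩ := hxa
  obtain ⟨s, hs, hst⟩ := hxb
  rw [mul_assoc, mul_assoc] at hst
  exact hab ((hT (t * a)).unique ⟨ha, t, ht, rfl⟩ ⟨hb, s, hs, (mul_left_cancel hst).symm⟩)

theorem card_filter_mem_image_mul_le (T C : Finset G) (x : G) :
    (C.filter fun c => x ∈ T.image (· * c)).card ≤ T.card := by
  have : (C.filter fun c => x ∈ T.image (· * c)) ⊆ T.image fun t => t⁻¹ * x := by
    intro c hc
    obtain ⟨t, ht, rfl⟩ := Finset.mem_image.1 (Finset.mem_filter.1 hc).2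
    exact Finset.mem_image.2 ⟨t, ht, by simp⟩
  exact (Finset.card_le_card this).trans Finset.card_image_le

/-- Invariance of the limit for nonpositive families. -/
theorem ae_invariant_of_nonpos [IsProbabilityMeasure ν]
    (hact : ∀ g : G, MeasurePreserving (fun y => g • y) ν ν)
    {d : Finset G → Y → ℝ} (hint : ∀ A : Finset G, A.Nonempty → Integrable (d A) ν)
    (hinv : ∀ᵐ y ∂ν, ∀ A : Finset G, A.Nonempty → ∀ g : G, d (A.image (· * g)) y = d A (g • y))
    (hsub : ∀ᵐ y ∂ν, ∀ A B : Finset G, A.Nonempty → B.Nonempty → Disjoint A B →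
      d (A ∪ B) y ≤ d A y + d B y)
    (hneg : ∀ᵐ y ∂ν, ∀ A : Finset G, A.Nonempty → d A y ≤ 0)
    {F : ℕ → Finset G} (hF : IsFolner F) {H : ℕ → Subgroup G}
    (htile : ∀ n, TilesWith (F n) (H n : Set G))
    {L : Y → ℝ} (hL : TendstoInMeasure ν (fun n y => d (F n) y / (F n).card) atTop L)
    {c₀ : ℝ} (hc₀ : ∀ n, c₀ ≤ ∫ y, d (F n) y / (F n).card ∂ν)
    (hcond : (∀ᵐ y ∂ν, ∀ A : Finset G, A.Nonempty → ∀ g : G,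
        d (A.image (g * ·)) y = d (A.image (· * g)) y) ∨
      (∀ᵐ y ∂ν, d ∅ y = 0 ∧ ∀ A B : Finset G, d (A ∩ B) y + d (A ∪ B) y ≤ d A y + d B y) ∨
      (∀ N : ℕ, ∃ p m, N ≤ p ∧ N ≤ m ∧ (H m : Set G) * (H p : Set G) = Set.univ)) :
    Integrable L ν ∧ ∀ g : G, ∀ᵐ y ∂ν, L (g • y) = L y := by
  have hF0 : ∀ n, (0 : ℝ) < (F n).card := fun n => by exact_mod_cast (hF.1 n).card_pos
  obtain ⟨hLint, hlim⟩ := integrable_and_eventually_integral_le hL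
    (fun n => (hint _ (hF.1 n)).div_const _) (fun n => hneg.mono fun y hy =>
      div_nonpos_of_nonpos_of_nonneg (hy _ (hF.1 n)) (hF0 n).le) hc₀
  refine ⟨hLint, ?_⟩
  have hcancel : ∀ n y, (F n).card * (d (F n) y / (F n).card) = d (F n) y := fun n y =>
    mul_div_cancel₀ _ (hF0 n).ne'
  have hred : ∀ (T : Y → Y), MeasurePreserving T ν ν →
      (∃ᶠ m in atTop, ∫ y, |L (T y) - L y| ∂ν
        ≤ 2 * (∫ y, d (F m) y / (F m).card ∂ν - ∫ y, L y ∂ν)) → ∀ᵐ y ∂ν, L (T y) = L y := by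
    intro T hT h
    refine ae_comp_eq_of_forall_integral_abs_le hT hLint fun ε hε => ?_
    obtain ⟨m, hm, hm'⟩ := (h.and_eventually (hlim (ε / 2) (by positivity))).exists
    linarith
  have hpack : ∀ m g K, (F m).image (g * ·) ⊆ K → ∀ n, ∀ᵐ y ∂ν,
      d (F n) y ≤ ∑ c ∈ innerCenters (H m) K (F n), d ((F m).image (g * ·)) (c • y) := by
    intro m g K hK n
    filter_upwards [hinv, hsub, hneg] with y h1 h2 h3
    have hne := (hF.1 m).image (g * ·)
    rw [← Finset.sum_congr rfl fun c _ => h1 _ hne c]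
    refine le_sum_of_packing (D := fun A => d A y) h2 h3 (hF.1 n) _ _ (fun c _ => hne.image _)
      (fun c hc => ?_) (((htile m).disjoint_image_s15 g).subset fun c hc =>
        (mem_innerCenters.1 hc).2.1)
    refine Finset.image_subset_iff.2 fun x hx => (mem_innerCenters.1 hc).2.2 x (hK hx)
  have hpack1 : ∀ m K, F m ⊆ K → ∀ n, ∀ᵐ y ∂ν,
      (F n).card * (d (F n) y / (F n).card)
        ≤ ∑ c ∈ innerCenters (H m) K (F n), d (F m) (c • (1 : G) • y) := by
    intro m K hK n
    have := hpack m 1 K (by simpa using hK) n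
    simpa only [hcancel, one_smul, one_mul, Finset.image_id'] using this
  rcases hcond with hbi | hst | hprod
  · intro g
    refine hred _ (hact g) (Frequently.of_forall fun m => ?_)
    set K := F m ∪ (F m).image (g⁻¹ * ·)
    obtain ⟨Q, hQ, -, hQint, hQle⟩ := exists_invariant_upper_bound hact hF hL (H m)
      (htile m) K (hint _ (hF.1 m)) (hneg.mono fun y hy => hy _ (hF.1 m))
    have hLQ := hQle 1 (hpack1 m K Finset.subset_union_left)
    simp only [one_smul] at hLQ
    have hLQ' := hQle g⁻¹ fun n => by
      filter_upwards [hpack m g⁻¹ K Finset.subset_union_right n,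
        hinv, hbi] with y h1 h2 h3
      rw [hcancel]
      refine h1.trans_eq (Finset.sum_congr rfl fun c _ => ?_)
      have hne := hF.1 m
      rw [← h2 _ (hne.image _), ← mul_smul, ← h2 _ hne]
      have h4 := h3 _ (hne.image (· * c)) g⁻¹
      simpa only [Finset.image_image, Function.comp_def, mul_assoc] using h4
    have h := integral_abs_comp_sub_le (hact g) hLint hQ hLQ (by
      filter_upwards [(hact g).quasiMeasurePreserving.ae hLQ'] with y h1
      rwa [inv_smul_smul] at h1)
    rwa [hQint, inv_mul_eq_div, ← integral_div] at h
  · intro g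
    refine hred _ (hact g) (Frequently.of_forall fun m => ?_)
    obtain ⟨Q, hQ, hQinv, hQint, hQle⟩ := exists_invariant_upper_bound hact hF hL ⊤
      tilesWith_one_top (F m) ((hint _ (hF.1 m)).div_const (F m).card)
      (hneg.mono fun y hy => div_nonpos_of_nonpos_of_nonneg (hy _ (hF.1 m)) (hF0 m).le)
    have hLQ := hQle 1 fun n => by
      filter_upwards [hinv, hsub, hneg, hst] with y h1 h2 h3 h4
      simp only [hcancel, one_smul]
      rw [← Finset.sum_div, le_div_iff₀ (hF0 m), mul_comm,
        ← Finset.sum_congr rfl fun c _ => h1 _ (hF.1 m) c]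
      refine nsmul_le_sum_of_stronglySubadditive (D := fun A => d A y) h4.1 h4.2 h3 _ _
        (fun c hc => Finset.image_subset_iff.2 (mem_innerCenters.1 hc).2.2) fun x _ => ?_
      exact card_filter_mem_image_mul_le _ _ _
    simp only [one_smul] at hLQ
    have h := integral_abs_comp_sub_le (hact g) hLint hQ hLQ (by
      filter_upwards [(hact g).quasiMeasurePreserving.ae hLQ, hQinv g trivial] with y h1 h2
      rwa [h2] at h1)
    rwa [hQint, Finset.card_singleton, Nat.cast_one, inv_one, one_mul] at h
  · have hH : ∀ m, ∀ h ∈ H m, ∫ y, |L (h • y) - L y| ∂ν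
        ≤ 2 * (∫ y, d (F m) y / (F m).card ∂ν - ∫ y, L y ∂ν) := by
      intro m h hh
      obtain ⟨Q, hQ, hQinv, hQint, hQle⟩ := exists_invariant_upper_bound hact hF hL (H m)
        (htile m) (F m) (hint _ (hF.1 m)) (hneg.mono fun y hy => hy _ (hF.1 m))
      have hLQ := hQle 1 (hpack1 m (F m) subset_rfl)
      simp only [one_smul] at hLQ
      have h := integral_abs_comp_sub_le (hact h) hLint hQ hLQ (by
        filter_upwards [(hact h).quasiMeasurePreserving.ae hLQ, hQinv h hh] with y h1 h2
        rwa [h2] at h1)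
      rwa [hQint, inv_mul_eq_div, ← integral_div] at h
    intro g
    refine ae_comp_eq_of_forall_integral_abs_le (hact g) hLint fun ε hε => ?_
    obtain ⟨N, hN⟩ := eventually_atTop.1 (hlim (ε / 4) (by positivity))
    obtain ⟨p, m, hp, hm, hpm⟩ := hprod N
    obtain ⟨a, ha, b, hb, hab⟩ : g ∈ (H m : Set G) * (H p : Set G) := by rw [hpm]; trivial
    have hcomp : ∀ c : G, Integrable (fun y => L (c • y)) ν := fun c =>
      (hact c).integrable_comp_of_integrable hLint
    have h1 : Integrable (fun y => |L (a • y) - L y|) ν := ((hcomp a).sub hLint).abs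
    have h2 : Integrable (fun y => |L (b • y) - L y|) ν := ((hcomp b).sub hLint).abs
    have h3 : Integrable (fun y => |L (a • b • y) - L (b • y)|) ν :=
      (hact b).integrable_comp_of_integrable h1
    have h4 := (hact b).integral_comp_eq h1.aestronglyMeasurable
    calc ∫ y, |L (g • y) - L y| ∂ν
        ≤ ∫ y, (|L (a • b • y) - L (b • y)| + |L (b • y) - L y|) ∂ν := by
          refine integral_mono ((hcomp g).sub hLint).abs (h3.add h2) fun y => ?_
          simp only [← hab, mul_smul]
          exact abs_sub_le _ _ _
      _ = ∫ y, |L (a • y) - L y| ∂ν + ∫ y, |L (b • y) - L y| ∂ν := by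
          rw [integral_add h3 h2, h4]
      _ ≤ ε := by linarith [hH m a ha, hH p b hb, hN m hm, hN p hp]

end Core

/-- Theorem 5.3(3) of the paper: under the hypotheses of the pointwise sub-additive ergodic
theorem, if additionally (i) the family `𝐃` is `G`-bi-invariant, or (ii) `𝐃` is strongly
sub-additive, or (iii) for every `N` there are `p, m ∈ 𝒩` with `p, m ≥ N` and
`G_{F_m} G_{F_p} = G`, then the a.e. limit function `d = lim_n d_{F_n}/|F_n|` is
`G`-invariant. -/
theorem limit_invariant_of_conditions
    {G : Type*} [Group G] [Countable G] [Infinite G] [DecidableEq G]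
    {Y : Type*} [MeasurableSpace Y] [MulAction G Y]
    (ν : Measure Y) [IsProbabilityMeasure ν]
    (hact : ∀ g : G, MeasurePreserving (fun y => g • y) ν ν)
    (d : Finset G → Y → ℝ)
    (hint : ∀ F : Finset G, F.Nonempty → Integrable (d F) ν)
    (hinv : ∀ F : Finset G, F.Nonempty → ∀ g : G,
      ∀ᵐ y ∂ν, d (F.image (· * g)) y = d F (g • y))
    (hsub : ∀ E F : Finset G, E.Nonempty → F.Nonempty → Disjoint E F →
      ∀ᵐ y ∂ν, d (E ∪ F) y ≤ d E y + d F y)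
    (hνD : ⊥ < ⨅ T ∈ {T : Finset G | Tiles T},
      (((T.card : ℝ)⁻¹ * ∫ y, d T y ∂ν : ℝ) : EReal))
    (F : ℕ → Finset G) (hF : IsFolner F)
    (H : ℕ → Subgroup G) (π : ∀ n, G ≃* H n)
    (htile : ∀ n, TilesWith (F n) ((H n : Set G)))
    (M : ℝ) (hM : 0 < M) (hTemp : TempelmanWith F M)
    (𝒩 : Set ℕ) (h𝒩 : 𝒩.Infinite)
    (happrox : ∀ m ∈ 𝒩, ∀ δ : ℝ, 0 < δ → ∀ᶠ p in atTop, ∃ n₁ n₂ : ℕ,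
      F p ⊆ F m * ((F n₁).image fun x => ((π m x : G))) ∧
      F m * ((F n₂).image fun x => ((π m x : G))) ⊆ F p ∧
      (((F n₁).card : ℝ) - ((F n₂).card : ℝ)) / ((F p).card : ℝ) < δ)
    (hcond :
      (∀ E : Finset G, E.Nonempty → ∀ g : G,
        ∀ᵐ y ∂ν, d (E.image (g * ·)) y = d (E.image (· * g)) y) ∨
      ((∀ y, d ∅ y = 0) ∧ ∀ E E' : Finset G,
        ∀ᵐ y ∂ν, d (E ∩ E') y + d (E ∪ E') y ≤ d E y + d E' y) ∨
      (∀ N : ℕ, ∃ p ∈ 𝒩, ∃ m ∈ 𝒩, N ≤ p ∧ N ≤ m ∧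
        (H m : Set G) * (H p : Set G) = Set.univ))
    (dlim : Y → ℝ)
    (hlim : ∀ᵐ y ∂ν, Tendsto (fun n => d (F n) y / ((F n).card : ℝ)) atTop (𝓝 (dlim y))) :
    ∀ g : G, ∀ᵐ y ∂ν, dlim (g • y) = dlim y := by
  have hinv' : ∀ᵐ y ∂ν, ∀ A : Finset G, A.Nonempty → ∀ g : G,
      d (A.image (· * g)) y = d A (g • y) := ae_all_iff.2 fun A => by
    by_cases hA : A.Nonempty
    · simpa only [hA, true_imp_iff] using ae_all_iff.2 (hinv A hA)
    · simp [hA]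
  have hsub' : ∀ᵐ y ∂ν, ∀ A B : Finset G, A.Nonempty → B.Nonempty → Disjoint A B →
      d (A ∪ B) y ≤ d A y + d B y := ae_all_iff.2 fun A => ae_all_iff.2 fun B => by
    by_cases h : A.Nonempty ∧ B.Nonempty ∧ Disjoint A B
    · exact (hsub A B h.1 h.2.1 h.2.2).mono fun y hy _ _ _ => hy
    · exact Eventually.of_forall fun y h1 h2 h3 => absurd ⟨h1, h2, h3⟩ h
  set D : Finset G → Y → ℝ := fun A y => d A y - ∑ f ∈ A, d {f} y with hD
  have hs : ∀ f : G, Integrable (d {f}) ν := fun f => hint _ (Finset.singleton_nonempty f)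
  have hsint : ∀ A : Finset G, Integrable (fun y => ∑ f ∈ A, d {f} y) ν := fun A =>
    integrable_finsetSum A fun f _ => hs f
  have hDint : ∀ A : Finset G, A.Nonempty → Integrable (D A) ν := fun A hA =>
    (hint A hA).sub (hsint A)
  have hone : ∀ᵐ y ∂ν, ∀ f : G, d {f} y = d {1} (f • y) := by
    filter_upwards [hinv'] with y hy f
    simpa using hy {1} (Finset.singleton_nonempty 1) f
  obtain ⟨P, hP, hPinv, -, hPlim⟩ := exists_invariant_limit_average hact ⊤ F
    (fun _ _ _ => trivial) (Eventually.of_forall hF.1) (fun g _ => hF.2 g) (hs 1)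
  have havg : ∀ A : Finset G, Integrable (fun y => ∑ c ∈ A, d {1} (c • y)) ν := fun A =>
    integrable_finsetSum A fun c _ => (hact c).integrable_comp_of_integrable (hs 1)
  have hlimD : TendstoInMeasure ν (fun n y => D (F n) y / (F n).card) atTop
      fun y => dlim y - P y := by
    refine (MeasureTheory.TendstoInMeasure.sub_of_tendsto_ae
      (fun n => ((hint _ (hF.1 n)).div_const _).aestronglyMeasurable)
      (fun n => ((havg (F n)).const_mul _).aestronglyMeasurable)
      hlim hPlim).congr_left fun n => ?_
    filter_upwards [hone] with y hy
    simp only [hD, hy]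
    ring
  obtain ⟨c, -, hc⟩ := EReal.lt_iff_exists_real_btwn.1 hνD
  have hcn : ∀ n, c - ∫ y, d {1} y ∂ν ≤ ∫ y, D (F n) y / (F n).card ∂ν := fun n => by
    have h1 : c ≤ ((F n).card : ℝ)⁻¹ * ∫ y, d (F n) y ∂ν := by
      have hT : F n ∈ {T : Finset G | Tiles T} := ⟨hF.1 n, H n, htile n⟩
      exact_mod_cast hc.le.trans (iInf₂_le (F n) hT)
    have h2 : ∀ f, ∫ y, d {f} y ∂ν = ∫ y, d {1} y ∂ν := fun f => by
      rw [← (hact f).integral_comp_eq (hs 1).aestronglyMeasurable]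
      exact integral_congr_ae (hone.mono fun y hy => hy f)
    have h3 : ((F n).card : ℝ) ≠ 0 := by exact_mod_cast (hF.1 n).card_pos.ne'
    rw [integral_div, integral_sub (hint _ (hF.1 n)) (hsint _),
      integral_finsetSum _ fun f _ => hs f, Finset.sum_congr rfl fun f _ => h2 f,
      Finset.sum_const, nsmul_eq_mul, sub_div, mul_div_cancel_left₀ _ h3, div_eq_inv_mul]
    linarith
  suffices hmain : ∀ g : G, ∀ᵐ y ∂ν, dlim (g • y) - P (g • y) = dlim y - P y by
    intro g
    filter_upwards [hmain g, hPinv g trivial] with y h1 h2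
    linarith
  refine (ae_invariant_of_nonpos hact hDint ?_ ?_ ?_ hF htile hlimD hcn ?_).2
  · filter_upwards [hinv', hone, ae_all_iff.2 fun g => (hact g).quasiMeasurePreserving.ae hone]
      with y h1 h2 h3 A hA g
    simp only [hD, h1 A hA g, Finset.sum_image fun a _ b _ h => mul_right_cancel h, h2, h3,
      mul_smul, one_smul]
  · filter_upwards [hsub'] with y hy A B hA hB hAB
    have := hy A B hA hB hAB
    simp only [hD, Finset.sum_union hAB]
    linarith
  · filter_upwards [hsub'] with y hy A hA
    have := biUnion_le_sum_of_subadditive (D := fun B => d B y) hy hA (fun f => {f})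
      (fun f _ => Finset.singleton_nonempty f) fun a _ b _ hab => by simpa using hab
    rw [Finset.biUnion_singleton_eq_self] at this
    exact sub_nonpos.2 this
  · refine hcond.imp (fun hbi => ?_) (Or.imp (fun hst => ?_) fun hprod N => ?_)
    · have hbi' : ∀ᵐ y ∂ν, ∀ A : Finset G, A.Nonempty → ∀ g : G,
          d (A.image (g * ·)) y = d (A.image (· * g)) y := ae_all_iff.2 fun A => by
        by_cases hA : A.Nonempty
        · simpa only [hA, true_imp_iff] using ae_all_iff.2 (hbi A hA)
        · simp [hA]
      filter_upwards [hbi'] with y hy A hA g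
      have h1 : ∀ f : G, d {g * f} y = d {f * g} y := fun f => by
        simpa using hy {f} (Finset.singleton_nonempty f) g
      simp only [hD, hy A hA g, Finset.sum_image fun a _ b _ h => mul_right_cancel h,
        Finset.sum_image fun a _ b _ h => mul_left_cancel h, h1]
    · filter_upwards [ae_all_iff.2 fun A => ae_all_iff.2 (hst.2 A)] with y hy
      refine ⟨by simp [hD, hst.1 y], fun A B => ?_⟩
      have h1 := hy A B
      have h2 := Finset.sum_union_inter (s₁ := A) (s₂ := B) (f := fun f => d {f} y)
      simp only [hD]
      linarith
    · obtain ⟨p, -, m, -, h⟩ := hprod N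
      exact ⟨p, m, h⟩
end
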